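/- Let D ⊆ ℂ^N be a strictly pseudoconvex domain and let γ : bD × [0,1] → cl(D) be a C¹ map with γ(x,r) ∈ D for r < 1, γ(x,1) = x and transversal approach, satisfying assumption (†). Let (r_j) be an increasing sequence in (0,1) with r_j → 1. Then the set 𝒲(r_j) of all f ∈ 𝒪(D) such that for every Lebesgue-measurable function h : bD → ℂ there is a subsequence (r_{j_k}) with f(γ(x, r_{j_k})) → h(x) as k → ∞ for almost every x ∈ bD (with respect to surface measure), is residual in 𝒪(D). -/

import Mathlib

open Set Filter Topology Metric MeasureTheory
open scoped ENNReal NNReal InnerProductSpace ComplexConjugate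

noncomputable section

/-- `ℂ^N` with the Euclidean structure. -/
abbrev EN (N : ℕ) := EuclideanSpace ℂ (Fin N)

instance {N : ℕ} : MeasurableSpace (EN N) := borel _
instance {N : ℕ} : BorelSpace (EN N) := ⟨rfl⟩

/-- A domain: a nonempty open connected subset. -/
def IsDomainSet {N : ℕ} (D : Set (EN N)) : Prop := IsOpen D ∧ IsConnected D

/-- `u` is plurisubharmonic on `D`: upper semicontinuous on `D`, and its restriction to
every complex affine line satisfies the sub-mean value inequality on every closed disc
(of that line) contained in `D`. -/
def PlurisubharmonicOn {N : ℕ} (u : EN N → ℝ) (D : Set (EN N)) : Prop :=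
  UpperSemicontinuousOn u D ∧
  ∀ (a b : EN N) (t₀ : ℂ) (r : ℝ), 0 < r →
    (fun t : ℂ => a + t • b) '' Metric.closedBall t₀ r ⊆ D →
    u (a + t₀ • b) ≤ (2 * Real.pi)⁻¹ *
      ∫ θ in (0:ℝ)..(2 * Real.pi), u (a + (t₀ + r * Complex.exp (θ * Complex.I)) • b)

/-- `D` is a pseudoconvex domain: a domain carrying a continuous plurisubharmonic
exhaustion function. -/
def Pseudoconvex {N : ℕ} (D : Set (EN N)) : Prop :=
  IsDomainSet D ∧ ∃ u : EN N → ℝ, ContinuousOn u D ∧ PlurisubharmonicOn u D ∧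
    ∀ c : ℝ, IsCompact (closure {z ∈ D | u z < c}) ∧ closure {z ∈ D | u z < c} ⊆ D

/-- The space `𝒪(D)` of holomorphic functions on `D`, as a submodule of `ℂ^N → ℂ`. -/
def Hol {N : ℕ} (D : Set (EN N)) : Submodule ℂ (EN N → ℂ) where
  carrier := {f | DifferentiableOn ℂ f D}
  add_mem' hf hg := hf.add hg
  zero_mem' := differentiableOn_const 0
  smul_mem' c f hf := hf.const_smul c

/-- The topology of uniform convergence on compact subsets of `D`, on `𝒪(D)`. -/
instance holTopology {N : ℕ} (D : Set (EN N)) : TopologicalSpace ↥(Hol D) :=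
  TopologicalSpace.induced
    (fun f => UniformOnFun.ofFun {K : Set (EN N) | K ⊆ D ∧ IsCompact K} f.1)
    inferInstance

/-- A set is residual if it contains a dense `G_δ` set. -/
def ResidualIn {X : Type*} [TopologicalSpace X] (S : Set X) : Prop :=
  ∃ T : Set X, T ⊆ S ∧ IsGδ T ∧ Dense T

/-- `S` is densely lineable: `S ∪ {0}` contains a dense vector subspace. -/
def DenselyLineableIn {X : Type*} [TopologicalSpace X] [AddCommMonoid X] [Module ℂ X]
    (S : Set X) : Prop :=
  ∃ p : Submodule ℂ X, Dense (p : Set X) ∧ (p : Set X) ⊆ S ∪ {0}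

/-- `S` is spaceable: `S ∪ {0}` contains a closed infinite-dimensional vector subspace. -/
def SpaceableIn {X : Type*} [TopologicalSpace X] [AddCommMonoid X] [Module ℂ X]
    (S : Set X) : Prop :=
  ∃ p : Submodule ℂ X, IsClosed (p : Set X) ∧ ¬ Module.Finite ℂ ↥p ∧ (p : Set X) ⊆ S ∪ {0}

/-- A finite length path to `bD`: continuous and piecewise `C¹` on `[0,1)`, with values in `D`,
finite length (total variation), converging to a boundary point of `D` as `r → 1`. -/
def FiniteLengthPathTo {N : ℕ} (D : Set (EN N)) (γ : ℝ → EN N) : Prop :=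
  MapsTo γ (Ico (0:ℝ) 1) D ∧ ContinuousOn γ (Ico (0:ℝ) 1) ∧
  (∃ u : ℕ → ℝ, u 0 = 0 ∧ StrictMono u ∧ (∀ n, u n < 1) ∧ Tendsto u atTop (𝓝 1) ∧
    ∀ n, ContDiffOn ℝ 1 γ (Icc (u n) (u (n+1)))) ∧
  eVariationOn γ (Ico (0:ℝ) 1) < ⊤ ∧
  ∃ ζ ∈ frontier D, Tendsto γ (𝓝[<] (1:ℝ)) (𝓝 ζ)

/-- The set of `f ∈ 𝒪(D)` with maximal cluster set along every finite length path to `bD`. -/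
def WildSet {N : ℕ} (D : Set (EN N)) : Set ↥(Hol D) :=
  {f | ∀ γ : ℝ → EN N, FiniteLengthPathTo D γ → ∀ c : ℂ,
    ∃ r : ℕ → ℝ, (∀ n, r n ∈ Ico (0:ℝ) 1) ∧ Tendsto r atTop (𝓝 1) ∧
      Tendsto (fun n => f.1 (γ (r n))) atTop (𝓝 c)}

/-- The `𝒪(D)`-hull of `K`. -/
def holHull {N : ℕ} (D K : Set (EN N)) : Set (EN N) :=
  {z ∈ D | ∀ φ : EN N → ℂ, DifferentiableOn ℂ φ D → ‖φ z‖ ≤ ⨆ w ∈ K, ‖φ w‖}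

/-- `K` is `𝒪(D)`-convex. -/
def HolConvexIn {N : ℕ} (D K : Set (EN N)) : Prop := K ⊆ D ∧ holHull D K = K

/-- The polynomial hull of a compact subset of `ℂ`. -/
def polyHull1 (E : Set ℂ) : Set ℂ :=
  {z | ∀ p : Polynomial ℂ, ‖p.eval z‖ ≤ ⨆ w ∈ E, ‖p.eval w‖}

/-- The polynomial hull of a subset of `ℂ^N`. -/
def polyHull {N : ℕ} (E : Set (EN N)) : Set (EN N) :=
  {z | ∀ p : MvPolynomial (Fin N) ℂ,
    ‖MvPolynomial.eval (fun j => z j) p‖ ≤ ⨆ w ∈ E, ‖MvPolynomial.eval (fun j => w j) p‖}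

/-- `E ⊆ ℂ^N` is polynomially convex. -/
def PolynomiallyConvex {N : ℕ} (E : Set (EN N)) : Prop := polyHull E = E

/-- The (real) Hessian of `ρ` at `p`, applied to the pair `(v, w)`. -/
def Hess {N : ℕ} (ρ : EN N → ℝ) (p v w : EN N) : ℝ :=
  fderiv ℝ (fderiv ℝ ρ) p v w

/-- The Levi form `∑_{j,k} ∂²ρ/∂z_j∂z̄_k (p) w_j w̄_k`, expressed through the real Hessian. -/
def LeviForm {N : ℕ} (ρ : EN N → ℝ) (p w : EN N) : ℝ :=
  (Hess ρ p w w + Hess ρ p (Complex.I • w) (Complex.I • w)) / 4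

/-- `w` belongs to the complex tangent space `{w : ∑_j ∂ρ/∂z_j(p) w_j = 0}` at `p`. -/
def ComplexTangent {N : ℕ} (ρ : EN N → ℝ) (p w : EN N) : Prop :=
  fderiv ℝ ρ p w = 0 ∧ fderiv ℝ ρ p (Complex.I • w) = 0

/-- `ρ` is a `C²` defining function for `D` on the open neighborhood `V` of `cl D`. -/
def IsDefiningFunctionOn {N : ℕ} (D : Set (EN N)) (ρ : EN N → ℝ) (V : Set (EN N)) : Prop :=
  IsOpen V ∧ closure D ⊆ V ∧ ContDiffOn ℝ 2 ρ V ∧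
  D = {z ∈ V | ρ z < 0} ∧ ∀ p ∈ frontier D, fderiv ℝ ρ p ≠ 0

/-- `D` is a strictly pseudoconvex domain with defining function `ρ`. -/
def StrictPSCWith {N : ℕ} (D : Set (EN N)) (ρ : EN N → ℝ) : Prop :=
  IsDomainSet D ∧ Bornology.IsBounded D ∧ (∃ V, IsDefiningFunctionOn D ρ V) ∧
  ∀ p ∈ frontier D, ∀ w : EN N, w ≠ 0 → ComplexTangent ρ p w → 0 < LeviForm ρ p w

/-- `D` is a strictly pseudoconvex domain. -/
def StrictlyPseudoconvex {N : ℕ} (D : Set (EN N)) : Prop := ∃ ρ, StrictPSCWith D ρ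

/-- `ρ` and `σ` are at `C²`-distance `< ε` on `V`. -/
def C2DistLt {N : ℕ} (V : Set (EN N)) (ρ σ : EN N → ℝ) (ε : ℝ) : Prop :=
  ∀ z ∈ V, |ρ z - σ z| + ‖fderiv ℝ ρ z - fderiv ℝ σ z‖ +
    ‖fderiv ℝ (fderiv ℝ ρ) z - fderiv ℝ (fderiv ℝ σ) z‖ < ε

/-- The standing assumptions on the map `γ : bD × [0,1] → cl D`: it is `C^k`, maps
`bD × [0,1)` into `D`, satisfies `γ(x,1) = x`, and the curves `r ↦ γ(x,r)` hit `bD`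
transversally at `x` (the `r`-derivative at `1` is not annihilated by `dρ(x)`,
i.e. it is not tangent to `bD` at `x`). -/
def GammaMap {N : ℕ} (D : Set (EN N)) (ρ : EN N → ℝ) (γ : EN N × ℝ → EN N) (k : ℕ) : Prop :=
  ContDiffOn ℝ k γ ((frontier D) ×ˢ Icc (0:ℝ) 1) ∧
  (∀ x ∈ frontier D, ∀ r ∈ Ico (0:ℝ) 1, γ (x, r) ∈ D) ∧
  (∀ x ∈ frontier D, γ (x, 1) = x) ∧
  ∀ x ∈ frontier D, fderiv ℝ ρ x (derivWithin (fun r => γ (x, r)) (Icc (0:ℝ) 1) 1) ≠ 0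

/-- Assumption (†): for all `r` close enough to `1`, `bD_r := γ(bD × {r})` bounds a strictly
pseudoconvex domain `D_r ⊆ D` whose defining function converges to `ρ` in `C²` norm on a
neighborhood `V` of `cl D` as `r → 1`. -/
def Dagger {N : ℕ} (D : Set (EN N)) (ρ : EN N → ℝ) (γ : EN N × ℝ → EN N) : Prop :=
  ∃ V : Set (EN N), IsOpen V ∧ closure D ⊆ V ∧
  ∃ (Dr : ℝ → Set (EN N)) (ρr : ℝ → EN N → ℝ),
    ∀ ε > 0, ∃ r₀ ∈ Ico (0:ℝ) 1, ∀ r ∈ Ioo r₀ 1,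
      StrictPSCWith (Dr r) (ρr r) ∧ Dr r ⊆ D ∧
      frontier (Dr r) = (fun x => γ (x, r)) '' frontier D ∧
      C2DistLt V (ρr r) ρ ε

/-- The `(2N-1)`-dimensional Hausdorff (surface) measure on `bD`. -/
def surfMeasure {N : ℕ} (D : Set (EN N)) : Measure (EN N) :=
  (Measure.hausdorffMeasure (2 * (N:ℝ) - 1)).restrict (frontier D)

/-- The normalized surface measure on `bD`. -/
def surfMeasureNorm {N : ℕ} (D : Set (EN N)) : Measure (EN N) :=
  ((Measure.hausdorffMeasure (2 * (N:ℝ) - 1) : Measure (EN N)) (frontier D))⁻¹ • surfMeasure D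

/-- The set `𝒲((r_j))` of `f ∈ 𝒪(D)` such that every measurable function on `bD` is an
a.e. limit of `f ∘ γ(·, r_{j_k})` along some subsequence of `(r_j)`. -/
def WSet {N : ℕ} (D : Set (EN N)) (γ : EN N × ℝ → EN N) (r : ℕ → ℝ) : Set ↥(Hol D) :=
  {f | ∀ h : EN N → ℂ, Measurable h → ∃ φ : ℕ → ℕ, StrictMono φ ∧
    ∀ᵐ x ∂ surfMeasure D, Tendsto (fun k => f.1 (γ (x, r (φ k)))) atTop (𝓝 (h x))}

/-- `Γ` is a closed cap of a convex set `V`: the closure of a connected component of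
`V \ H` for some real affine hyperplane `H` (for convex `V`, a nonempty open half-space
slice of `V`). -/
def IsClosedCap {N : ℕ} (V : Set (EN N)) (Γ : Set (EN N)) : Prop :=
  ∃ (l : EN N →L[ℝ] ℝ) (c : ℝ), l ≠ 0 ∧ (V ∩ {z | c < l z}).Nonempty ∧
    Γ = closure (V ∩ {z | c < l z})

/-- `V` is a strictly convex domain: a bounded convex domain with `C²` boundary whose
defining function has positive definite real Hessian on the real tangent space. -/
def StrictlyConvexDomain {N : ℕ} (V : Set (EN N)) : Prop :=
  IsDomainSet V ∧ Bornology.IsBounded V ∧ Convex ℝ V ∧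
  ∃ (ρ : EN N → ℝ) (W : Set (EN N)), IsDefiningFunctionOn V ρ W ∧
    ∀ p ∈ frontier V, ∀ w : EN N, w ≠ 0 → fderiv ℝ ρ p w = 0 → 0 < Hess ρ p w w

/-- The defining function `‖z‖² - 1` of the unit ball. -/
def ballRho {N : ℕ} : EN N → ℝ := fun z => ‖z‖ ^ 2 - 1

/-- The normalized surface measure on the unit sphere of `ℂ^N`. -/
def sphMeasure (N : ℕ) : Measure (EN N) :=
  ((Measure.hausdorffMeasure (2 * (N:ℝ) - 1) : Measure (EN N)) (Metric.sphere 0 1))⁻¹ •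
    (Measure.hausdorffMeasure (2 * (N:ℝ) - 1)).restrict (Metric.sphere 0 1)

/-- `v` is a weight: increasing on `[0,∞)`, nonnegative, and tending to `∞`. -/
def IsWeight (v : ℝ → ℝ) : Prop :=
  (∀ x ∈ Ici (0:ℝ), 0 ≤ v x) ∧ MonotoneOn v (Ici 0) ∧ Tendsto v atTop atTop

/-- The norm `‖f‖ = sup_{z ∈ 𝔹_N} |f z| / v(|z|)` of `H_v^0`. -/
def hvNorm {N : ℕ} (v : ℝ → ℝ) (f : EN N → ℂ) : ℝ :=
  ⨆ z ∈ Metric.ball (0:EN N) 1, ‖f z‖ / v ‖z‖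

/-- Membership in `H_v^0`: `f` is holomorphic on `𝔹_N` and `sup_{|z|=r} |f z| / v(r) → 0`
as `r → 1⁻`. -/
def MemHv {N : ℕ} (v : ℝ → ℝ) (f : EN N → ℂ) : Prop :=
  DifferentiableOn ℂ f (Metric.ball 0 1) ∧
  Tendsto (fun r : ℝ => ⨆ z ∈ Metric.sphere (0:EN N) r, ‖f z‖ / v r) (𝓝[<] 1) (𝓝 0)

/-- `S` contains, relatively to `H_v^0` with its norm topology, a dense `G_δ` subset:
there are countably many relatively norm-open sets `U n` whose intersection with `H_v^0`
is norm-dense in `H_v^0` and contained in `S`. -/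
def ResidualInHv {N : ℕ} (v : ℝ → ℝ) (S : Set (EN N → ℂ)) : Prop :=
  ∃ U : ℕ → Set (EN N → ℂ),
    (∀ n, ∀ f, MemHv v f → f ∈ U n →
      ∃ δ > 0, ∀ g, MemHv v g → hvNorm v (g - f) < δ → g ∈ U n) ∧
    (∀ f, MemHv v f → ∀ δ > 0, ∃ g, MemHv v g ∧ (∀ n, g ∈ U n) ∧ hvNorm v (g - f) < δ) ∧
    ∀ f, MemHv v f → (∀ n, f ∈ U n) → f ∈ S

/-- `S` is densely lineable in `H_v^0`: `S ∪ {0}` contains a norm-dense subspace of `H_v^0`. -/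
def DenselyLineableInHv {N : ℕ} (v : ℝ → ℝ) (S : Set (EN N → ℂ)) : Prop :=
  ∃ p : Submodule ℂ (EN N → ℂ), (↑p ⊆ {f : EN N → ℂ | MemHv v f}) ∧ (↑p ⊆ S ∪ {0}) ∧
    ∀ f, MemHv v f → ∀ δ > 0, ∃ g ∈ p, hvNorm v (g - f) < δ

/-- `S` is spaceable in `H_v^0`: `S ∪ {0}` contains a norm-closed infinite-dimensional
subspace of `H_v^0`. -/
def SpaceableInHv {N : ℕ} (v : ℝ → ℝ) (S : Set (EN N → ℂ)) : Prop :=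
  ∃ p : Submodule ℂ (EN N → ℂ), (↑p ⊆ {f : EN N → ℂ | MemHv v f}) ∧ (↑p ⊆ S ∪ {0}) ∧
    ¬ Module.Finite ℂ ↥p ∧
    ∀ f, MemHv v f → (∀ δ > 0, ∃ g ∈ p, hvNorm v (g - f) < δ) → f ∈ p

/-- The standing assumptions on the family `{γ_z : z ∈ 𝔹_N}`: each `γ_z` is a `C¹` map
`b𝔹_N × [0,1] → cl 𝔹_N` into `𝔹_N` for `r < 1` with `γ_z(x,1) = x`, transversal approach
and (†), with joint continuity of `(z,x,r) ↦ γ_z(x,r)` and of `(z,r) ↦ ∂γ_z(x,r)/∂r`. -/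
def BallGammaFamily {N : ℕ} (γ : EN N → EN N × ℝ → EN N) : Prop :=
  (∀ z ∈ Metric.ball (0:EN N) 1,
    GammaMap (Metric.ball 0 1) ballRho (γ z) 1 ∧ Dagger (Metric.ball 0 1) ballRho (γ z)) ∧
  ContinuousOn (fun p : EN N × (EN N × ℝ) => γ p.1 p.2)
    (Metric.ball 0 1 ×ˢ (Metric.sphere 0 1 ×ˢ Icc (0:ℝ) 1)) ∧
  ∀ x ∈ Metric.sphere (0:EN N) 1,
    ContinuousOn (fun p : EN N × ℝ => derivWithin (fun r => γ p.1 (x, r)) (Icc (0:ℝ) 1) p.2)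
      (Metric.ball 0 1 ×ˢ Icc (0:ℝ) 1)

/-- The set of `f` such that for every `z ∈ 𝔹_N`, every measurable function on `b𝔹_N` is an
a.e. limit of `f ∘ γ_z(·, r_{j_k})` along some subsequence of `(r_j)`. -/
def WSetHv {N : ℕ} (γ : EN N → EN N × ℝ → EN N) (r : ℕ → ℝ) : Set (EN N → ℂ) :=
  {f | ∀ z ∈ Metric.ball (0:EN N) 1, ∀ h : EN N → ℂ, Measurable h →
    ∃ φ : ℕ → ℕ, StrictMono φ ∧
      ∀ᵐ x ∂ sphMeasure N, Tendsto (fun k => f (γ z (x, r (φ k)))) atTop (𝓝 (h x))}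

/-- The set `E_L^* = {γ_z(x,r) : x ∈ E, r ∈ [0,1], z ∈ L}`. -/
def EStarSet {N : ℕ} (γ : EN N → EN N × ℝ → EN N) (L E : Set (EN N)) : Set (EN N) :=
  {w | ∃ z ∈ L, ∃ x ∈ E, ∃ r ∈ Icc (0:ℝ) 1, w = γ z (x, r)}

/-- The Korányi approach region `D_α(x)`. -/
def Koranyi {N : ℕ} (α : ℝ) (x : EN N) : Set (EN N) :=
  {z ∈ Metric.ball (0:EN N) 1 | ‖1 - (⟪x, z⟫_ℂ : ℂ)‖ < α / 2 * (1 - ‖z‖ ^ 2)}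

/-- `h` has a `K`-limit at `x`: for every `α > 1` the values of `h` converge along every
sequence in `D_α(x)` converging to `x`. -/
def HasKLimitAt {N : ℕ} (h : EN N → ℂ) (x : EN N) : Prop :=
  ∀ α > (1:ℝ), ∃ c : ℂ, ∀ z : ℕ → EN N, (∀ i, z i ∈ Koranyi α x) →
    Tendsto z atTop (𝓝 x) → Tendsto (fun i => h (z i)) atTop (𝓝 c)

/-- The circle `bL_x = L_x ∩ b𝔹_N` cut out on the complex line through `x` and `0`. -/
def lineCircle {N : ℕ} (x : EN N) : Set (EN N) :=
  {z | ∃ t : ℂ, z = t • x} ∩ Metric.sphere 0 1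

end
noncomputable section
open Set Filter Topology Metric MeasureTheory
open scoped ENNReal NNReal InnerProductSpace ComplexConjugate
namespace LP

/-- Lebesgue (Haar) measure on `ℂ^N`. -/
abbrev LM (N : ℕ) : Measure (EN N) := Measure.addHaar

/-- standard basis vector -/
def eb {N : ℕ} (j : Fin N) : EN N := EuclideanSpace.single j (1:ℂ)

/-- Wirtinger-type derivative `½(∂_x + a ∂_y)`. -/
def cd {N : ℕ} (a : ℂ) (j : Fin N) (w : EN N → ℂ) (z : EN N) : ℂ :=
  (1/2 : ℂ) * (fderiv ℝ w z (eb j) + a * fderiv ℝ w z (Complex.I • eb j))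

/-- test functions of class `C^n` -/
structure Tst {N : ℕ} (n : ℕ) (Ω : Set (EN N)) (w : EN N → ℂ) : Prop where
  smooth : ContDiff ℝ n w
  cpt : HasCompactSupport w
  sub : tsupport w ⊆ Ω

variable {N : ℕ} {Ω : Set (EN N)}

lemma cd_zero_of_notMem_tsupport {a : ℂ} {j : Fin N} {w : EN N → ℂ} {z : EN N}
    (hz : z ∉ tsupport w) : cd a j w z = 0 := by
  have h : w =ᶠ[𝓝 z] 0 := notMem_tsupport_iff_eventuallyEq.1 hz
  have h2 : fderiv ℝ w z = 0 := by
    rw [h.fderiv_eq]; simp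
  simp [cd, h2]

lemma cd_congr {a : ℂ} {j : Fin N} {w u : EN N → ℂ} {z : EN N} (h : w =ᶠ[𝓝 z] u) :
    cd a j w z = cd a j u z := by
  simp [cd, h.fderiv_eq]

lemma cd_add {a : ℂ} {j : Fin N} {w u : EN N → ℂ} {z : EN N} (hw : DifferentiableAt ℝ w z)
    (hu : DifferentiableAt ℝ u z) : cd a j (fun x => w x + u x) z = cd a j w z + cd a j u z := by
  simp only [cd]; rw [fderiv_fun_add hw hu]; simp only [add_apply]; ring

lemma cd_sub {a : ℂ} {j : Fin N} {w u : EN N → ℂ} {z : EN N} (hw : DifferentiableAt ℝ w z)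
    (hu : DifferentiableAt ℝ u z) : cd a j (fun x => w x - u x) z = cd a j w z - cd a j u z := by
  simp only [cd]; rw [fderiv_fun_sub hw hu]; simp only [sub_apply]; ring

lemma cd_neg {a : ℂ} {j : Fin N} {w : EN N → ℂ} {z : EN N} :
    cd a j (fun x => - w x) z = - cd a j w z := by
  simp only [cd]; rw [fderiv_fun_neg]; simp only [neg_apply]; ring

lemma cd_mul {a : ℂ} {j : Fin N} {w u : EN N → ℂ} {z : EN N} (hw : DifferentiableAt ℝ w z)
    (hu : DifferentiableAt ℝ u z) :
    cd a j (fun x => w x * u x) z = cd a j w z * u z + w z * cd a j u z := by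
  simp only [cd]; rw [fderiv_fun_mul hw hu]
  simp only [add_apply, smul_apply, smul_eq_mul]; ring

lemma cd_conj {a : ℂ} {j : Fin N} {w : EN N → ℂ} {z : EN N} (hw : DifferentiableAt ℝ w z) :
    cd a j (fun x => conj (w x)) z = conj (cd (conj a) j w z) := by
  have h : HasFDerivAt (fun x => conj (w x))
      ((Complex.conjCLE : ℂ →L[ℝ] ℂ).comp (fderiv ℝ w z)) z :=
    (Complex.conjCLE : ℂ →L[ℝ] ℂ).hasFDerivAt.comp z hw.hasFDerivAt
  simp only [cd]; rw [h.fderiv]; simp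
  left; exact (map_ofNat (starRingEnd ℂ) 2).symm

lemma Tst.mono {n : ℕ} {Ω' : Set (EN N)} {w : EN N → ℂ} (h : Tst n Ω w) (hs : Ω ⊆ Ω') :
    Tst n Ω' w := ⟨h.1, h.2, h.3.trans hs⟩

lemma Tst.of_le {n m : ℕ} {w : EN N → ℂ} (h : Tst n Ω w) (hs : m ≤ n) :
    Tst m Ω w := ⟨h.1.of_le (by exact_mod_cast hs), h.2, h.3⟩

lemma Tst.mul_left (hΩ : IsOpen Ω) {n : ℕ} {f w : EN N → ℂ} (hf : ContDiffOn ℝ n f Ω)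
    (h : Tst n Ω w) : Tst n Ω (fun z => f z * w z) := by
  have hsub : tsupport (fun z => f z * w z) ⊆ tsupport w := tsupport_mul_subset_right
  refine ⟨?_, h.cpt.mul_left, hsub.trans h.sub⟩
  rw [contDiff_iff_contDiffAt]
  intro z
  by_cases hz : z ∈ Ω
  · exact (hf.contDiffAt (hΩ.mem_nhds hz)).mul h.smooth.contDiffAt
  · have h0 : (fun z => f z * w z) =ᶠ[𝓝 z] 0 :=
      notMem_tsupport_iff_eventuallyEq.1 (fun hh => hz (h.sub (hsub hh)))
    exact contDiffAt_const.congr_of_eventuallyEq h0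

lemma Tst.mul_right (hΩ : IsOpen Ω) {n : ℕ} {f w : EN N → ℂ} (hf : ContDiffOn ℝ n f Ω)
    (h : Tst n Ω w) : Tst n Ω (fun z => w z * f z) := by
  simpa [mul_comm] using h.mul_left hΩ hf

lemma Tst.conj {n : ℕ} {w : EN N → ℂ} (h : Tst n Ω w) : Tst n Ω (fun z => conj (w z)) := by
  have hsub : tsupport (fun z => (starRingEnd ℂ) (w z)) ⊆ tsupport w := by
    apply closure_mono; intro z hz; simpa using hz
  refine ⟨?_, ?_, hsub.trans h.sub⟩
  · exact (Complex.conjCLE : ℂ →L[ℝ] ℂ).contDiff.comp h.smooth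
  · exact h.cpt.comp_left (g := starRingEnd ℂ) (by simp)

lemma Tst.neg {n : ℕ} {w : EN N → ℂ} (h : Tst n Ω w) : Tst n Ω (fun z => - w z) := by
  have hsub : tsupport (fun z => - (w z)) ⊆ tsupport w := by
    apply closure_mono; intro z hz; simpa using hz
  exact ⟨h.smooth.neg, h.cpt.comp_left (g := fun x => -x) (by simp), hsub.trans h.sub⟩

lemma Tst.add {n : ℕ} {w u : EN N → ℂ} (h : Tst n Ω w) (h' : Tst n Ω u) :
    Tst n Ω (fun z => w z + u z) :=
  ⟨h.smooth.add h'.smooth, h.cpt.add h'.cpt,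
    (tsupport_add w u).trans (union_subset h.sub h'.sub)⟩

lemma Tst.sub' {n : ℕ} {w u : EN N → ℂ} (h : Tst n Ω w) (h' : Tst n Ω u) :
    Tst n Ω (fun z => w z - u z) := by
  simpa [sub_eq_add_neg] using h.add h'.neg

lemma Tst.zero {n : ℕ} : Tst n Ω (fun _ => (0:ℂ)) :=
  ⟨contDiff_const, HasCompactSupport.zero, by simp [tsupport]⟩

lemma Tst.sum {n : ℕ} {ι : Type*} (s : Finset ι) {w : ι → EN N → ℂ} (h : ∀ i ∈ s, Tst n Ω (w i)) :
    Tst n Ω (fun z => ∑ i ∈ s, w i z) := by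
  classical
  induction s using Finset.induction_on with
  | empty => simpa using Tst.zero
  | insert a s ha ih =>
    simp only [Finset.sum_insert ha]
    exact (h a (by simp)).add (ih fun i hi => h i (by simp [hi]))

lemma contDiffOn_cd (hΩ : IsOpen Ω) {n : ℕ} {f : EN N → ℂ} (hf : ContDiffOn ℝ (n+1 : ℕ) f Ω)
    (a : ℂ) (j : Fin N) : ContDiffOn ℝ n (cd a j f) Ω := by
  have h1 : ContDiffOn ℝ n (fderiv ℝ f) Ω := hf.fderiv_of_isOpen hΩ (by norm_cast)
  have h2 : ∀ v, ContDiffOn ℝ n (fun z => fderiv ℝ f z v) Ω := fun v => h1.clm_apply contDiffOn_const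
  exact contDiffOn_const.mul ((h2 _).add (contDiffOn_const.mul (h2 _)))

lemma tsupport_cd {a : ℂ} {j : Fin N} {w : EN N → ℂ} : tsupport (cd a j w) ⊆ tsupport w := by
  apply closure_minimal _ (isClosed_tsupport _)
  intro z hz
  by_contra h
  exact hz (cd_zero_of_notMem_tsupport h)

lemma Tst.cd {n : ℕ} {w : EN N → ℂ} (h : Tst (n+1) Ω w) (a : ℂ) (j : Fin N) :
    Tst n Ω (cd a j w) := by
  refine ⟨?_, ?_, tsupport_cd.trans h.sub⟩
  · rw [← contDiffOn_univ]; exact contDiffOn_cd isOpen_univ h.smooth.contDiffOn a j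
  · exact h.cpt.mono' ((subset_tsupport _).trans tsupport_cd)

lemma Tst.integrable {n : ℕ} {w : EN N → ℂ} (h : Tst n Ω w) : Integrable w (LM N) :=
  h.smooth.continuous.integrable_of_hasCompactSupport h.cpt

lemma Tst.diff {n : ℕ} {w : EN N → ℂ} (h : Tst (n+1) Ω w) : Differentiable ℝ w :=
  h.smooth.differentiable (by norm_cast)

lemma integral_fderiv_zero {w : EN N → ℂ} (h : Tst 1 Ω w) (v : EN N) :
    ∫ z, fderiv ℝ w z v ∂(LM N) = 0 := by
  have hc : Continuous (fun z => fderiv ℝ w z v) :=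
    (h.smooth.continuous_fderiv (by norm_num)).clm_apply continuous_const
  have hcs : HasCompactSupport (fun z => fderiv ℝ w z v) := h.cpt.fderiv_apply (𝕜 := ℝ) v
  have := integral_mul_fderiv_eq_neg_fderiv_mul_of_integrable (μ := LM N) (f := fun _ => (1:ℂ))
    (g := w) (v := v) (by simp) (by simpa using hc.integrable_of_hasCompactSupport hcs)
    (by simpa using h.integrable) (by intros; fun_prop) (fun x _ => h.diff x)
  simpa using this

lemma integral_cd_zero {w : EN N → ℂ} (h : Tst 1 Ω w) (a : ℂ) (j : Fin N) :
    ∫ z, cd a j w z ∂(LM N) = 0 := by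
  have hi : ∀ v, Integrable (fun z => fderiv ℝ w z v) (LM N) := fun v =>
    ((h.smooth.continuous_fderiv (by norm_num)).clm_apply continuous_const).integrable_of_hasCompactSupport
      (h.cpt.fderiv_apply (𝕜 := ℝ) v)
  simp only [cd]
  rw [integral_const_mul, integral_add (hi _) ((hi _).const_mul _), integral_const_mul,
    integral_fderiv_zero h, integral_fderiv_zero h]
  simp

lemma ibp (hΩ : IsOpen Ω) {f w : EN N → ℂ} (hf : ContDiffOn ℝ 1 f Ω) (h : Tst 1 Ω w) (a : ℂ)
    (j : Fin N) : ∫ z, cd a j f z * w z ∂(LM N) = - ∫ z, f z * cd a j w z ∂(LM N) := by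
  have hp : ∀ z, cd a j (fun x => f x * w x) z = cd a j f z * w z + f z * cd a j w z := by
    intro z
    by_cases hz : z ∈ Ω
    · exact cd_mul ((hf.contDiffAt (hΩ.mem_nhds hz)).differentiableAt (by norm_num)) (h.diff z)
    · have hz' : z ∉ tsupport w := fun hh => hz (h.sub hh)
      rw [cd_zero_of_notMem_tsupport hz', cd_zero_of_notMem_tsupport, image_eq_zero_of_notMem_tsupport hz']
      · simp
      · exact fun hh => hz' (tsupport_mul_subset_right hh)
  have h1 : Tst 1 Ω (fun x => f x * w x) := h.mul_left hΩ (by exact_mod_cast hf)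
  have h2 := integral_cd_zero h1 a j
  simp only [hp] at h2
  have i1 : Integrable (fun z => cd a j f z * w z) (LM N) :=
    (Tst.mul_left hΩ (n := 0) (contDiffOn_cd hΩ (by exact_mod_cast hf) a j) (h.of_le (by simp))).integrable
  have i2 : Integrable (fun z => f z * cd a j w z) (LM N) :=
    (Tst.mul_left hΩ (n := 0) (hf.of_le (by simp)) (h.cd a j)).integrable
  rw [integral_add i1 i2] at h2
  exact eq_neg_of_add_eq_zero_left h2

lemma cd_cd {w : EN N → ℂ} {z : EN N} (hw : ContDiffAt ℝ 2 w z) (a b : ℂ) (j k : Fin N) :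
    cd a j (cd b k w) z = (1/4 : ℂ) *
      (fderiv ℝ (fderiv ℝ w) z (eb j) (eb k) + b * fderiv ℝ (fderiv ℝ w) z (eb j) (Complex.I • eb k)
      + a * (fderiv ℝ (fderiv ℝ w) z (Complex.I • eb j) (eb k)
        + b * fderiv ℝ (fderiv ℝ w) z (Complex.I • eb j) (Complex.I • eb k))) := by
  have hd : DifferentiableAt ℝ (fderiv ℝ w) z :=
    (hw.fderiv_right (m := 1) (by norm_num)).differentiableAt (by norm_num)
  have hv : ∀ v, HasFDerivAt (fun z => fderiv ℝ w z v) ((fderiv ℝ (fderiv ℝ w) z).flip v) z := by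
    intro v
    have := hd.hasFDerivAt.clm_apply (hasFDerivAt_const v z)
    refine this.congr_fderiv ?_
    ext x; simp
  have : HasFDerivAt (cd b k w) ((1/2 : ℂ) • ((fderiv ℝ (fderiv ℝ w) z).flip (eb k)
      + b • (fderiv ℝ (fderiv ℝ w) z).flip (Complex.I • eb k))) z :=
    ((hv (eb k)).add ((hv (Complex.I • eb k)).const_mul b)).const_mul _
  rw [cd, this.fderiv]
  simp
  ring

lemma cd_comm {w : EN N → ℂ} {z : EN N} (hw : ContDiffAt ℝ 2 w z) (a b : ℂ) (j k : Fin N) :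
    cd a j (cd b k w) z = cd b k (cd a j w) z := by
  have hs : IsSymmSndFDerivAt ℝ w z := hw.isSymmSndFDerivAt (by simp)
  rw [cd_cd hw, cd_cd hw, hs.eq (eb j) (eb k), hs.eq (eb j) (Complex.I • eb k),
    hs.eq (Complex.I • eb j) (eb k), hs.eq (Complex.I • eb j) (Complex.I • eb k)]
  ring

lemma ibp2 (hΩ : IsOpen Ω) {f w : EN N → ℂ} (hf : ContDiffOn ℝ 1 f Ω) (h : Tst 2 Ω w) (a b : ℂ)
    (j k : Fin N) : ∫ z, cd a j f z * cd b k w z ∂(LM N) = ∫ z, cd b k f z * cd a j w z ∂(LM N) := by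
  rw [ibp hΩ hf (h.cd b k), ibp hΩ hf (h.cd a j)]
  congr 2; ext z; rw [cd_comm h.smooth.contDiffAt]

end LP
end

noncomputable section
open Set Filter Topology Metric MeasureTheory
open scoped ENNReal NNReal InnerProductSpace ComplexConjugate
namespace LP
variable {N : ℕ} {Ω : Set (EN N)}

abbrev dbar (j : Fin N) (w : EN N → ℂ) : EN N → ℂ := cd Complex.I j w
abbrev dd (j : Fin N) (w : EN N → ℂ) : EN N → ℂ := cd (-Complex.I) j w

/-- complexification of a real function -/
abbrev cr (φ : EN N → ℝ) : EN N → ℂ := fun z => (φ z : ℂ)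

lemma contDiffOn_cr {n : WithTop ℕ∞} {φ : EN N → ℝ} (h : ContDiffOn ℝ n φ Ω) : ContDiffOn ℝ n (cr φ) Ω :=
  Complex.ofRealCLM.contDiff.comp_contDiffOn h

lemma cd_cr_conj {a : ℂ} {j : Fin N} {φ : EN N → ℝ} {z : EN N} (hw : DifferentiableAt ℝ (cr φ) z) :
    conj (cd a j (cr φ) z) = cd (conj a) j (cr φ) z := by
  have := cd_conj (a := conj a) (j := j) hw
  simp only [cr, Complex.conj_ofReal, Complex.conj_conj] at this
  rw [this]

lemma cd_exp {a : ℂ} {j : Fin N} {f : EN N → ℂ} {z : EN N} (hw : DifferentiableAt ℝ f z) :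
    cd a j (fun x => Complex.exp (f x)) z = Complex.exp (f z) * cd a j f z := by
  have h : HasFDerivAt (fun x => Complex.exp (f x)) (Complex.exp (f z) • fderiv ℝ f z) z := by
    exact hw.hasFDerivAt.cexp
  simp only [cd]; rw [h.fderiv]; simp; ring

/-- The basic commutator identity for one pair of indices. -/
lemma basic_pair (hΩ : IsOpen Ω) {φ : EN N → ℝ} (hφ : ContDiffOn ℝ 2 φ Ω) {a c : EN N → ℂ}
    (ha : Tst 2 Ω a) (hc : Tst 2 Ω c) (j k : Fin N) :
    ∫ z, ((dd j a z - a z * dd j (cr φ) z) * dbar k c z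
      - dbar k a z * (dd j c z + dd j (cr φ) z * c z)
      - dbar k (dd j (cr φ)) z * (a z * c z)) ∂(LM N) = 0 := by
  have hφc : ContDiffOn ℝ 2 (cr φ) Ω := contDiffOn_cr hφ
  have hφ1 : ContDiffOn ℝ 1 (dd j (cr φ)) Ω := by
    exact_mod_cast contDiffOn_cd hΩ (n := 1) (by exact_mod_cast hφc) _ _
  have hac : Tst 2 Ω (fun z => a z * c z) := hc.mul_left hΩ ha.smooth.contDiffOn
  have e1 := ibp2 hΩ (ha.smooth.contDiffOn.of_le (by norm_num)) hc (-Complex.I) Complex.I j k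
  have e2 := ibp hΩ hφ1 (hac.of_le (by norm_num) : Tst 1 Ω _) Complex.I k
  have i1 : Integrable (fun z => dd j a z * dbar k c z) (LM N) :=
    (Tst.mul_left hΩ (n := 0) ((ha.cd _ _).of_le (by norm_num)).smooth.contDiffOn
      ((hc.cd (n := 1) _ _).of_le (by norm_num))).integrable
  have i2 : Integrable (fun z => dbar k a z * dd j c z) (LM N) :=
    (Tst.mul_left hΩ (n := 0) ((ha.cd _ _).of_le (by norm_num)).smooth.contDiffOn
      ((hc.cd (n := 1) _ _).of_le (by norm_num))).integrable
  have i3 : Integrable (fun z => dd j (cr φ) z * dbar k (fun z => a z * c z) z) (LM N) :=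
    (Tst.mul_left hΩ (n := 0) (hφ1.of_le (by norm_num))
      ((hac.cd (n := 1) _ _).of_le (by norm_num))).integrable
  have i4 : Integrable (fun z => dbar k (dd j (cr φ)) z * (a z * c z)) (LM N) :=
    (Tst.mul_left hΩ (n := 0) (contDiffOn_cd hΩ (by exact_mod_cast hφ1) _ _)
      (hac.of_le (by norm_num))).integrable
  have : ∀ z, ((dd j a z - a z * dd j (cr φ) z) * dbar k c z
      - dbar k a z * (dd j c z + dd j (cr φ) z * c z)
      - dbar k (dd j (cr φ)) z * (a z * c z)) = (dd j a z * dbar k c z - dbar k a z * dd j c z)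
      - (dd j (cr φ) z * dbar k (fun z => a z * c z) z + dbar k (dd j (cr φ)) z * (a z * c z)) := by
    intro z
    rw [show dbar k (fun z => a z * c z) z = _ from cd_mul (ha.diff z) (hc.diff z)]
    ring
  simp_rw [this]
  have i12 : Integrable (fun z => dd j a z * dbar k c z - dbar k a z * dd j c z) (LM N) := i1.sub i2
  have i34 : Integrable (fun z => dd j (cr φ) z * dbar k (fun z => a z * c z) z
    + dbar k (dd j (cr φ)) z * (a z * c z)) (LM N) := i3.add i4
  rw [integral_sub i12 i34, integral_sub i1 i2, integral_add i3 i4, e1, e2]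
  simp

lemma pointwise_alg (A T P : ℂ) (B : Fin N → Fin N → ℂ) (hA : A = T - P) (L : ℝ) (e : ℝ)
    (hL : 2 * ‖P‖^2 + 2 * e ≤ L) :
    ‖A‖^2 - (∑ j, ∑ k, B j k * conj (B k j)).re - L ≤
      2 * ‖T‖^2 + (1/2) * (∑ j, ∑ k, ‖B j k - B k j‖^2) - 2 * e := by
  have h1 : ‖A‖^2 ≤ 2 * ‖T‖^2 + 2 * ‖P‖^2 := by
    have : ‖A‖ ≤ ‖T‖ + ‖P‖ := by rw [hA]; exact norm_sub_le _ _
    nlinarith [sq_nonneg (‖T‖ - ‖P‖), norm_nonneg A, norm_nonneg T, norm_nonneg P]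
  have h2 : -(∑ j, ∑ k, B j k * conj (B k j)).re ≤ (1/2) * (∑ j, ∑ k, ‖B j k - B k j‖^2) := by
    have : ∀ j k, ‖B j k - B k j‖^2 = ‖B j k‖^2 + ‖B k j‖^2 - 2 * (B j k * conj (B k j)).re := by
      intro j k
      rw [← Complex.normSq_eq_norm_sq, ← Complex.normSq_eq_norm_sq, ← Complex.normSq_eq_norm_sq,
        Complex.normSq_sub]
    simp only [this, Finset.sum_sub_distrib, ← Finset.mul_sum, Complex.re_sum]
    have : 0 ≤ ∑ j : Fin N, ∑ k : Fin N, (‖B j k‖^2 + ‖B k j‖^2) := by positivity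
    linarith
  linarith

/-- weight hypothesis -/
def WeightIneq (Ω : Set (EN N)) (φ ψ : EN N → ℝ) : Prop :=
  ∀ z ∈ Ω, ∀ v : Fin N → ℂ,
    2 * ‖∑ j, v j * dd j (cr ψ) z‖^2 + 2 * (Real.exp (ψ z) * ∑ j, ‖v j‖^2)
      ≤ (∑ j, ∑ k, dbar k (dd j (cr φ)) z * (v j * conj (v k))).re

lemma basic_est (hΩ : IsOpen Ω) {φ ψ : EN N → ℝ} (hφ : ContDiffOn ℝ 2 φ Ω)
    (hψ : ContDiffOn ℝ 2 ψ Ω) (hW : WeightIneq Ω φ ψ) {f : Fin N → EN N → ℂ}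
    (hf : ∀ j, Tst 2 Ω (f j)) :
    0 ≤ ∫ z, (2 * ‖∑ j, (dd j (f j) z + f j z * dd j (cr (fun x => ψ x - φ x)) z)‖^2
      + (1/2) * (∑ j, ∑ k, ‖dbar k (f j) z - dbar j (f k) z‖^2)
      - 2 * (Real.exp (ψ z) * ∑ j, ‖f j z‖^2)) * Real.exp (-φ z) ∂(LM N) := by
  have hφc : ContDiffOn ℝ 2 (cr φ) Ω := contDiffOn_cr hφ
  have hψc : ContDiffOn ℝ 2 (cr ψ) Ω := contDiffOn_cr hψ
  have hφd : ∀ z ∈ Ω, DifferentiableAt ℝ (cr φ) z := fun z hz =>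
    (hφc.contDiffAt (hΩ.mem_nhds hz)).differentiableAt (by norm_num)
  have hψd : ∀ z ∈ Ω, DifferentiableAt ℝ (cr ψ) z := fun z hz =>
    (hψc.contDiffAt (hΩ.mem_nhds hz)).differentiableAt (by norm_num)
  set W : EN N → ℂ := fun z => Complex.exp (-(cr φ z)) with hWdef
  have hWs : ContDiffOn ℝ 2 W Ω := hφc.neg.cexp
  have hc : ∀ k, Tst 2 Ω (fun z => conj (f k z) * W z) := fun k => (hf k).conj.mul_right hΩ hWs
  -- derivative of c
  have hdc : ∀ (a : ℂ) (i k : Fin N), ∀ z ∈ Ω, cd a i (fun z => conj (f k z) * W z) z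
      = (conj (cd (conj a) i (f k) z) - conj (f k z) * cd a i (cr φ) z) * W z := by
    intro a i k z hz
    have hexp : cd a i W z = W z * (-(cd a i (cr φ) z)) := by
      have h1 : DifferentiableAt ℝ (fun x => -(cr φ x)) z := (hφd z hz).neg
      have := cd_exp (a := a) (j := i) h1
      rw [cd_neg] at this
      exact this
    rw [cd_mul ((hf k).conj.diff z) ((hWs.contDiffAt (hΩ.mem_nhds hz)).differentiableAt (by norm_num)),
      cd_conj ((hf k).diff z), hexp]
    ring
  have hsum : ∑ j, ∑ k, ∫ z, ((dd j (f j) z - f j z * dd j (cr φ) z) * dbar k (fun z => conj (f k z) * W z) z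
      - dbar k (f j) z * (dd j (fun z => conj (f k z) * W z) z + dd j (cr φ) z * (conj (f k z) * W z))
      - dbar k (dd j (cr φ)) z * (f j z * (conj (f k z) * W z))) ∂(LM N) = 0 :=
    Finset.sum_eq_zero fun j _ => Finset.sum_eq_zero fun k _ => basic_pair hΩ hφ (hf j) (hc k) j k
  -- integrability (as test functions of class C^0)
  have hT : ∀ j k, Tst 0 Ω (fun z => ((dd j (f j) z - f j z * dd j (cr φ) z) * dbar k (fun z => conj (f k z) * W z) z
      - dbar k (f j) z * (dd j (fun z => conj (f k z) * W z) z + dd j (cr φ) z * (conj (f k z) * W z))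
      - dbar k (dd j (cr φ)) z * (f j z * (conj (f k z) * W z)))) := by
    intro j k
    have hφ1 : ContDiffOn ℝ 1 (dd j (cr φ)) Ω := by
      exact_mod_cast contDiffOn_cd hΩ (n := 1) (by exact_mod_cast hφc) _ _
    have hφ2 : ContDiffOn ℝ (0:ℕ) (dbar k (dd j (cr φ))) Ω := contDiffOn_cd hΩ (by exact_mod_cast hφ1) _ _
    have hφ0 : ContDiffOn ℝ (0:ℕ) (dd j (cr φ)) Ω := hφ1.of_le (by norm_num)
    have c0 := (hc k).of_le (m := 0) (by norm_num)
    have f0 := (hf j).of_le (m := 0) (by norm_num)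
    have cdk := fun (a : ℂ) i => ((hc k).cd a i).of_le (m := 0) (by norm_num)
    have fdk := fun (a : ℂ) i => ((hf j).cd a i).of_le (m := 0) (by norm_num)
    refine Tst.sub' (Tst.sub' ?_ ?_) ?_
    · exact Tst.mul_left hΩ ((fdk _ j).sub' (f0.mul_right hΩ hφ0)).smooth.contDiffOn (cdk _ k)
    · exact Tst.mul_left hΩ (fdk _ k).smooth.contDiffOn ((cdk _ j).add (c0.mul_left hΩ hφ0))
    · exact Tst.mul_left hΩ hφ2 (Tst.mul_left hΩ f0.smooth.contDiffOn c0)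
  have hIntg : ∫ z, ∑ j, ∑ k, ((dd j (f j) z - f j z * dd j (cr φ) z) * dbar k (fun z => conj (f k z) * W z) z
      - dbar k (f j) z * (dd j (fun z => conj (f k z) * W z) z + dd j (cr φ) z * (conj (f k z) * W z))
      - dbar k (dd j (cr φ)) z * (f j z * (conj (f k z) * W z))) ∂(LM N) = 0 := by
    rw [integral_finsetSum _ (fun j _ => integrable_finsetSum _ (fun k _ => (hT j k).integrable))]
    rw [← hsum]
    exact Finset.sum_congr rfl fun j _ => integral_finsetSum _ (fun k _ => (hT j k).integrable)
  have hTT : Tst 0 Ω (fun z => ∑ j, ∑ k, ((dd j (f j) z - f j z * dd j (cr φ) z) * dbar k (fun z => conj (f k z) * W z) z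
      - dbar k (f j) z * (dd j (fun z => conj (f k z) * W z) z + dd j (cr φ) z * (conj (f k z) * W z))
      - dbar k (dd j (cr φ)) z * (f j z * (conj (f k z) * W z)))) :=
    Tst.sum _ fun j _ => Tst.sum _ fun k _ => hT j k
  have hre : ∫ z, (∑ j, ∑ k, ((dd j (f j) z - f j z * dd j (cr φ) z) * dbar k (fun z => conj (f k z) * W z) z
      - dbar k (f j) z * (dd j (fun z => conj (f k z) * W z) z + dd j (cr φ) z * (conj (f k z) * W z))
      - dbar k (dd j (cr φ)) z * (f j z * (conj (f k z) * W z)))).re ∂(LM N) = 0 := by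
    have := integral_re (𝕜 := ℂ) hTT.integrable
    rw [hIntg] at this
    simpa using this
  rw [← hre]
  have hzero : ∀ z, z ∉ Ω → ∀ j, f j z = 0 ∧ ∀ a k, cd a k (f j) z = 0 := fun z hz j =>
    ⟨image_eq_zero_of_notMem_tsupport (fun h => hz ((hf j).sub h)),
      fun a k => cd_zero_of_notMem_tsupport (fun h => hz ((hf j).sub h))⟩
  -- compare
  have hpt : ∀ z, (∑ j, ∑ k, ((dd j (f j) z - f j z * dd j (cr φ) z) * dbar k (fun z => conj (f k z) * W z) z
      - dbar k (f j) z * (dd j (fun z => conj (f k z) * W z) z + dd j (cr φ) z * (conj (f k z) * W z))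
      - dbar k (dd j (cr φ)) z * (f j z * (conj (f k z) * W z)))).re ≤
      (2 * ‖∑ j, (dd j (f j) z + f j z * dd j (cr (fun x => ψ x - φ x)) z)‖^2
      + (1/2) * (∑ j, ∑ k, ‖dbar k (f j) z - dbar j (f k) z‖^2)
      - 2 * (Real.exp (ψ z) * ∑ j, ‖f j z‖^2)) * Real.exp (-φ z) := by
    intro z
    by_cases hz : z ∈ Ω
    · set A := ∑ j, (dd j (f j) z - f j z * dd j (cr φ) z) with hA
      set T := ∑ j, (dd j (f j) z + f j z * dd j (cr (fun x => ψ x - φ x)) z) with hTd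
      set P := ∑ j, f j z * dd j (cr ψ) z with hP
      have hAT : A = T - P := by
        rw [hA, hTd, hP, ← Finset.sum_sub_distrib]
        refine Finset.sum_congr rfl fun j _ => ?_
        have : cr (fun x => ψ x - φ x) = fun x => cr ψ x - cr φ x := by ext x; simp [cr]
        rw [this, show dd j (fun x => cr ψ x - cr φ x) z = _ from cd_sub (hψd z hz) (hφd z hz)]
        ring
      have key := pointwise_alg A T P (fun j k => dbar k (f j) z) hAT
        (∑ j, ∑ k, dbar k (dd j (cr φ)) z * (f j z * conj (f k z))).re
        (Real.exp (ψ z) * ∑ j, ‖f j z‖^2) (by simpa [hP] using hW z hz (fun j => f j z))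
      have hWr : W z = ((Real.exp (-φ z) : ℝ) : ℂ) := by simp [hWdef, cr]
      have hsimp : (∑ j, ∑ k, ((dd j (f j) z - f j z * dd j (cr φ) z) * dbar k (fun z => conj (f k z) * W z) z
        - dbar k (f j) z * (dd j (fun z => conj (f k z) * W z) z + dd j (cr φ) z * (conj (f k z) * W z))
        - dbar k (dd j (cr φ)) z * (f j z * (conj (f k z) * W z))))
        = (A * conj A - (∑ j, ∑ k, dbar k (f j) z * conj (dbar j (f k) z))
          - ∑ j, ∑ k, dbar k (dd j (cr φ)) z * (f j z * conj (f k z))) * ((Real.exp (-φ z) : ℝ) : ℂ) := by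
        rw [← hWr, hA, map_sum, Finset.sum_mul_sum, ← Finset.sum_sub_distrib, ← Finset.sum_sub_distrib,
          Finset.sum_mul]
        refine Finset.sum_congr rfl fun j _ => ?_
        rw [← Finset.sum_sub_distrib, ← Finset.sum_sub_distrib, Finset.sum_mul]
        refine Finset.sum_congr rfl fun k _ => ?_
        rw [show dbar k (fun z => conj (f k z) * W z) z = _ from hdc _ _ _ z hz,
          show dd j (fun z => conj (f k z) * W z) z = _ from hdc _ _ _ z hz, map_sub, map_mul,
          show conj (dd k (cr φ) z) = _ from cd_cr_conj (hφd z hz)]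
        simp only [map_neg, Complex.conj_I, neg_neg]
        ring
      rw [hsimp, Complex.re_mul_ofReal]
      refine mul_le_mul_of_nonneg_right ?_ (Real.exp_pos _).le
      rw [Complex.sub_re, Complex.sub_re, Complex.mul_conj, Complex.ofReal_re, Complex.normSq_eq_norm_sq]
      exact key
    · have h0 := hzero z hz
      simp [h0]
  -- integrability of the majorant
  have hmaj : Integrable (fun z => (2 * ‖∑ j, (dd j (f j) z + f j z * dd j (cr (fun x => ψ x - φ x)) z)‖^2
      + (1/2) * (∑ j, ∑ k, ‖dbar k (f j) z - dbar j (f k) z‖^2)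
      - 2 * (Real.exp (ψ z) * ∑ j, ‖f j z‖^2)) * Real.exp (-φ z)) (LM N) := by
    have hn : ∀ {w : EN N → ℂ}, Tst 0 Ω w → Tst 0 Ω (fun z => ((‖w z‖^2 : ℝ) : ℂ)) := by
      intro w hw
      have : (fun z => ((‖w z‖^2 : ℝ) : ℂ)) = fun z => w z * conj (w z) := by
        ext z; rw [Complex.mul_conj, Complex.normSq_eq_norm_sq]
      rw [this]; exact Tst.mul_left hΩ hw.smooth.contDiffOn hw.conj
    have hW0 : ContDiffOn ℝ (0:ℕ) W Ω := hWs.of_le (by norm_num)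
    have hS0 : ContDiffOn ℝ (0:ℕ) (fun z => Complex.exp (cr ψ z)) Ω := hψc.cexp.of_le (by norm_num)
    have hψφ : ∀ j, ContDiffOn ℝ (0:ℕ) (dd j (cr (fun x => ψ x - φ x))) Ω := fun j =>
      (contDiffOn_cd hΩ (n := 1) (by exact_mod_cast contDiffOn_cr (hψ.sub hφ)) _ _).of_le (by norm_num)
    have f0 := fun j => (hf j).of_le (m := 0) (by norm_num)
    have fdk := fun (a : ℂ) i j => ((hf j).cd a i).of_le (m := 0) (by norm_num)
    have t1 := hn (Tst.sum Finset.univ fun j _ =>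
      (fdk (-Complex.I) j j).add ((f0 j).mul_right hΩ (hψφ j)))
    have t2 := Tst.sum Finset.univ fun j _ => Tst.sum Finset.univ fun k _ =>
      hn ((fdk Complex.I k j).sub' (fdk Complex.I j k))
    have t3 := Tst.mul_left hΩ hS0 (Tst.sum Finset.univ fun j _ => hn (f0 j))
    have hc0 : ∀ c : ℂ, ContDiffOn ℝ (0:ℕ) (fun _ : EN N => c) Ω := fun c => contDiffOn_const
    have t := Tst.mul_right hΩ hW0 (Tst.sub' (Tst.add (Tst.mul_left hΩ (hc0 2) t1)
      (Tst.mul_left hΩ (hc0 (((1/2:ℝ)):ℂ)) t2)) (Tst.mul_left hΩ (hc0 2) t3))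
    have := t.integrable.re
    refine this.congr (Eventually.of_forall fun z => ?_)
    simp only [hWdef, cr]
    norm_cast
  exact integral_mono hTT.integrable.re hmaj hpt

end LP
end

noncomputable section
open Set Filter Topology Metric MeasureTheory
open scoped ENNReal NNReal InnerProductSpace ComplexConjugate
namespace LP
variable {N : ℕ} {Ω : Set (EN N)}

/-- unnormalized bump -/
def kb (y : EN N) : ℝ := expNegInvGlue (1 - ‖y‖^2)

lemma kb_contDiff : ContDiff ℝ (⊤ : ℕ∞) (kb : EN N → ℝ) := by
  unfold kb
  exact expNegInvGlue.contDiff.comp (contDiff_const.sub (contDiff_norm_sq ℝ))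

lemma kb_nonneg (y : EN N) : 0 ≤ kb y := expNegInvGlue.nonneg _

lemma kb_zero {y : EN N} (h : 1 ≤ ‖y‖) : kb y = 0 :=
  expNegInvGlue.zero_of_nonpos (by nlinarith)

lemma kb_le (y : EN N) : kb y ≤ 1 := by
  unfold kb expNegInvGlue
  split_ifs with h
  · norm_num
  · rw [Real.exp_le_one_iff]; push Not at h
    have := inv_pos.2 h; linarith

lemma kb_cpt : HasCompactSupport (kb : EN N → ℝ) := by
  refine HasCompactSupport.of_support_subset_isCompact (isCompact_closedBall (0:EN N) 1) ?_
  intro y hy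
  by_contra h
  simp only [mem_closedBall, dist_zero_right, not_le] at h
  exact hy (kb_zero h.le)

lemma kb_int : Integrable (kb : EN N → ℝ) (LM N) :=
  kb_contDiff.continuous.integrable_of_hasCompactSupport kb_cpt

def kI (N : ℕ) : ℝ := ∫ y : EN N, kb y ∂(LM N)

lemma kI_pos : 0 < kI N := by
  unfold kI
  rw [integral_pos_iff_support_of_nonneg kb_nonneg kb_int]
  refine IsOpen.measure_pos _ ?_ ⟨0, ?_⟩
  · exact isOpen_ne_fun kb_contDiff.continuous continuous_const
  · simp only [Function.mem_support, kb]
    exact (expNegInvGlue.pos_of_pos (by simp)).ne'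

lemma finrank_EN : Module.finrank ℝ (EN N) = 2 * N := by
  rw [← Module.finrank_mul_finrank ℝ ℂ (EN N)]; simp

/-- normalized kernel at scale `ε` -/
def kk (ε : ℝ) (y : EN N) : ℝ := kb (ε⁻¹ • y) / (ε^(2*N) * kI N)

lemma kk_contDiff (ε : ℝ) : ContDiff ℝ (⊤ : ℕ∞) (kk ε : EN N → ℝ) := by
  unfold kk
  exact (kb_contDiff.comp (contDiff_id.const_smul _)).div_const _

lemma kk_nonneg {ε : ℝ} (hε : 0 < ε) (y : EN N) : 0 ≤ kk ε y :=
  div_nonneg (kb_nonneg _) (by have := @kI_pos N; positivity)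

lemma kk_zero {ε : ℝ} (hε : 0 < ε) {y : EN N} (h : ε ≤ ‖y‖) : kk ε y = 0 := by
  unfold kk
  rw [kb_zero, zero_div]
  rw [norm_smul, norm_inv, Real.norm_of_nonneg hε.le, ← div_eq_inv_mul, le_div_iff₀ hε]; linarith

lemma kk_le {ε : ℝ} (hε : 0 < ε) (y : EN N) : kk ε y ≤ 1 / (ε^(2*N) * kI N) := by
  unfold kk; have := @kI_pos N
  gcongr; exact kb_le _

lemma kk_rot {ε : ℝ} {c : ℂ} (hc : ‖c‖ = 1) (y : EN N) : kk ε (c • y) = kk ε y := by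
  simp only [kk, kb, norm_smul, hc, one_mul]

lemma kk_neg {ε : ℝ} (y : EN N) : kk ε (-y) = kk ε y := by
  simp only [kk, kb, norm_smul, norm_neg]

lemma kk_cpt {ε : ℝ} (hε : 0 < ε) : HasCompactSupport (kk ε : EN N → ℝ) := by
  refine HasCompactSupport.of_support_subset_isCompact (isCompact_closedBall (0:EN N) ε) ?_
  intro y hy
  by_contra h
  simp only [mem_closedBall, dist_zero_right, not_le] at h
  exact hy (kk_zero hε h.le)

lemma kk_int {ε : ℝ} (hε : 0 < ε) : Integrable (kk ε : EN N → ℝ) (LM N) :=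
  (kk_contDiff ε).continuous.integrable_of_hasCompactSupport (kk_cpt hε)

lemma kk_integral {ε : ℝ} (hε : 0 < ε) : ∫ y : EN N, kk ε y ∂(LM N) = 1 := by
  unfold kk
  rw [integral_div]
  have := Measure.integral_comp_inv_smul (LM N) (kb : EN N → ℝ) ε
  rw [this, finrank_EN, abs_of_pos (by positivity), smul_eq_mul]
  have h := @kI_pos N
  exact div_self (by positivity : (0:ℝ) < ε^(2*N) * kI N).ne'

abbrev kc (ε : ℝ) : EN N → ℂ := cr (kk ε)

lemma kc_contDiff (ε : ℝ) : ContDiff ℝ (⊤ : ℕ∞) (kc ε : EN N → ℂ) :=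
  Complex.ofRealCLM.contDiff.comp (kk_contDiff ε)

lemma kc_cpt {ε : ℝ} (hε : 0 < ε) : HasCompactSupport (kc ε : EN N → ℂ) :=
  (kk_cpt hε).comp_left (g := fun x : ℝ => (x:ℂ)) (by simp)

/-- mollification -/
def mo (ε : ℝ) (h : EN N → ℂ) (x : EN N) : ℂ := ∫ y, h y * kc ε (x - y) ∂(LM N)

lemma mo_eq (ε : ℝ) (h : EN N → ℂ) : mo ε h =
    MeasureTheory.convolution h (kc ε) (ContinuousLinearMap.mul ℝ ℂ) (LM N) := by
  ext x; simp [mo, MeasureTheory.convolution]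

lemma mo_contDiff {ε : ℝ} (hε : 0 < ε) {h : EN N → ℂ} (hh : LocallyIntegrable h (LM N)) {n : ℕ} :
    ContDiff ℝ n (mo ε h) := by
  rw [mo_eq]
  exact (kc_cpt hε).contDiff_convolution_right _ hh ((kc_contDiff ε).of_le (by exact_mod_cast le_top))

lemma cd_mo {ε : ℝ} (hε : 0 < ε) {h : EN N → ℂ} (hh : LocallyIntegrable h (LM N)) (a : ℂ) (j : Fin N)
    (x : EN N) : cd a j (mo ε h) x = ∫ y, h y * cd a j (kc ε) (x - y) ∂(LM N) := by
  have hk1 : ContDiff ℝ 1 (kc ε : EN N → ℂ) := (kc_contDiff ε).of_le (by exact_mod_cast le_top)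
  have h1 := (kc_cpt hε).hasFDerivAt_convolution_right (ContinuousLinearMap.mul ℝ ℂ) hh hk1 x
  have hp : ∀ v, fderiv ℝ (mo ε h) x v = ∫ y, h y * fderiv ℝ (kc ε) (x - y) v ∂(LM N) := by
    intro v
    rw [mo_eq, h1.fderiv, convolution_precompR_apply]
    · simp [MeasureTheory.convolution]
    · exact hh
    · exact (kc_cpt hε).fderiv ℝ
    · exact hk1.continuous_fderiv (by norm_num)
  have hi : ∀ v, Integrable (fun y => h y * fderiv ℝ (kc ε) (x - y) v) (LM N) := by
    intro v
    have hc : HasCompactSupport (fun y => fderiv ℝ (kc ε : EN N → ℂ) y v) :=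
      ((kc_cpt hε).fderiv ℝ).comp_left (g := fun L : EN N →L[ℝ] ℂ => L v) (by simp)
    have := hc.convolutionExists_right (ContinuousLinearMap.mul ℝ ℂ) hh
      ((hk1.continuous_fderiv (by norm_num)).clm_apply continuous_const) x
    simpa [ConvolutionExistsAt] using this
  simp only [cd, hp]
  rw [← integral_const_mul, ← integral_add (hi _) ((hi _).const_mul _), ← integral_const_mul]
  congr 1; ext y; ring

lemma mo_tsupport {ε : ℝ} (hε : 0 < ε) {h : EN N → ℂ} {K : Set (EN N)}
    (hs : ∀ z, z ∉ K → h z = 0) : ∀ x, x ∉ cthickening ε K → mo ε h x = 0 := by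
  intro x hx
  unfold mo
  refine integral_eq_zero_of_ae (Eventually.of_forall fun y => ?_)
  by_cases hy : y ∈ K
  · have : ε ≤ ‖x - y‖ := by
      by_contra hlt
      push Not at hlt
      refine hx (mem_cthickening_of_dist_le x y ε K hy ?_)
      rw [dist_eq_norm]; exact hlt.le
    simp [kc, cr, kk_zero hε this]
  · simp [hs y hy]

end LP
end

noncomputable section
open Set Filter Topology Metric MeasureTheory
open scoped ENNReal NNReal InnerProductSpace ComplexConjugate
namespace LP
variable {N : ℕ} {Ω : Set (EN N)}

lemma trans_cont {h : EN N → ℂ} (hh : MemLp h 2 (LM N)) :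
    Tendsto (fun t : EN N => eLpNorm (fun x => h (x - t) - h x) 2 (LM N)) (𝓝 0) (𝓝 0) := by
  let g : EN N → C(EN N, EN N) := fun t => ⟨fun x => x - t, by fun_prop⟩
  have hg : Continuous g :=
    ContinuousMap.continuous_of_continuous_uncurry g (by
      show Continuous (fun p : EN N × EN N => p.2 - p.1); fun_prop)
  have hm : ∀ t, MeasurePreserving (g t) (LM N) (LM N) := fun t => measurePreserving_sub_right _ t
  have h1 : Tendsto (fun t => Lp.compMeasurePreserving (g t) (hm t) (hh.toLp h)) (𝓝 0)
      (𝓝 (Lp.compMeasurePreserving (g 0) (hm 0) (hh.toLp h))) :=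
    Tendsto.compMeasurePreservingLp tendsto_const_nhds (hg.tendsto 0) hm (hm 0) (by norm_num)
  rw [Lp.tendsto_Lp_iff_tendsto_eLpNorm'] at h1
  refine h1.congr fun t => eLpNorm_congr_ae ?_
  have e1 : ∀ t, Lp.compMeasurePreserving (g t) (hm t) (hh.toLp h) =ᵐ[LM N] fun x => h (x - t) := by
    intro t
    rw [Lp.toLp_compMeasurePreserving]
    exact MemLp.coeFn_toLp _
  filter_upwards [e1 t, e1 0] with x h2 h3
  rw [Pi.sub_apply, h2, h3, sub_zero]

lemma memLp_locInt {h : EN N → ℂ} (hh : MemLp h 2 (LM N)) : LocallyIntegrable h (LM N) :=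
  hh.locallyIntegrable (by norm_num)

lemma mo_exists {ε : ℝ} (hε : 0 < ε) {h : EN N → ℂ} (hh : LocallyIntegrable h (LM N)) (x : EN N) :
    Integrable (fun y => h y * kc ε (x - y)) (LM N) := by
  have := (kc_cpt hε).convolutionExists_right (ContinuousLinearMap.mul ℝ ℂ) hh
      (kc_contDiff ε).continuous x
  simpa [ConvolutionExistsAt] using this

lemma mo_sub_eq {ε : ℝ} (hε : 0 < ε) {h : EN N → ℂ} (hh : LocallyIntegrable h (LM N)) (x : EN N) :
    mo ε h x - h x = ∫ t, (h (x - t) - h x) * kc ε t ∂(LM N) := by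
  have h1 : mo ε h x = ∫ t, h (x - t) * kc ε t ∂(LM N) := by
    unfold mo
    rw [← integral_sub_left_eq_self _ (LM N) x]; simp
  have hi : Integrable (fun t => h (x - t) * kc ε t) (LM N) := by
    have := (mo_exists hε hh x).comp_sub_left x
    simpa using this
  have h2 : h x = ∫ t, h x * kc ε t ∂(LM N) := by
    rw [integral_const_mul]; simp only [kc, cr]; rw [integral_complex_ofReal, kk_integral hε]; simp
  have hi2 : Integrable (fun t => h x * kc ε t) (LM N) := (kk_int hε).ofReal.const_mul _
  conv_lhs => rw [h1, h2]
  rw [← integral_sub hi hi2]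
  congr 1; ext t; ring

lemma moll_bound {ε : ℝ} (hε : 0 < ε) {h : EN N → ℂ} (hm : StronglyMeasurable h) (hh : MemLp h 2 (LM N))
    {c : ℝ≥0∞} (hc : ∀ t : EN N, ‖t‖ ≤ ε → eLpNorm (fun x => h (x - t) - h x) 2 (LM N) ≤ c) :
    eLpNorm (fun x => mo ε h x - h x) 2 (LM N) ≤ c := by
  set ν : Measure (EN N) := (LM N).withDensity (fun t => ENNReal.ofReal (kk ε t)) with hν
  have hkm : Measurable (fun t : EN N => ENNReal.ofReal (kk ε t)) :=
    (kk_contDiff ε).continuous.measurable.ennreal_ofReal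
  have hprob : IsProbabilityMeasure ν := ⟨by
    rw [hν, withDensity_apply _ MeasurableSet.univ, Measure.restrict_univ,
      ← ofReal_integral_eq_lintegral_ofReal (kk_int hε) (Eventually.of_forall (kk_nonneg hε)),
      kk_integral hε]; simp⟩
  have hpt : ∀ x, ‖mo ε h x - h x‖ₑ ^ (2:ℝ) ≤ ∫⁻ t, ‖h (x - t) - h x‖ₑ ^ (2:ℝ) ∂ν := by
    intro x
    have hmx : StronglyMeasurable (fun t => h (x - t) - h x) :=
      (hm.comp_measurable (measurable_const.sub measurable_id)).sub stronglyMeasurable_const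
    have h1 : ‖mo ε h x - h x‖ₑ ≤ ∫⁻ t, ‖h (x - t) - h x‖ₑ ∂ν := by
      rw [mo_sub_eq hε (memLp_locInt hh) x]
      refine (enorm_integral_le_lintegral_enorm _).trans (le_of_eq ?_)
      rw [hν, lintegral_withDensity_eq_lintegral_mul _ hkm hmx.enorm]
      refine lintegral_congr fun t => ?_
      rw [enorm_mul, mul_comm, Pi.mul_apply]
      congr 1
      simp only [kc, cr]
      rw [← ofReal_norm, Complex.norm_real, Real.norm_of_nonneg (kk_nonneg hε t)]
    have h2 := eLpNorm'_le_eLpNorm'_of_exponent_le (p := 1) (q := 2) (by norm_num) (by norm_num) ν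
      hmx.aestronglyMeasurable
    simp only [eLpNorm', ENNReal.rpow_one, div_one, one_div] at h2
    have h3 := h1.trans h2
    have := ENNReal.rpow_le_rpow h3 (z := 2) (by norm_num)
    rwa [← ENNReal.rpow_mul, inv_mul_cancel₀ (by norm_num), ENNReal.rpow_one] at this
  have hsq : ∀ g : EN N → ℂ, eLpNorm g 2 (LM N) = (∫⁻ x, ‖g x‖ₑ ^ (2:ℝ) ∂(LM N)) ^ (1/(2:ℝ)) := by
    intro g
    rw [eLpNorm_eq_lintegral_rpow_enorm_toReal (by norm_num) (by norm_num)]; simp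
  have hc2 : ∀ t : EN N, ‖t‖ ≤ ε → ∫⁻ x, ‖h (x - t) - h x‖ₑ ^ (2:ℝ) ∂(LM N) ≤ c ^ (2:ℝ) := by
    intro t ht
    have := ENNReal.rpow_le_rpow (hc t ht) (z := 2) (by norm_num)
    rwa [hsq, ← ENNReal.rpow_mul, one_div, inv_mul_cancel₀ (by norm_num), ENNReal.rpow_one] at this
  rw [hsq]
  have hfin : ∫⁻ x, ‖mo ε h x - h x‖ₑ ^ (2:ℝ) ∂(LM N) ≤ c ^ (2:ℝ) := by
    calc _ ≤ ∫⁻ x, ∫⁻ t, ‖h (x - t) - h x‖ₑ ^ (2:ℝ) ∂ν ∂(LM N) := lintegral_mono hpt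
      _ = ∫⁻ t, ∫⁻ x, ‖h (x - t) - h x‖ₑ ^ (2:ℝ) ∂(LM N) ∂ν := by
        refine lintegral_lintegral_swap ?_
        refine Measurable.aemeasurable ?_
        refine Measurable.pow_const ?_ _
        refine StronglyMeasurable.enorm ?_
        exact (hm.comp_measurable (measurable_fst.sub measurable_snd)).sub (hm.comp_measurable measurable_fst)
      _ ≤ ∫⁻ t, c ^ (2:ℝ) ∂ν := by
        refine lintegral_mono_ae ?_
        rw [hν, ae_withDensity_iff hkm]
        refine Eventually.of_forall fun t ht => hc2 t ?_
        by_contra hlt; push Not at hlt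
        exact ht (by rw [kk_zero hε hlt.le]; simp)
      _ = _ := by simp
  have := ENNReal.rpow_le_rpow hfin (z := 1/2) (by norm_num)
  rwa [← ENNReal.rpow_mul, one_div, mul_inv_cancel₀ (by norm_num), ENNReal.rpow_one, ← one_div] at this

lemma mo_congr {h h' : EN N → ℂ} (e : h =ᵐ[LM N] h') (ε : ℝ) : mo ε h = mo ε h' := by
  ext x; unfold mo
  exact integral_congr_ae (e.mono fun y hy => by simp only [hy])

lemma moll_tendsto {h : EN N → ℂ} (hh : MemLp h 2 (LM N)) :
    Tendsto (fun ε : ℝ => eLpNorm (fun x => mo ε h x - h x) 2 (LM N)) (𝓝[>] 0) (𝓝 0) := by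
  wlog hm : StronglyMeasurable h generalizing h
  · have e := hh.1.ae_eq_mk
    have := this ((memLp_congr_ae e).1 hh) hh.1.stronglyMeasurable_mk
    refine this.congr fun ε => ?_
    rw [mo_congr e ε]
    exact eLpNorm_congr_ae (e.mono fun x hx => by simp only [hx])
  rw [ENNReal.tendsto_nhds_zero]
  intro c hc
  have := (ENNReal.tendsto_nhds_zero.1 (trans_cont hh)) c hc
  obtain ⟨δ, hδ, hb⟩ := Metric.eventually_nhds_iff.1 this
  have : Ioo 0 δ ∈ 𝓝[>] (0:ℝ) := Ioo_mem_nhdsGT hδ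
  filter_upwards [this] with ε hε
  exact moll_bound hε.1 hm hh fun t ht => hb (by rw [dist_zero_right]; exact ht.trans_lt hε.2)

/-- L² convergence -/
structure L2T {ι : Type*} (l : Filter ι) (u : ι → EN N → ℂ) (v : EN N → ℂ) : Prop where
  mem : ∀ᶠ i in l, MemLp (u i) 2 (LM N)
  lim : MemLp v 2 (LM N)
  tend : Tendsto (fun i => eLpNorm (fun x => u i x - v x) 2 (LM N)) l (𝓝 0)

variable {ι : Type*} {l : Filter ι}

lemma L2T.add {u u' : ι → EN N → ℂ} {v v' : EN N → ℂ} (h : L2T l u v) (h' : L2T l u' v') :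
    L2T l (fun i x => u i x + u' i x) (fun x => v x + v' x) := by
  refine ⟨by filter_upwards [h.mem, h'.mem] with i a b using a.add b, h.lim.add h'.lim, ?_⟩
  have := h.tend.add h'.tend
  rw [add_zero] at this
  refine tendsto_of_tendsto_of_tendsto_of_le_of_le' tendsto_const_nhds this
    (Eventually.of_forall fun _ => zero_le) ?_
  filter_upwards [h.mem, h'.mem] with i a b
  have e : (fun x => u i x + u' i x - (v x + v' x)) = (fun x => u i x - v x) + fun x => u' i x - v' x := by
    ext x; simp; ring
  rw [e]
  exact eLpNorm_add_le (a.sub h.lim).1 (b.sub h'.lim).1 (by norm_num)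

lemma L2T.bmul {u : ι → EN N → ℂ} {v b : EN N → ℂ} (h : L2T l u v) (hb : AEStronglyMeasurable b (LM N))
    {C : ℝ} (hC : ∀ x, ‖b x‖ ≤ C) : L2T l (fun i x => b x * u i x) (fun x => b x * v x) := by
  have hm : ∀ {w : EN N → ℂ}, MemLp w 2 (LM N) → MemLp (fun x => b x * w x) 2 (LM N) := fun {w} hw =>
    hw.of_le_mul (c := C) (hb.mul hw.1) (Eventually.of_forall fun x => by
      rw [norm_mul]; gcongr; exact hC x)
  refine ⟨h.mem.mono fun i hi => hm hi, hm h.lim, ?_⟩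
  have := ENNReal.Tendsto.const_mul (a := ENNReal.ofReal C) h.tend (Or.inr ENNReal.ofReal_ne_top)
  rw [mul_zero] at this
  refine tendsto_of_tendsto_of_tendsto_of_le_of_le' tendsto_const_nhds this
    (Eventually.of_forall fun _ => zero_le) (Eventually.of_forall fun i => ?_)
  refine eLpNorm_le_mul_eLpNorm_of_ae_le_mul (Eventually.of_forall fun x => ?_) 2
  rw [← mul_sub, norm_mul]; gcongr; exact hC x

lemma L2T.zero : L2T l (fun _ _ => (0:ℂ)) (fun _ : EN N => (0:ℂ)) :=
  ⟨Eventually.of_forall fun _ => MemLp.zero', MemLp.zero', by simpa using tendsto_const_nhds⟩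

lemma L2T.sub {u u' : ι → EN N → ℂ} {v v' : EN N → ℂ} (h : L2T l u v) (h' : L2T l u' v') :
    L2T l (fun i x => u i x - u' i x) (fun x => v x - v' x) := by
  have := h.add (h'.bmul (b := fun _ => -1) aestronglyMeasurable_const (C := 1) (by simp))
  simpa [sub_eq_add_neg] using this

lemma L2T.sum {κ : Type*} (s : Finset κ) {u : κ → ι → EN N → ℂ} {v : κ → EN N → ℂ}
    (h : ∀ k ∈ s, L2T l (u k) (v k)) : L2T l (fun i x => ∑ k ∈ s, u k i x) (fun x => ∑ k ∈ s, v k x) := by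
  classical
  induction s using Finset.induction_on with
  | empty => simpa using L2T.zero
  | insert a s ha ih =>
    simp only [Finset.sum_insert ha]
    exact (h a (by simp)).add (ih fun k hk => h k (by simp [hk]))

lemma L2T.congr {u u' : ι → EN N → ℂ} {v v' : EN N → ℂ} (h : L2T l u v)
    (hu : ∀ᶠ i in l, u i = u' i) (hv : v = v') : L2T l u' v' := by
  subst hv
  refine ⟨by filter_upwards [h.mem, hu] with i a b using b ▸ a, h.lim, ?_⟩
  refine h.tend.congr' ?_
  filter_upwards [hu] with i hi; rw [hi]

lemma memLp_sq {v : EN N → ℂ} (h : MemLp v 2 (LM N)) :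
    ∫ x, ‖v x‖^2 ∂(LM N) = (eLpNorm v 2 (LM N)).toReal^2 := by
  rw [h.eLpNorm_eq_integral_rpow_norm (by norm_num) (by norm_num), ENNReal.toReal_ofReal (by positivity)]
  simp only [ENNReal.toReal_ofNat, Real.rpow_ofNat]
  rw [← Real.rpow_natCast, ← Real.rpow_mul (by positivity)]
  norm_num

lemma L2T.tendsto_sq {u : ι → EN N → ℂ} {v : EN N → ℂ} (h : L2T l u v) :
    Tendsto (fun i => ∫ x, ‖u i x‖^2 ∂(LM N)) l (𝓝 (∫ x, ‖v x‖^2 ∂(LM N))) := by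
  rw [memLp_sq h.lim]
  have hd : Tendsto (fun i => (eLpNorm (fun x => u i x - v x) 2 (LM N)).toReal) l (𝓝 0) := by
    have := (ENNReal.tendsto_toReal ENNReal.zero_ne_top).comp h.tend
    exact this
  have hn : Tendsto (fun i => (eLpNorm (u i) 2 (LM N)).toReal) l (𝓝 (eLpNorm v 2 (LM N)).toReal) := by
    rw [tendsto_iff_dist_tendsto_zero]
    refine squeeze_zero' (Eventually.of_forall fun _ => dist_nonneg) ?_ hd
    filter_upwards [h.mem] with i hi
    have a1 : eLpNorm (u i) 2 (LM N) ≤ eLpNorm (fun x => u i x - v x) 2 (LM N) + eLpNorm v 2 (LM N) := by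
      have := eLpNorm_add_le (hi.sub h.lim).1 h.lim.1 (p := 2) (by norm_num)
      rw [sub_add_cancel] at this
      exact this
    have a2 : eLpNorm v 2 (LM N) ≤ eLpNorm (fun x => u i x - v x) 2 (LM N) + eLpNorm (u i) 2 (LM N) := by
      have := eLpNorm_sub_le hi.1 (hi.sub h.lim).1 (p := 2) (by norm_num)
      simp only [sub_sub_cancel] at this
      rw [add_comm]; exact this
    have t0 : eLpNorm (fun x => u i x - v x) 2 (LM N) ≠ ⊤ := (hi.sub h.lim).2.ne
    have b1 := ENNReal.toReal_mono (ENNReal.add_ne_top.2 ⟨t0, h.lim.2.ne⟩) a1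
    have b2 := ENNReal.toReal_mono (ENNReal.add_ne_top.2 ⟨t0, hi.2.ne⟩) a2
    rw [ENNReal.toReal_add t0 h.lim.2.ne] at b1
    rw [ENNReal.toReal_add t0 hi.2.ne] at b2
    rw [Real.dist_eq, abs_le]; constructor <;> linarith
  refine (hn.pow 2).congr' ?_
  filter_upwards [h.mem] with i hi
  rw [memLp_sq hi]

lemma moll_L2T {h : EN N → ℂ} (hh : MemLp h 2 (LM N)) : L2T (𝓝[>] (0:ℝ)) (fun ε => mo ε h) h := by
  have ht := moll_tendsto hh
  refine ⟨?_, hh, ht⟩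
  have := (ENNReal.tendsto_nhds_zero.1 ht) 1 one_pos
  filter_upwards [this, self_mem_nhdsWithin] with ε h1 hε
  have hc : Continuous (mo ε h) := (mo_contDiff hε (memLp_locInt hh) (n := 0)).continuous
  have h2 : MemLp (fun x => mo ε h x - h x) 2 (LM N) :=
    ⟨hc.aestronglyMeasurable.sub hh.1, h1.trans_lt ENNReal.one_lt_top⟩
  have := h2.add hh
  refine (memLp_congr_ae (Eventually.of_forall fun x => ?_)).1 this
  simp

end LP
end

noncomputable section
open Set Filter Topology Metric MeasureTheory
open scoped ENNReal NNReal InnerProductSpace ComplexConjugate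
namespace LP
variable {N : ℕ} {Ω : Set (EN N)}

/-- locally square integrable on `Ω` -/
def L2loc (Ω : Set (EN N)) (f : EN N → ℂ) : Prop :=
  ∀ K ⊆ Ω, IsCompact K → MemLp f 2 ((LM N).restrict K)

lemma bdd_of_compact {K : Set (EN N)} (hK : IsCompact K) {g : EN N → ℂ} (hg : ContinuousOn g K) :
    AEStronglyMeasurable (K.indicator g) (LM N) ∧ ∃ C : ℝ, ∀ x, ‖K.indicator g x‖ ≤ C := by
  constructor
  · rw [aestronglyMeasurable_indicator_iff hK.measurableSet]
    exact hg.aestronglyMeasurable hK.measurableSet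
  · obtain ⟨C, hC⟩ := hK.exists_bound_of_continuousOn hg
    refine ⟨max C 0, fun x => ?_⟩
    by_cases hx : x ∈ K
    · rw [indicator_of_mem hx]; exact (hC x hx).trans (le_max_left _ _)
    · rw [indicator_of_notMem hx]; simp

lemma L2loc.mul_test {f w : EN N → ℂ} (hf : L2loc Ω f) (hw : Tst 0 Ω w) :
    MemLp (fun z => w z * f z) 2 (LM N) := by
  have hK : IsCompact (tsupport w) := hw.cpt
  have h1 := hf _ hw.sub hK
  have h2 : MemLp ((tsupport w).indicator f) 2 (LM N) := (memLp_indicator_iff_restrict hK.measurableSet).2 h1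
  obtain ⟨C, hC⟩ := hw.smooth.continuous.bounded_above_of_compact_support hw.cpt
  have h3 : MemLp (fun z => w z * (tsupport w).indicator f z) 2 (LM N) :=
    h2.of_le_mul (c := C) (hw.smooth.continuous.aestronglyMeasurable.mul h2.1)
      (Eventually.of_forall fun x => by rw [norm_mul]; gcongr; exact hC x)
  refine (memLp_congr_ae (Eventually.of_forall fun x => ?_)).1 h3
  by_cases hx : x ∈ tsupport w
  · simp [indicator_of_mem hx]
  · simp [image_eq_zero_of_notMem_tsupport hx]

lemma L2loc.mul_test' {f w : EN N → ℂ} (hf : L2loc Ω f) (hw : Tst 0 Ω w) :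
    MemLp (fun z => f z * w z) 2 (LM N) := by
  simpa only [mul_comm] using hf.mul_test hw

lemma L2loc.int_test {f w : EN N → ℂ} (hf : L2loc Ω f) (hw : Tst 0 Ω w) :
    Integrable (fun z => f z * w z) (LM N) := by
  have h := hf.mul_test' hw
  have h1 : LocallyIntegrable (fun z => f z * w z) (LM N) := memLp_locInt h
  exact (integrableOn_iff_integrable_of_support_subset (s := tsupport w) (fun x hx => by
    by_contra hn; exact hx (by simp [image_eq_zero_of_notMem_tsupport hn]))).1
    (h1.integrableOn_isCompact hw.cpt)

lemma L2loc.cont_mul {f g : EN N → ℂ} (hf : L2loc Ω f) (hg : ContinuousOn g Ω) :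
    L2loc Ω (fun z => g z * f z) := by
  intro K hKs hK
  obtain ⟨h1, C, hC⟩ := bdd_of_compact hK (hg.mono hKs)
  have h2 : MemLp (fun x => K.indicator g x * f x) 2 ((LM N).restrict K) :=
    (hf K hKs hK).of_le_mul (c := C) (h1.restrict.mul (hf K hKs hK).1)
      (Eventually.of_forall fun x => by rw [norm_mul]; gcongr; exact hC x)
  refine (memLp_congr_ae ?_).1 h2
  filter_upwards [ae_restrict_mem hK.measurableSet] with x hx
  simp [indicator_of_mem hx]

lemma L2loc.add {f g : EN N → ℂ} (hf : L2loc Ω f) (hg : L2loc Ω g) : L2loc Ω (fun z => f z + g z) :=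
  fun K h h' => (hf K h h').add (hg K h h')

lemma L2loc.sub {f g : EN N → ℂ} (hf : L2loc Ω f) (hg : L2loc Ω g) : L2loc Ω (fun z => f z - g z) :=
  fun K h h' => (hf K h h').sub (hg K h h')

lemma L2loc.neg {f : EN N → ℂ} (hf : L2loc Ω f) : L2loc Ω (fun z => - f z) :=
  fun K h h' => (hf K h h').neg

lemma L2loc.sum {ι : Type*} (s : Finset ι) {f : ι → EN N → ℂ} (hf : ∀ i ∈ s, L2loc Ω (f i)) :
    L2loc Ω (fun z => ∑ i ∈ s, f i z) :=
  fun K h h' => memLp_finsetSum s (fun i hi => hf i hi K h h')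

lemma cd_reflect {ε : ℝ} (a : ℂ) (j : Fin N) (x y : EN N) :
    cd a j (fun t => kc ε (x - t)) y = - cd a j (kc ε) (x - y) := by
  have hd : DifferentiableAt ℝ (kc ε : EN N → ℂ) (x - y) := (kc_contDiff ε).differentiable (by norm_num) _
  have h : HasFDerivAt (fun t => kc ε (x - t)) (-(fderiv ℝ (kc ε) (x - y))) y := by
    have h1 : HasFDerivAt (fun t : EN N => x - t) (-(ContinuousLinearMap.id ℝ (EN N))) y :=
      (hasFDerivAt_id y).const_sub x
    have := hd.hasFDerivAt.comp y h1
    refine this.congr_fderiv ?_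
    ext v; simp
  simp only [cd]; rw [h.fderiv]; simp; ring

lemma weak_moll (hΩ : IsOpen Ω) {η : EN N → ℂ} (hη : Tst 2 Ω η) {ι : Type*} (s : Finset ι)
    {f : ι → EN N → ℂ} (hf : ∀ i, L2loc Ω (f i)) {t : EN N → ℂ} (ht : L2loc Ω t) (a : ι → ℂ)
    (k : ι → Fin N)
    (hw : ∀ w, Tst 2 Ω w → ∑ i ∈ s, ∫ z, f i z * cd (a i) (k i) w z ∂(LM N) = -∫ z, t z * w z ∂(LM N))
    {ε : ℝ} (hε : 0 < ε) (x : EN N) :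
    ∑ i ∈ s, cd (a i) (k i) (mo ε (fun z => η z * f i z)) x
      = mo ε (fun z => (∑ i ∈ s, cd (a i) (k i) η z * f i z) + η z * t z) x := by
  have hη0 := hη.of_le (m := 0) (by norm_num)
  have hη1 : ∀ (a : ℂ) k, Tst 0 Ω (cd a k η) := fun a k => (hη.cd a k).of_le (by norm_num)
  have hle : ∀ n : ℕ, (n : WithTop ℕ∞) ≤ ((⊤ : ℕ∞) : WithTop ℕ∞) := fun n => by exact_mod_cast le_top
  have hkc : ContDiff ℝ (2:ℕ) (kc ε : EN N → ℂ) := (kc_contDiff ε).of_le (hle 2)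
  have hkx : ContDiff ℝ 2 (fun t => kc ε (x - t)) :=
    hkc.comp (contDiff_const.sub contDiff_id)
  have hkx0 : ContDiffOn ℝ (0:ℕ) (fun t => kc ε (x - t)) Ω := (hkx.of_le (by norm_num)).contDiffOn
  have hwt : Tst 2 Ω (fun z => η z * kc ε (x - z)) := hη.mul_right hΩ hkx.contDiffOn
  have key := hw _ hwt
  have e1 : ∀ i, cd (a i) (k i) (mo ε (fun z => η z * f i z)) x =
      ∫ z, f i z * (cd (a i) (k i) η z * kc ε (x - z)) ∂(LM N)
      - ∫ z, f i z * cd (a i) (k i) (fun z => η z * kc ε (x - z)) z ∂(LM N) := by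
    intro i
    rw [cd_mo hε (memLp_locInt ((hf i).mul_test hη0)),
      ← integral_sub ((hf i).int_test ((hη1 _ _).mul_right hΩ hkx0))
        ((hf i).int_test ((hwt.cd _ _).of_le (by norm_num)))]
    congr 1; ext z
    rw [cd_mul (hη.diff z) (hkx.differentiable (by norm_num) z), cd_reflect]
    ring
  rw [Finset.sum_congr rfl fun i _ => e1 i, Finset.sum_sub_distrib, key, sub_neg_eq_add]
  unfold mo
  have i1 : ∀ i ∈ s, Integrable (fun z => f i z * (cd (a i) (k i) η z * kc ε (x - z))) (LM N) :=
    fun i _ => (hf i).int_test ((hη1 _ _).mul_right hΩ hkx0)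
  rw [← integral_finsetSum _ i1, ← integral_add (integrable_finsetSum _ i1)
    (ht.int_test (hwt.of_le (by norm_num)))]
  congr 1; ext z
  rw [add_mul, Finset.sum_mul]
  congr 1
  · exact Finset.sum_congr rfl fun i _ => by ring
  · ring

lemma mo_add {ε : ℝ} (hε : 0 < ε) {g h : EN N → ℂ} (hg : LocallyIntegrable g (LM N))
    (hh : LocallyIntegrable h (LM N)) (x : EN N) : mo ε (fun z => g z + h z) x = mo ε g x + mo ε h x := by
  unfold mo
  rw [← integral_add (mo_exists hε hg x) (mo_exists hε hh x)]
  congr 1; ext y; ring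

/-- splitting the quadratic functional -/
lemma quad_split {A : EN N → ℂ} {B : Fin N → Fin N → EN N → ℂ} {F : Fin N → EN N → ℂ}
    {q p : EN N → ℂ} {φ ψ : EN N → ℝ} (hA : MemLp (fun z => q z * A z) 2 (LM N))
    (hB : ∀ j k, MemLp (fun z => q z * B j k z) 2 (LM N)) (hF : ∀ j, MemLp (fun z => p z * F j z) 2 (LM N))
    (hz : ∀ z, (‖q z‖^2 = Real.exp (-φ z) ∧ ‖p z‖^2 = Real.exp (ψ z) * Real.exp (-φ z)) ∨
      (A z = 0 ∧ (∀ j k, B j k z = 0) ∧ ∀ j, F j z = 0)) :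
    ∫ z, (2 * ‖A z‖^2 + (1/2) * (∑ j, ∑ k, ‖B j k z‖^2) - 2 * (Real.exp (ψ z) * ∑ j, ‖F j z‖^2))
      * Real.exp (-φ z) ∂(LM N) = 2 * ∫ z, ‖q z * A z‖^2 ∂(LM N)
        + (1/2) * (∑ j, ∑ k, ∫ z, ‖q z * B j k z‖^2 ∂(LM N)) - 2 * ∑ j, ∫ z, ‖p z * F j z‖^2 ∂(LM N) := by
  have i1 : Integrable (fun z => ‖q z * A z‖^2) (LM N) := hA.integrable_norm_pow (by norm_num)
  have i2 : ∀ j k, Integrable (fun z => ‖q z * B j k z‖^2) (LM N) := fun j k =>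
    (hB j k).integrable_norm_pow (by norm_num)
  have i3 : ∀ j, Integrable (fun z => ‖p z * F j z‖^2) (LM N) := fun j =>
    (hF j).integrable_norm_pow (by norm_num)
  have i2' : Integrable (fun z => ∑ j, ∑ k, ‖q z * B j k z‖^2) (LM N) :=
    integrable_finsetSum _ fun j _ => integrable_finsetSum _ fun k _ => i2 j k
  have i3' : Integrable (fun z => ∑ j, ‖p z * F j z‖^2) (LM N) :=
    integrable_finsetSum _ fun j _ => i3 j
  have e2 : ∑ j, ∑ k, ∫ z, ‖q z * B j k z‖^2 ∂(LM N) = ∫ z, ∑ j, ∑ k, ‖q z * B j k z‖^2 ∂(LM N) := by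
    rw [integral_finsetSum _ fun j _ => integrable_finsetSum _ fun k _ => i2 j k]
    exact Finset.sum_congr rfl fun j _ => (integral_finsetSum _ fun k _ => i2 j k).symm
  rw [e2, ← integral_finsetSum _ fun j _ => i3 j, ← integral_const_mul, ← integral_const_mul,
    ← integral_const_mul]
  have i12 : Integrable (fun z => 2 * ‖q z * A z‖^2 + (1/2) * ∑ j, ∑ k, ‖q z * B j k z‖^2) (LM N) :=
    (i1.const_mul 2).add (i2'.const_mul _)
  rw [← integral_add (i1.const_mul 2) (i2'.const_mul _), ← integral_sub i12 (i3'.const_mul 2)]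
  congr 1; ext z
  simp only [norm_mul, mul_pow, ← Finset.mul_sum]
  rcases hz z with ⟨h1, h2⟩ | ⟨h1, h2, h3⟩
  · rw [h1, h2]; ring
  · simp [h1, h2, h3]

lemma cut_est (hΩ : IsOpen Ω) {φ ψ : EN N → ℝ} (hφ : ContDiffOn ℝ 2 φ Ω)
    (hψ : ContDiffOn ℝ 2 ψ Ω) (hW : WeightIneq Ω φ ψ) {η : EN N → ℂ} (hη : Tst 2 Ω η)
    {f : Fin N → EN N → ℂ} (hf : ∀ j, L2loc Ω (f j)) {t : EN N → ℂ} (ht : L2loc Ω t)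
    (h1 : ∀ j k w, Tst 2 Ω w → ∫ z, f j z * dbar k w z ∂(LM N) = ∫ z, f k z * dbar j w z ∂(LM N))
    (h2 : ∀ w, Tst 2 Ω w → ∑ j, ∫ z, f j z * dd j w z ∂(LM N)
      = -∫ z, (t z - ∑ j, dd j (cr (fun x => ψ x - φ x)) z * f j z) * w z ∂(LM N)) :
    0 ≤ ∫ z, (2 * ‖(∑ j, dd j η z * f j z) + η z * t z‖^2
      + (1/2) * (∑ j, ∑ k, ‖dbar k η z * f j z - dbar j η z * f k z‖^2)
      - 2 * (Real.exp (ψ z) * ∑ j, ‖η z * f j z‖^2)) * Real.exp (-φ z) ∂(LM N) := by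
  set s : Fin N → EN N → ℂ := fun j => dd j (cr (fun x => ψ x - φ x)) with hs
  have hsc : ∀ j, ContinuousOn (s j) Ω := fun j =>
    (contDiffOn_cd hΩ (n := 1) (by exact_mod_cast contDiffOn_cr (hψ.sub hφ)) _ _).continuousOn
  have hη0 := hη.of_le (m := 0) (by norm_num)
  have hη1 : ∀ (a : ℂ) k, Tst 0 Ω (cd a k η) := fun a k => (hη.cd a k).of_le (by norm_num)
  have hK : IsCompact (tsupport η) := hη.cpt
  obtain ⟨δ, hδ, hδs⟩ := hK.exists_cthickening_subset_open hΩ hη.sub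
  set K' := cthickening δ (tsupport η) with hK'
  have hK'c : IsCompact K' := hK.cthickening
  have hKK : tsupport η ⊆ K' := self_subset_cthickening _
  have hoff : ∀ z, z ∉ K' → η z = 0 ∧ ∀ (a : ℂ) k, cd a k η z = 0 := fun z hz =>
    ⟨image_eq_zero_of_notMem_tsupport fun h => hz (hKK h),
      fun a k => cd_zero_of_notMem_tsupport fun h => hz (hKK h)⟩
  -- weights
  set q0 : EN N → ℂ := fun z => Complex.exp (-(cr φ z) / 2) with hq0
  set p0 : EN N → ℂ := fun z => Complex.exp ((cr ψ z - cr φ z) / 2) with hp0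
  have hφcont : ContinuousOn (cr φ) Ω := (contDiffOn_cr hφ).continuousOn
  have hψcont : ContinuousOn (cr ψ) Ω := (contDiffOn_cr hψ).continuousOn
  have hq0c : ContinuousOn q0 K' := (Complex.continuous_exp.comp_continuousOn (hφcont.neg.div_const 2)).mono hδs
  have hp0c : ContinuousOn p0 K' := (Complex.continuous_exp.comp_continuousOn
    ((hψcont.sub hφcont).div_const 2)).mono hδs
  set q := K'.indicator q0 with hq
  set p := K'.indicator p0 with hp
  obtain ⟨hqm, Cq, hCq⟩ := bdd_of_compact hK'c hq0c
  obtain ⟨hpm, Cp, hCp⟩ := bdd_of_compact hK'c hp0c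
  have hwt : ∀ z ∈ K', ‖q z‖^2 = Real.exp (-φ z) ∧ ‖p z‖^2 = Real.exp (ψ z) * Real.exp (-φ z) := by
    intro z hz
    rw [hq, hp, indicator_of_mem hz, indicator_of_mem hz, hq0, hp0]
    simp only [Complex.norm_exp, ← Real.exp_nat_mul, ← Real.exp_add, cr]
    have a1 : (-(φ z : ℂ) / 2).re = -φ z / 2 := by
      rw [show (-(φ z : ℂ) / 2) = ((-φ z / 2 : ℝ) : ℂ) by push_cast; rfl, Complex.ofReal_re]
    have a2 : (((ψ z : ℂ) - φ z) / 2).re = (ψ z - φ z) / 2 := by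
      rw [show (((ψ z : ℂ) - φ z) / 2) = (((ψ z - φ z) / 2 : ℝ) : ℂ) by push_cast; rfl, Complex.ofReal_re]
    rw [a1, a2]
    constructor <;> · congr 1; push_cast; ring
  -- the functions
  have mF : ∀ j, MemLp (fun z => η z * f j z) 2 (LM N) := fun j => (hf j).mul_test hη0
  have hsf : L2loc Ω (fun z => ∑ j, s j z * f j z) := L2loc.sum _ fun j _ => (hf j).cont_mul (hsc j)
  have hts : L2loc Ω (fun z => t z - ∑ j, s j z * f j z) := ht.sub hsf
  have mA0 : MemLp (fun z => (∑ j, dd j η z * f j z) + η z * (t z - ∑ j, s j z * f j z)) 2 (LM N) :=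
    (memLp_finsetSum _ fun j _ => (hf j).mul_test (hη1 _ _)).add (hts.mul_test hη0)
  have mB : ∀ j k, MemLp (fun z => dbar k η z * f j z - dbar j η z * f k z) 2 (LM N) := fun j k =>
    ((hf j).mul_test (hη1 _ _)).sub ((hf k).mul_test (hη1 _ _))
  -- mollified identities
  have idA : ∀ ε : ℝ, 0 < ε → ∀ x, ∑ j, dd j (mo ε (fun z => η z * f j z)) x
      = mo ε (fun z => (∑ j, dd j η z * f j z) + η z * (t z - ∑ j, s j z * f j z)) x := fun ε hε x =>
    weak_moll hΩ hη Finset.univ hf hts (fun _ => -Complex.I) (fun j => j) h2 hε x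
  have idB : ∀ ε : ℝ, 0 < ε → ∀ j k x, dbar k (mo ε (fun z => η z * f j z)) x
      - dbar j (mo ε (fun z => η z * f k z)) x
      = mo ε (fun z => dbar k η z * f j z - dbar j η z * f k z) x := by
    intro ε hε j k x
    have hfb : ∀ b : Bool, L2loc Ω (if b then f j else fun z => - f k z) := by
      intro b; cases b
      · simpa using (hf k).neg
      · simpa using hf j
    have := weak_moll hΩ hη (Finset.univ : Finset Bool) hfb (t := fun _ => 0)
      (fun K _ _ => MemLp.zero') (fun _ => Complex.I) (fun b => if b then k else j) (by
        intro w hw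
        simp only [Fintype.sum_bool, if_true, zero_mul, integral_zero, neg_zero]
        simp only [Bool.false_eq_true, if_false, neg_mul, integral_neg]
        rw [h1 j k w hw]; ring) hε x
    simp only [Fintype.sum_bool, if_true] at this
    simp only [Bool.false_eq_true, if_false, mul_neg, mul_zero, add_zero] at this
    have e : mo ε (fun z => -(η z * f k z)) = fun z => -(mo ε (fun z => η z * f k z) z) := by
      ext z; unfold mo; rw [← integral_neg]; congr 1; ext y; ring
    rw [e, cd_neg] at this
    simpa [sub_eq_add_neg] using this
  -- the estimate for each ε
  have hev : ∀ᶠ ε : ℝ in 𝓝[>] 0, 0 ≤ 2 * ∫ z, ‖q z * (mo ε (fun z => (∑ j, dd j η z * f j z)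
        + η z * (t z - ∑ j, s j z * f j z)) z + ∑ j, K'.indicator (s j) z * mo ε (fun z => η z * f j z) z)‖^2 ∂(LM N)
        + (1/2) * (∑ j, ∑ k, ∫ z, ‖q z * mo ε (fun z => dbar k η z * f j z - dbar j η z * f k z) z‖^2 ∂(LM N))
        - 2 * ∑ j, ∫ z, ‖p z * mo ε (fun z => η z * f j z) z‖^2 ∂(LM N) := by
    filter_upwards [Ioo_mem_nhdsGT hδ] with ε hε
    have hmoff : ∀ {g : EN N → ℂ}, (∀ z, z ∉ tsupport η → g z = 0) → ∀ x, x ∉ K' → mo ε g x = 0 := by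
      intro g hg x hx
      exact mo_tsupport hε.1 hg x fun h => hx (cthickening_mono hε.2.le _ h)
    have hgz : ∀ z, z ∉ tsupport η → η z = 0 ∧ ∀ (a : ℂ) k, cd a k η z = 0 := fun z hz =>
      ⟨image_eq_zero_of_notMem_tsupport hz, fun a k => cd_zero_of_notMem_tsupport hz⟩
    have oF : ∀ j x, x ∉ K' → mo ε (fun z => η z * f j z) x = 0 := fun j =>
      hmoff fun z hz => by simp [(hgz z hz).1]
    have oB : ∀ j k x, x ∉ K' → mo ε (fun z => dbar k η z * f j z - dbar j η z * f k z) x = 0 := fun j k =>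
      hmoff fun z hz => by simp [(hgz z hz).2]
    have oA : ∀ x, x ∉ K' → mo ε (fun z => (∑ j, dd j η z * f j z)
        + η z * (t z - ∑ j, s j z * f j z)) x = 0 :=
      hmoff fun z hz => by simp [(hgz z hz).1, (hgz z hz).2]
    have tF : ∀ j, Tst 2 Ω (mo ε (fun z => η z * f j z)) := by
      intro j
      have hts : tsupport (mo ε (fun z => η z * f j z)) ⊆ K' :=
        closure_minimal (fun x hx => by by_contra h; exact hx (oF j x h)) hK'c.isClosed
      exact ⟨mo_contDiff hε.1 (memLp_locInt (mF j)), hK'c.of_isClosed_subset (isClosed_tsupport _) hts,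
        hts.trans hδs⟩
    have hb := basic_est hΩ hφ hψ hW tF
    have hcont : ∀ {g : EN N → ℂ}, MemLp g 2 (LM N) → (∀ x, x ∉ K' → mo ε g x = 0) →
        MemLp (mo ε g) 2 (LM N) := by
      intro g hg h0
      have hc : Continuous (mo ε g) := (mo_contDiff hε.1 (memLp_locInt hg) (n := 0)).continuous
      refine hc.memLp_of_hasCompactSupport ?_
      exact HasCompactSupport.intro hK'c h0
    have hqmul : ∀ {g b : EN N → ℂ} {C : ℝ}, AEStronglyMeasurable b (LM N) → (∀ x, ‖b x‖ ≤ C) →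
        MemLp g 2 (LM N) → MemLp (fun z => b z * g z) 2 (LM N) := by
      intro g b C hb hC hg
      exact hg.of_le_mul (c := C) (hb.mul hg.1) (Eventually.of_forall fun x => by
        rw [norm_mul]; gcongr; exact hC x)
    have hsp := quad_split (φ := φ) (ψ := ψ) (q := q) (p := p)
      (A := fun z => mo ε (fun z => (∑ j, dd j η z * f j z)
        + η z * (t z - ∑ j, s j z * f j z)) z + ∑ j, K'.indicator (s j) z * mo ε (fun z => η z * f j z) z)
      (B := fun j k => mo ε (fun z => dbar k η z * f j z - dbar j η z * f k z))
      (F := fun j => mo ε (fun z => η z * f j z))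
      (hqmul hqm hCq ((hcont mA0 oA).add (memLp_finsetSum _ fun j _ => by
        obtain ⟨a1, C, a2⟩ := bdd_of_compact hK'c ((hsc j).mono hδs)
        exact hqmul a1 a2 (hcont (mF j) (oF j)))))
      (fun j k => hqmul hqm hCq (hcont (mB j k) (oB j k)))
      (fun j => hqmul hpm hCp (hcont (mF j) (oF j)))
      (by
        intro z
        by_cases hz : z ∈ K'
        · exact Or.inl (hwt z hz)
        · refine Or.inr ⟨?_, fun j k => oB j k z hz, fun j => oF j z hz⟩
          simp [oA z hz, oF _ z hz])
    rw [← hsp]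
    refine hb.trans_eq ?_
    congr 1; ext z
    simp only [idB ε hε.1, Finset.sum_add_distrib, idA ε hε.1]
    by_cases hz : z ∈ K'
    · simp only [indicator_of_mem hz, hs]
      have e : ∀ F : Fin N → ℂ, ∑ j, F j * dd j (cr (fun x => ψ x - φ x)) z
        = ∑ j, dd j (cr (fun x => ψ x - φ x)) z * F j := fun F =>
        Finset.sum_congr rfl fun j _ => mul_comm _ _
      rw [e]
    · simp [oF _ z hz, indicator_of_notMem hz]
  -- pass to the limit
  have LA : L2T (𝓝[>] (0:ℝ)) (fun ε z => q z * (mo ε (fun z => (∑ j, dd j η z * f j z)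
        + η z * (t z - ∑ j, s j z * f j z)) z + ∑ j, K'.indicator (s j) z * mo ε (fun z => η z * f j z) z))
      (fun z => q z * (((∑ j, dd j η z * f j z)
        + η z * (t z - ∑ j, s j z * f j z)) + ∑ j, K'.indicator (s j) z * (η z * f j z))) := by
    refine L2T.bmul ((moll_L2T mA0).add (L2T.sum _ fun j _ => ?_)) hqm hCq
    obtain ⟨a1, C, a2⟩ := bdd_of_compact hK'c ((hsc j).mono hδs)
    exact (moll_L2T (mF j)).bmul a1 a2
  have LB := fun j k => (moll_L2T (mB j k)).bmul hqm hCq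
  have LF := fun j => (moll_L2T (mF j)).bmul hpm hCp
  have hlim := ((LA.tendsto_sq.const_mul 2).add ((tendsto_finsetSum Finset.univ fun j _ =>
    tendsto_finsetSum Finset.univ fun k _ => (LB j k).tendsto_sq).const_mul (1/2))).sub
    ((tendsto_finsetSum Finset.univ fun j _ => (LF j).tendsto_sq).const_mul 2)
  have h0 := ge_of_tendsto hlim hev
  rw [← quad_split (φ := φ) (ψ := ψ) LA.lim (fun j k => (LB j k).lim) (fun j => (LF j).lim)] at h0
  · refine h0.trans_eq ?_
    congr 1; ext z
    congr 6
    by_cases hz : z ∈ K'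
    · simp only [indicator_of_mem hz]
      have : ∑ j, s j z * (η z * f j z) = η z * ∑ j, s j z * f j z := by
        rw [Finset.mul_sum]; exact Finset.sum_congr rfl fun j _ => by ring
      rw [this]; ring
    · simp [(hoff z hz).1]
  · intro z
    by_cases hz : z ∈ K'
    · exact Or.inl (hwt z hz)
    · refine Or.inr ⟨?_, fun j k => ?_, fun j => ?_⟩
      · simp [(hoff z hz).1, (hoff z hz).2]
      · simp [(hoff z hz).2]
      · simp [(hoff z hz).1]

end LP
end

noncomputable section
open Set Filter Topology Metric MeasureTheory
open scoped ENNReal NNReal InnerProductSpace ComplexConjugate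
namespace LP
variable {N : ℕ} {Ω : Set (EN N)}

/-- a good sequence of cutoffs -/
structure Cutoffs (Ω : Set (EN N)) (ψ : EN N → ℝ) (η : ℕ → EN N → ℂ) : Prop where
  tst : ∀ n, Tst 2 Ω (η n)
  le_one : ∀ n z, ‖η n z‖ ≤ 1
  grad : ∀ n, ∀ z ∈ Ω, ∀ j, ‖dbar j (η n) z‖^2 ≤ Real.exp (ψ z) ∧ ‖dd j (η n) z‖^2 ≤ Real.exp (ψ z)
  one : ∀ z ∈ Ω, ∀ᶠ n in atTop, η n =ᶠ[𝓝 z] fun _ => 1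

lemma cd_const {a : ℂ} {j : Fin N} {c : ℂ} {z : EN N} : cd a j (fun _ => c) z = 0 := by
  simp [cd]

lemma sq_norm_sum_le (a : Fin N → ℂ) : ‖∑ j, a j‖^2 ≤ N * ∑ j, ‖a j‖^2 := by
  calc ‖∑ j, a j‖^2 ≤ (∑ j, ‖a j‖)^2 := by gcongr; exact norm_sum_le _ _
    _ ≤ _ := by simpa using sq_sum_le_card_mul_sum_sq (s := Finset.univ) (f := fun j => ‖a j‖)

lemma sq_add_le (a b : ℂ) : ‖a + b‖^2 ≤ 2 * ‖a‖^2 + 2 * ‖b‖^2 := by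
  have := norm_add_le a b
  nlinarith [sq_nonneg (‖a‖ - ‖b‖), norm_nonneg (a+b), norm_nonneg a, norm_nonneg b]

lemma cut_pt_aux {X Y Z S T n : ℝ} (h1 : 0 ≤ X) (h2 : X ≤ 2 * (n * S) + 2 * T) (h3 : 0 ≤ Y)
    (h4 : Y ≤ 4 * (n * S)) (h5 : 0 ≤ Z) (h6 : Z ≤ S)  :
    |2 * X + (1/2) * Y - 2 * Z| ≤ (6 * n + 2) * S + 4 * T := by
  rw [abs_le]; constructor <;> linarith

lemma cut_pt (a b f : Fin N → ℂ) (η t : ℂ) {e : ℝ} (he0 : 0 ≤ e) (ha : ∀ j, ‖a j‖^2 ≤ e)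
    (hb : ∀ j, ‖b j‖^2 ≤ e) (hη : ‖η‖ ≤ 1) :
    |2 * ‖(∑ j, a j * f j) + η * t‖^2 + (1/2) * (∑ j, ∑ k, ‖b k * f j - b j * f k‖^2)
      - 2 * (e * ∑ j, ‖η * f j‖^2)| ≤ (6 * N + 2) * (e * ∑ j, ‖f j‖^2) + 4 * ‖t‖^2 := by
  set S := ∑ j, ‖f j‖^2 with hS
  have hS0 : 0 ≤ S := Finset.sum_nonneg fun _ _ => sq_nonneg _
  have r1 : ‖(∑ j, a j * f j) + η * t‖^2 ≤ 2 * (N * (e * S)) + 2 * ‖t‖^2 := by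
    refine (sq_add_le _ _).trans ?_
    have c1 : ‖∑ j, a j * f j‖^2 ≤ N * (e * S) := by
      refine (sq_norm_sum_le _).trans ?_
      refine mul_le_mul_of_nonneg_left ?_ (Nat.cast_nonneg _)
      rw [hS, Finset.mul_sum]
      refine Finset.sum_le_sum fun j _ => ?_
      rw [norm_mul, mul_pow]
      exact mul_le_mul_of_nonneg_right (ha j) (sq_nonneg _)
    have c2 : ‖η * t‖^2 ≤ ‖t‖^2 := by
      rw [norm_mul]; gcongr
      nlinarith [norm_nonneg t]
    linarith
  have r2 : ∑ j, ∑ k, ‖b k * f j - b j * f k‖^2 ≤ 4 * (N * (e * S)) := by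
    have : ∀ j k, ‖b k * f j - b j * f k‖^2 ≤ 2 * (e * ‖f j‖^2) + 2 * (e * ‖f k‖^2) := by
      intro j k
      rw [sub_eq_add_neg]
      refine (sq_add_le _ _).trans ?_
      rw [norm_neg, norm_mul, norm_mul, mul_pow, mul_pow]
      have := mul_le_mul_of_nonneg_right (hb k) (sq_nonneg ‖f j‖)
      have := mul_le_mul_of_nonneg_right (hb j) (sq_nonneg ‖f k‖)
      linarith
    refine (Finset.sum_le_sum fun j _ => Finset.sum_le_sum fun k _ => this j k).trans (le_of_eq ?_)
    simp only [Finset.sum_add_distrib, Finset.sum_const, ← Finset.mul_sum, Finset.card_univ,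
      Fintype.card_fin, nsmul_eq_mul]
    rw [← hS]; ring
  have r3 : ∑ j, ‖η * f j‖^2 ≤ S := by
    rw [hS]
    refine Finset.sum_le_sum fun j _ => ?_
    rw [norm_mul]
    gcongr
    nlinarith [norm_nonneg (f j)]
  have r30 : 0 ≤ ∑ j, ‖η * f j‖^2 := Finset.sum_nonneg fun _ _ => sq_nonneg _
  have r20 : 0 ≤ ∑ j, ∑ k, ‖b k * f j - b j * f k‖^2 :=
    Finset.sum_nonneg fun _ _ => Finset.sum_nonneg fun _ _ => sq_nonneg _
  have r4 := mul_le_mul_of_nonneg_left r3 he0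
  have r5 := mul_nonneg he0 r30
  have r10 := sq_nonneg ‖(∑ j, a j * f j) + η * t‖
  exact cut_pt_aux r10 r1 r20 r2 r5 r4 

lemma cut_lim (hΩ : IsOpen Ω) {φ ψ : EN N → ℝ} (hφ : ContDiffOn ℝ 2 φ Ω)
    (hψ : ContDiffOn ℝ 2 ψ Ω) (hW : WeightIneq Ω φ ψ) {η : ℕ → EN N → ℂ} (hη : Cutoffs Ω ψ η)
    {f : Fin N → EN N → ℂ} (hf : ∀ j, L2loc Ω (f j)) {t : EN N → ℂ} (ht : L2loc Ω t)
    (h1 : ∀ j k w, Tst 2 Ω w → ∫ z, f j z * dbar k w z ∂(LM N) = ∫ z, f k z * dbar j w z ∂(LM N))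
    (h2 : ∀ w, Tst 2 Ω w → ∑ j, ∫ z, f j z * dd j w z ∂(LM N)
      = -∫ z, (t z - ∑ j, dd j (cr (fun x => ψ x - φ x)) z * f j z) * w z ∂(LM N))
    (hfm : ∀ j, AEStronglyMeasurable (f j) ((LM N).restrict Ω))
    (htm : AEStronglyMeasurable t ((LM N).restrict Ω))
    (hfi : ∀ j, IntegrableOn (fun z => Real.exp (ψ z - φ z) * ‖f j z‖^2) Ω (LM N))
    (hti : IntegrableOn (fun z => Real.exp (-φ z) * ‖t z‖^2) Ω (LM N)) :
    ∑ j, ∫ z in Ω, Real.exp (ψ z - φ z) * ‖f j z‖^2 ∂(LM N)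
      ≤ ∫ z in Ω, Real.exp (-φ z) * ‖t z‖^2 ∂(LM N) := by
  set I : ℕ → EN N → ℝ := fun n z => (2 * ‖(∑ j, dd j (η n) z * f j z) + η n z * t z‖^2
      + (1/2) * (∑ j, ∑ k, ‖dbar k (η n) z * f j z - dbar j (η n) z * f k z‖^2)
      - 2 * (Real.exp (ψ z) * ∑ j, ‖η n z * f j z‖^2)) * Real.exp (-φ z) with hI
  have hpos : ∀ n, 0 ≤ ∫ z in Ω, I n z ∂(LM N) := by
    intro n
    have := cut_est hΩ hφ hψ hW (hη.tst n) hf ht h1 h2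
    rw [setIntegral_eq_integral_of_forall_compl_eq_zero]
    · exact this
    · intro z hz
      have a1 : η n z = 0 := image_eq_zero_of_notMem_tsupport fun h => hz ((hη.tst n).sub h)
      have a2 : ∀ (a : ℂ) k, cd a k (η n) z = 0 := fun a k =>
        cd_zero_of_notMem_tsupport fun h => hz ((hη.tst n).sub h)
      simp [hI, a1, a2]
  have hlim : Tendsto (fun n => ∫ z in Ω, I n z ∂(LM N)) atTop
      (𝓝 (∫ z in Ω, (2 * (Real.exp (-φ z) * ‖t z‖^2) - 2 * ∑ j, Real.exp (ψ z - φ z) * ‖f j z‖^2) ∂(LM N))) := by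
    have hφm : AEStronglyMeasurable φ ((LM N).restrict Ω) := hφ.continuousOn.aestronglyMeasurable hΩ.measurableSet
    have hψm : AEStronglyMeasurable ψ ((LM N).restrict Ω) := hψ.continuousOn.aestronglyMeasurable hΩ.measurableSet
    refine tendsto_integral_of_dominated_convergence (fun z => (6 * N + 2) * (∑ j, Real.exp (ψ z - φ z) * ‖f j z‖^2)
      + 4 * (Real.exp (-φ z) * ‖t z‖^2)) ?_ ?_ ?_ ?_
    · intro n
      have a1 : AEStronglyMeasurable (η n) ((LM N).restrict Ω) := (hη.tst n).smooth.continuous.aestronglyMeasurable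
      have a2 : ∀ (a : ℂ) k, AEStronglyMeasurable (cd a k (η n)) ((LM N).restrict Ω) := fun a k =>
        ((hη.tst n).cd a k).smooth.continuous.aestronglyMeasurable
      have b1 : AEStronglyMeasurable (fun z => Real.exp (-φ z)) ((LM N).restrict Ω) :=
        Real.continuous_exp.comp_aestronglyMeasurable hφm.neg
      have b2 : AEStronglyMeasurable (fun z => Real.exp (ψ z)) ((LM N).restrict Ω) :=
        Real.continuous_exp.comp_aestronglyMeasurable hψm
      have s1 : AEStronglyMeasurable (fun z => ∑ j, dd j (η n) z * f j z) ((LM N).restrict Ω) :=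
        Finset.aestronglyMeasurable_fun_sum _ fun j _ => (a2 _ j).mul (hfm j)
      have s2 : AEStronglyMeasurable (fun z => ∑ j, ∑ k, ‖dbar k (η n) z * f j z - dbar j (η n) z * f k z‖^2)
          ((LM N).restrict Ω) :=
        Finset.aestronglyMeasurable_fun_sum _ fun j _ => Finset.aestronglyMeasurable_fun_sum _ fun k _ =>
          (((a2 _ k).mul (hfm j)).sub ((a2 _ j).mul (hfm k))).norm.pow 2
      have s3 : AEStronglyMeasurable (fun z => ∑ j, ‖η n z * f j z‖^2) ((LM N).restrict Ω) :=
        Finset.aestronglyMeasurable_fun_sum _ fun j _ => (a1.mul (hfm j)).norm.pow 2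
      exact ((((s1.add (a1.mul htm)).norm.pow 2).const_mul 2).add (s2.const_mul (1/2)) |>.sub
        ((b2.mul s3).const_mul 2)).mul b1
    · exact ((integrable_finsetSum _ fun j _ => hfi j).const_mul _).add (hti.const_mul 4)
    · intro n
      filter_upwards [ae_restrict_mem hΩ.measurableSet] with z hz
      have hb : (6 * N + 2) * (∑ j, Real.exp (ψ z - φ z) * ‖f j z‖^2) + 4 * (Real.exp (-φ z) * ‖t z‖^2)
          = ((6 * N + 2) * (Real.exp (ψ z) * ∑ j, ‖f j z‖^2) + 4 * ‖t z‖^2) * Real.exp (-φ z) := by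
        rw [← Finset.mul_sum, sub_eq_add_neg, Real.exp_add]; ring
      rw [hb, hI, norm_mul, Real.norm_eq_abs, Real.norm_eq_abs, Real.abs_exp]
      refine mul_le_mul_of_nonneg_right ?_ (Real.exp_pos _).le
      exact cut_pt (fun j => dd j (η n) z) (fun j => dbar j (η n) z) (fun j => f j z) (η n z) (t z)
        (Real.exp_pos _).le (fun j => (hη.grad n z hz j).2) (fun j => (hη.grad n z hz j).1) (hη.le_one n z)
    · filter_upwards [ae_restrict_mem hΩ.measurableSet] with z hz
      refine tendsto_const_nhds.congr' ?_
      filter_upwards [hη.one z hz] with n hn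
      have a1 : η n z = 1 := hn.self_of_nhds
      have a2 : ∀ (a : ℂ) k, cd a k (η n) z = 0 := fun a k => by rw [cd_congr hn, cd_const]
      rw [hI]
      simp only [a1, a2, zero_mul, Finset.sum_const_zero, zero_add, one_mul, sub_zero, norm_zero]
      rw [← Finset.mul_sum, sub_eq_add_neg (ψ z), Real.exp_add]
      norm_num
      ring
  have h0 := ge_of_tendsto' hlim hpos
  rw [integral_sub (hti.const_mul 2) ((integrable_finsetSum _ fun j _ => hfi j).const_mul _),
    integral_const_mul, integral_const_mul, integral_finsetSum _ fun j _ => hfi j] at h0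
  linarith

/-- abstract Riesz lemma -/
lemma riesz_abs {X H : Type*} [AddCommGroup X] [Module ℂ X] [NormedAddCommGroup H] [InnerProductSpace ℂ H]
    [CompleteSpace H] (T : X →ₗ[ℂ] H) (ℓ : X →ₗ[ℂ] ℂ) {C : ℝ} (h : ∀ x, ‖ℓ x‖ ≤ C * ‖T x‖) :
    ∃ Y : H, ∀ x, ⟪Y, T x⟫_ℂ = ℓ x := by
  have hk : LinearMap.ker T ≤ LinearMap.ker ℓ := by
    intro x hx
    rw [LinearMap.mem_ker] at hx ⊢
    have := h x
    rw [hx, norm_zero, mul_zero] at this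
    exact norm_le_zero_iff.1 this
  let g : LinearMap.range T →ₗ[ℂ] ℂ := ((LinearMap.ker T).liftQ ℓ hk).comp T.quotKerEquivRange.symm.toLinearMap
  have hg : ∀ x, g ⟨T x, LinearMap.mem_range_self T x⟩ = ℓ x := by
    intro x
    have : T.quotKerEquivRange.symm ⟨T x, LinearMap.mem_range_self T x⟩ = Submodule.Quotient.mk x := by
      rw [LinearEquiv.symm_apply_eq]; rfl
    show (LinearMap.ker T).liftQ ℓ hk (T.quotKerEquivRange.symm _) = _
    rw [this]; simp
  let gc : LinearMap.range T →L[ℂ] ℂ := g.mkContinuous C (by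
    rintro ⟨_, x, rfl⟩
    rw [hg]; exact h x)
  obtain ⟨G, hG, -⟩ := exists_extension_norm_eq (LinearMap.range T) gc
  refine ⟨(InnerProductSpace.toDual ℂ H).symm G, fun x => ?_⟩
  rw [InnerProductSpace.toDual_symm_apply]
  have := hG ⟨T x, LinearMap.mem_range_self T x⟩
  rw [this]
  exact hg x

end LP
end

noncomputable section
open Set Filter Topology Metric MeasureTheory
open scoped ENNReal NNReal InnerProductSpace ComplexConjugate
namespace LP
variable {N : ℕ} {Ω : Set (EN N)}

/-- real exponential weights as complex functions -/
def ex (h : EN N → ℝ) (z : EN N) : ℂ := ((Real.exp (h z) : ℝ) : ℂ)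

lemma ex_conj (h : EN N → ℝ) (z : EN N) : conj (ex h z) = ex h z := Complex.conj_ofReal _
lemma ex_norm (h : EN N → ℝ) (z : EN N) : ‖ex h z‖ = Real.exp (h z) := by
  simp [ex]
lemma ex_ne (h : EN N → ℝ) (z : EN N) : ex h z ≠ 0 := by
  simp [ex]
lemma ex_mul {h k l : EN N → ℝ} {z : EN N} (e : h z + k z = l z) : ex h z * ex k z = ex l z := by
  simp only [ex]; rw [← e, Real.exp_add]; push_cast; rfl
lemma ex_one {h k : EN N → ℝ} {z : EN N} (e : h z + k z = 0) : ex h z * ex k z = 1 := by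
  simp only [ex]; rw [← Complex.ofReal_mul, ← Real.exp_add, e]; simp

lemma ex_eq (h : EN N → ℝ) : ex h = fun z => Complex.exp (cr h z) := by
  funext z; simp [ex, cr]

lemma ex_contDiffOn {n : WithTop ℕ∞} {h : EN N → ℝ} (hh : ContDiffOn ℝ n h Ω) : ContDiffOn ℝ n (ex h) Ω := by
  rw [ex_eq]; exact (contDiffOn_cr hh).cexp

lemma cd_ex {a : ℂ} {j : Fin N} {h : EN N → ℝ} {z : EN N} (hw : DifferentiableAt ℝ (cr h) z) :
    cd a j (ex h) z = ex h z * cd a j (cr h) z := by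
  rw [ex_eq]; exact cd_exp hw

lemma MemLp.L2loc {h : EN N → ℂ} (hh : MemLp h 2 ((LM N).restrict Ω)) : L2loc Ω h := fun _ hK _ =>
  hh.mono_measure (Measure.restrict_mono hK le_rfl)

abbrev L2s (Ω : Set (EN N)) := Lp ℂ 2 ((LM N).restrict Ω)
abbrev H2 (Ω : Set (EN N)) := PiLp 2 (fun _ : Fin N => L2s Ω)

lemma Tst.memLp {w : EN N → ℂ} (h : Tst 0 Ω w) : MemLp w 2 ((LM N).restrict Ω) := by
  have : Continuous w := h.smooth.continuous
  exact (this.memLp_of_hasCompactSupport h.cpt).mono_measure Measure.restrict_le_self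

def toL (a : Fin N → EN N → ℂ) (ha : ∀ j, MemLp (a j) 2 ((LM N).restrict Ω)) : H2 Ω :=
  WithLp.toLp 2 (fun j => (ha j).toLp (a j))

lemma inner_L2 (X Y : L2s Ω) : ⟪X, Y⟫_ℂ = ∫ z in Ω, Y z * conj (X z) ∂(LM N) := by
  rw [L2.inner_def]; rfl

lemma toL_coe {a : Fin N → EN N → ℂ} (ha : ∀ j, MemLp (a j) 2 ((LM N).restrict Ω)) (j) :
    (toL a ha j : EN N → ℂ) =ᵐ[(LM N).restrict Ω] a j := (ha j).coeFn_toLp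

lemma inner_toL_left {a : Fin N → EN N → ℂ} (ha : ∀ j, MemLp (a j) 2 ((LM N).restrict Ω)) (X : H2 Ω) :
    ⟪toL a ha, X⟫_ℂ = ∑ j, ∫ z in Ω, X j z * conj (a j z) ∂(LM N) := by
  rw [PiLp.inner_apply]
  refine Finset.sum_congr rfl fun j _ => ?_
  rw [inner_L2]
  refine integral_congr_ae ?_
  filter_upwards [toL_coe ha j] with z hz
  rw [hz]

lemma normsq_L2 (X : L2s Ω) : ‖X‖^2 = ∫ z in Ω, ‖X z‖^2 ∂(LM N) := by
  have h : ((‖X‖^2 : ℝ) : ℂ) = ⟪X, X⟫_ℂ := by rw [inner_self_eq_norm_sq_to_K]; push_cast; rfl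
  have : ⟪X, X⟫_ℂ = ((∫ z in Ω, ‖X z‖^2 ∂(LM N) : ℝ) : ℂ) := by
    rw [inner_L2, ← integral_complex_ofReal]
    refine integral_congr_ae (Eventually.of_forall fun z => ?_)
    simp only
    rw [Complex.mul_conj, Complex.normSq_eq_norm_sq]
  rw [this] at h
  exact_mod_cast h

lemma setInt_tst {w u : EN N → ℂ} (h : Tst 0 Ω w) : ∫ z in Ω, u z * w z ∂(LM N) = ∫ z, u z * w z ∂(LM N) := by
  refine setIntegral_eq_integral_of_forall_compl_eq_zero fun z hz => ?_
  rw [image_eq_zero_of_notMem_tsupport fun h' => hz (h.sub h'), mul_zero]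

lemma memLp_L2s (X : L2s Ω) : MemLp X 2 ((LM N).restrict Ω) := Lp.memLp X

/-- generators of the complement of the closed forms -/
def Agen (Ω : Set (EN N)) (σ : EN N → ℝ) : Set (H2 Ω) :=
  {s | ∃ j k : Fin N, ∃ w : EN N → ℂ, Tst 2 Ω w ∧ ∀ X : H2 Ω, ⟪s, X⟫_ℂ =
    ∫ z, (ex (fun z => -(σ z / 2)) z * X j z) * dbar k w z ∂(LM N)
      - ∫ z, (ex (fun z => -(σ z / 2)) z * X k z) * dbar j w z ∂(LM N)}

def Acl (Ω : Set (EN N)) (σ : EN N → ℝ) : Submodule ℂ (H2 Ω) := (Submodule.span ℂ (Agen Ω σ))ᗮ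

lemma single_inner (X : H2 Ω) (j : Fin N) (S : L2s Ω) :
    ⟪(WithLp.toLp 2 (Pi.single j S) : H2 Ω), X⟫_ℂ = ⟪S, X j⟫_ℂ := by
  rw [PiLp.inner_apply, Finset.sum_eq_single j]
  · simp
  · intro b _ hb
    simp [Pi.single_eq_of_ne hb]
  · simp

lemma single_test (hΩ : IsOpen Ω) {σ : EN N → ℝ} (hσ : ContDiffOn ℝ 2 σ Ω) (j : Fin N) {w : EN N → ℂ} (hw : Tst 0 Ω w) :
    ∃ s : H2 Ω, ∀ X : H2 Ω, ⟪s, X⟫_ℂ = ∫ z, (ex (fun z => -(σ z / 2)) z * X j z) * w z ∂(LM N) := by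
  have hq : ContDiffOn ℝ 2 (ex (fun z => -(σ z / 2))) Ω := ex_contDiffOn (hσ.div_const 2).neg
  have hq0 : ContDiffOn ℝ (0:ℕ) (ex (fun z => -(σ z / 2))) Ω := hq.of_le (by norm_num)
  have ht := (hw.conj.mul_left hΩ hq0)
  refine ⟨WithLp.toLp 2 (Pi.single j (Tst.memLp ht).toLp), fun X => ?_⟩
  rw [single_inner, inner_L2]
  have h1 := (Tst.memLp ht).coeFn_toLp
  have : ∫ z, (ex (fun z => -(σ z / 2)) z * X j z) * w z ∂(LM N) =
    ∫ z in Ω, (ex (fun z => -(σ z / 2)) z * X j z) * w z ∂(LM N) := (setInt_tst hw).symm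
  rw [this]
  refine integral_congr_ae ?_
  filter_upwards [h1] with z hz
  rw [hz]
  simp only [map_mul, ex_conj, Complex.conj_conj]
  ring

lemma mem_Acl (hΩ : IsOpen Ω) {σ : EN N → ℝ} (hσ : ContDiffOn ℝ 2 σ Ω) (X : H2 Ω) : X ∈ Acl Ω σ ↔
    ∀ j k w, Tst 2 Ω w → ∫ z, (ex (fun z => -(σ z / 2)) z * X j z) * dbar k w z ∂(LM N)
      = ∫ z, (ex (fun z => -(σ z / 2)) z * X k z) * dbar j w z ∂(LM N) := by
  constructor
  · intro hX j k w hw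
    obtain ⟨s, hs⟩ := single_test hΩ hσ j ((hw.cd Complex.I k).of_le (m := 0) (by norm_num))
    obtain ⟨s', hs'⟩ := single_test hΩ hσ k ((hw.cd Complex.I j).of_le (m := 0) (by norm_num))
    have hm : s - s' ∈ Agen Ω σ := ⟨j, k, w, hw, fun X => by rw [inner_sub_left, hs, hs']⟩
    have := (Submodule.mem_orthogonal _ _).1 hX _ (Submodule.subset_span hm)
    rw [inner_sub_left, hs, hs'] at this
    exact sub_eq_zero.1 this
  · intro h
    have : Submodule.span ℂ (Agen Ω σ) ≤ (Submodule.span ℂ {X})ᗮ := by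
      rw [Submodule.span_le]
      rintro s ⟨j, k, w, hw, hs⟩
      rw [SetLike.mem_coe, Submodule.mem_orthogonal_singleton_iff_inner_right, ← inner_conj_symm, hs, h j k w hw]
      simp
    rw [Acl, Submodule.mem_orthogonal]
    intro u hu
    exact Submodule.mem_orthogonal_singleton_iff_inner_left.1 (this hu)

end LP
end

noncomputable section
open Set Filter Topology Metric MeasureTheory
open scoped ENNReal NNReal InnerProductSpace ComplexConjugate
namespace LP
variable {N : ℕ} {Ω : Set (EN N)}

/-- the formal adjoint expression -/
def tt (σ : EN N → ℝ) (v : Fin N → EN N → ℂ) (z : EN N) : ℂ :=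
  ∑ j, (dd j (v j) z + v j z * dd j (cr σ) z)

lemma tt_tst (hΩ : IsOpen Ω) {σ : EN N → ℝ} (hσ : ContDiffOn ℝ 2 σ Ω) {v : Fin N → EN N → ℂ}
    (hv : ∀ j, Tst 2 Ω (v j)) : Tst 0 Ω (tt σ v) := by
  refine Tst.sum _ fun j _ => Tst.add (((hv j).cd _ j).of_le (by norm_num)) ?_
  refine Tst.mul_right hΩ ?_ ((hv j).of_le (by norm_num))
  have : ContDiffOn ℝ (1+1 : ℕ) (cr σ) Ω := by exact_mod_cast contDiffOn_cr hσ
  exact (contDiffOn_cd hΩ this _ _).of_le (by norm_num)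

lemma dd_W (hΩ : IsOpen Ω) {σ : EN N → ℝ} (hσ : ContDiffOn ℝ 2 σ Ω) {w : EN N → ℂ} (hw : Tst 2 Ω w) (j : Fin N)
    (z : EN N) (hz : z ∈ Ω) :
    dd j (fun z => ex (fun z => -σ z) z * w z) z = ex (fun z => -σ z) z * (dd j w z - w z * dd j (cr σ) z) := by
  have h1 : DifferentiableAt ℝ (cr fun z => -σ z) z :=
    ((contDiffOn_cr hσ.neg).contDiffAt (hΩ.mem_nhds hz)).differentiableAt (by norm_num)
  have h2 : DifferentiableAt ℝ (ex fun z => -σ z) z :=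
    ((ex_contDiffOn hσ.neg).contDiffAt (hΩ.mem_nhds hz)).differentiableAt (by norm_num)
  show cd _ j _ z = _
  rw [cd_mul h2 (hw.diff z), cd_ex h1]
  have : (cr fun z => -σ z) = fun z => - cr σ z := by funext x; simp [cr]
  rw [this, cd_neg]
  show _ = _ * (cd _ j w z - w z * cd _ j (cr σ) z)
  ring

lemma int4 {a b c d : EN N → ℂ} (ha : Integrable a (LM N)) (hb : Integrable b (LM N)) (hc : Integrable c (LM N))
    (hd : Integrable d (LM N)) : ∫ z, a z ∂(LM N) - ∫ z, b z ∂(LM N) - ∫ z, c z ∂(LM N) + ∫ z, d z ∂(LM N)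
      = ∫ z, (a z - b z - c z + d z) ∂(LM N) := by
  have h1 : Integrable (fun z => a z - b z) (LM N) := ha.sub hb
  have h2 : Integrable (fun z => a z - b z - c z) (LM N) := h1.sub hc
  rw [integral_add h2 hd, integral_sub h1 hc, integral_sub ha hb]

lemma int3 {a b c : EN N → ℂ} (ha : Integrable a (LM N)) (hb : Integrable b (LM N)) (hc : Integrable c (LM N)) :
    ∫ z, a z ∂(LM N) + ∫ z, b z ∂(LM N) - ∫ z, c z ∂(LM N) = ∫ z, (a z + b z - c z) ∂(LM N) := by
  have h1 : Integrable (fun z => a z + b z) (LM N) := ha.add hb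
  rw [integral_sub h1 hc, integral_add ha hb]

/-- the projection of a test form onto closed forms satisfies the hypotheses of `cut_lim` -/
lemma proj_est (hΩ : IsOpen Ω) {φ ψ : EN N → ℝ} (hφ : ContDiffOn ℝ 2 φ Ω)
    (hψ : ContDiffOn ℝ 2 ψ Ω) (hW : WeightIneq Ω φ ψ) {η : ℕ → EN N → ℂ} (hη : Cutoffs Ω ψ η)
    {v : Fin N → EN N → ℂ} (hv : ∀ j, Tst 2 Ω (v j))
    (V V1 : H2 Ω) (hV : ∀ j, (V j : EN N → ℂ) =ᵐ[(LM N).restrict Ω] fun z => ex (fun z => (ψ z - φ z)/2) z * v j z)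
    (h1 : V1 ∈ Acl Ω (fun z => ψ z - φ z)) (h2 : ∀ B ∈ Acl Ω (fun z => ψ z - φ z), ⟪B, V - V1⟫_ℂ = 0) :
    ‖V1‖^2 ≤ ∫ z in Ω, Real.exp (-φ z) * ‖tt (fun z => ψ z - φ z) v z‖^2 ∂(LM N) := by
  set σ : EN N → ℝ := fun z => ψ z - φ z with hσd
  have hσ : ContDiffOn ℝ 2 σ Ω := hψ.sub hφ
  set q := ex (fun z => -(σ z / 2)) with hq
  set p := ex (fun z => σ z / 2) with hp
  have hqc : ContDiffOn ℝ 2 q Ω := ex_contDiffOn (hσ.div_const 2).neg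
  have hpc : ContDiffOn ℝ 2 p Ω := ex_contDiffOn (hσ.div_const 2)
  have hpq : ∀ z, q z * p z = 1 := fun z => ex_one (by ring)
  have ht := tt_tst hΩ hσ hv
  have hf : ∀ j, L2loc Ω (fun z => q z * V1 j z) := fun j => (MemLp.L2loc (memLp_L2s (V1 j))).cont_mul hqc.continuousOn
  have hs1 : ∀ j, ContDiffOn ℝ (1:ℕ) (dd j (cr σ)) Ω := fun j => by
    have : ContDiffOn ℝ (1+1 : ℕ) (cr σ) Ω := by exact_mod_cast contDiffOn_cr hσ
    exact contDiffOn_cd hΩ this _ _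
  have key : ∀ j, ∫ z in Ω, Real.exp (ψ z - φ z) * ‖q z * V1 j z‖^2 ∂(LM N) = ‖V1 j‖^2 ∧
      IntegrableOn (fun z => Real.exp (ψ z - φ z) * ‖q z * V1 j z‖^2) Ω (LM N) := by
    intro j
    have : (fun z => Real.exp (ψ z - φ z) * ‖q z * V1 j z‖^2) = fun z => ‖V1 j z‖^2 := by
      funext z
      rw [norm_mul, hq, ex_norm, mul_pow, ← Real.exp_nat_mul, ← mul_assoc, ← Real.exp_add]
      have : ψ z - φ z + ((2:ℕ):ℝ) * -(σ z / 2) = 0 := by rw [hσd]; push_cast; ring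
      rw [this]; simp
    rw [this]
    exact ⟨(normsq_L2 _).symm, (memLp_L2s (V1 j)).norm.integrable_sq⟩
  have main := cut_lim hΩ hφ hψ hW hη (f := fun j z => q z * V1 j z) hf (t := tt σ v)
    (MemLp.L2loc ht.memLp) ((mem_Acl hΩ hσ V1).1 h1) ?_
    (fun j => (hqc.continuousOn.aestronglyMeasurable hΩ.measurableSet).mul (memLp_L2s (V1 j)).1)
    ht.smooth.continuous.aestronglyMeasurable (fun j => (key j).2) ?_
  · calc ‖V1‖^2 = ∑ j, ‖V1 j‖^2 := PiLp.norm_sq_eq_of_L2 _ _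
      _ = ∑ j, ∫ z in Ω, Real.exp (ψ z - φ z) * ‖q z * V1 j z‖^2 ∂(LM N) :=
        Finset.sum_congr rfl fun j _ => (key j).1.symm
      _ ≤ _ := main
  · intro w hw
    set w' : EN N → ℂ := fun z => ex (fun z => -σ z) z * w z with hw'
    have hw't : Tst 2 Ω w' := hw.mul_left hΩ (by exact_mod_cast ex_contDiffOn hσ.neg)
    have hB0 : ∀ j, Tst 0 Ω (fun z => p z * dbar j (fun z => conj (w' z)) z) := fun j =>
      ((hw't.conj.cd Complex.I j).of_le (m := 0) (by norm_num)).mul_left hΩ (hpc.of_le (by norm_num))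
    set B : H2 Ω := toL (fun j z => p z * dbar j (fun z => conj (w' z)) z) (fun j => (hB0 j).memLp) with hB
    have hBA : B ∈ Acl Ω σ := by
      rw [mem_Acl hΩ hσ]
      intro j k ω hω
      have aux : ∀ j k, ∫ z, (q z * B j z) * dbar k ω z ∂(LM N) = ∫ z, dbar j (fun z => conj (w' z)) z * dbar k ω z ∂(LM N) := by
        intro j k
        have t0 : Tst 0 Ω (dbar k ω) := (hω.cd _ k).of_le (by norm_num)
        rw [← setInt_tst t0, ← setInt_tst t0]
        refine integral_congr_ae ?_
        filter_upwards [toL_coe (fun j => (hB0 j).memLp) j] with z hz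
        rw [hB, hz, ← mul_assoc, hpq, one_mul]
      rw [aux, aux]
      exact ibp2 hΩ (hw't.conj.smooth.contDiffOn.of_le (by norm_num)) hω _ _ _ _
    have hz := h2 B hBA
    rw [hB, inner_toL_left] at hz
    have hdd : ∀ j, ∀ z ∈ Ω, p z * (p z * conj (dbar j (fun z => conj (w' z)) z)) = dd j w z - w z * dd j (cr σ) z := by
      intro j z hz
      have : conj (dbar j (fun z => conj (w' z)) z) = dd j w' z := by
        show conj (cd _ j _ z) = cd _ j _ z
        rw [cd_conj (hw't.diff z)]; simp
      rw [this, hw', dd_W hΩ hσ hw j z hz, ← mul_assoc, ← mul_assoc, ex_mul (l := σ) (by ring),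
        ex_one (by ring), one_mul]
    have hvV : ∑ j, ∫ z in Ω, (v j z - q z * V1 j z) * (dd j w z - w z * dd j (cr σ) z) ∂(LM N) = 0 := by
      rw [← hz]
      refine Finset.sum_congr rfl fun j _ => ?_
      refine integral_congr_ae ?_
      filter_upwards [hV j, Lp.coeFn_sub (V j) (V1 j), ae_restrict_mem hΩ.measurableSet] with z e1 e2 hzΩ
      have : (V - V1) j z = V j z - V1 j z := by
        rw [PiLp.sub_apply, e2]; rfl
      rw [this, e1, ← hdd j z hzΩ]
      have e3 : v j z - q z * V1 j z = q z * (p z * v j z - V1 j z) := by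
        rw [mul_sub, ← mul_assoc, hpq, one_mul]
      rw [e3, map_mul, hp, ex_conj, ← hp]
      linear_combination ((p z * v j z - V1 j z) * p z * conj (dbar j (fun z => conj (w' z)) z)) * hpq z
    have w0 : Tst 0 Ω w := hw.of_le (by norm_num)
    have wd : ∀ j, Tst 0 Ω (dd j w) := fun j => (hw.cd _ j).of_le (by norm_num)
    have ws : ∀ j, Tst 0 Ω (fun z => w z * dd j (cr σ) z) := fun j => w0.mul_right hΩ ((hs1 j).of_le (by norm_num))
    have vl : ∀ j, L2loc Ω (v j) := fun j => MemLp.L2loc (((hv j).of_le (by norm_num)).memLp)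
    have ibv : ∀ j, ∫ z, v j z * dd j w z ∂(LM N) = - ∫ z, dd j (v j) z * w z ∂(LM N) := by
      intro j
      rw [show ∫ z, dd j (v j) z * w z ∂(LM N) = _ from ibp hΩ ((hv j).smooth.contDiffOn.of_le (by norm_num)) (hw.of_le (by norm_num)) _ _]
      simp [dd]
    have i1 : ∀ j, Integrable (fun z => v j z * dd j w z) (LM N) := fun j => (vl j).int_test (wd j)
    have i2 : ∀ j, Integrable (fun z => v j z * (w z * dd j (cr σ) z)) (LM N) := fun j => (vl j).int_test (ws j)
    have i3 : ∀ j, Integrable (fun z => (q z * V1 j z) * dd j w z) (LM N) := fun j => (hf j).int_test (wd j)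
    have i4 : ∀ j, Integrable (fun z => (q z * V1 j z) * (w z * dd j (cr σ) z)) (LM N) := fun j => (hf j).int_test (ws j)
    have i5 : ∀ j, Integrable (fun z => dd j (v j) z * w z) (LM N) := fun j =>
      (MemLp.L2loc (((hv j).cd _ j).of_le (by norm_num) : Tst 0 Ω _).memLp).int_test w0
    have e4 : ∀ j, ∫ z in Ω, (v j z - q z * V1 j z) * (dd j w z - w z * dd j (cr σ) z) ∂(LM N)
        = - ∫ z, dd j (v j) z * w z ∂(LM N) - ∫ z, v j z * (w z * dd j (cr σ) z) ∂(LM N)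
         - ∫ z, (q z * V1 j z) * dd j w z ∂(LM N) + ∫ z, (q z * V1 j z) * (w z * dd j (cr σ) z) ∂(LM N) := by
      intro j
      rw [setInt_tst (u := fun z => v j z - q z * V1 j z) ((wd j).sub' (ws j)), ← ibv j,
        int4 (i1 j) (i2 j) (i3 j) (i4 j)]
      congr 1; funext z; ring
    have e5 : ∫ z, (tt σ v z - ∑ j, dd j (cr σ) z * (q z * V1 j z)) * w z ∂(LM N) =
        ∑ j, (∫ z, dd j (v j) z * w z ∂(LM N) + ∫ z, v j z * (w z * dd j (cr σ) z) ∂(LM N)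
          - ∫ z, (q z * V1 j z) * (w z * dd j (cr σ) z) ∂(LM N)) := by
      have : ∀ j, (∫ z, dd j (v j) z * w z ∂(LM N) + ∫ z, v j z * (w z * dd j (cr σ) z) ∂(LM N)
          - ∫ z, (q z * V1 j z) * (w z * dd j (cr σ) z) ∂(LM N)) = ∫ z, (dd j (v j) z * w z
            + v j z * (w z * dd j (cr σ) z) - (q z * V1 j z) * (w z * dd j (cr σ) z)) ∂(LM N) := by
        intro j
        exact int3 (i5 j) (i2 j) (i4 j)
      have i6 : ∀ j, Integrable (fun z => dd j (v j) z * w z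
            + v j z * (w z * dd j (cr σ) z) - (q z * V1 j z) * (w z * dd j (cr σ) z)) (LM N) :=
        fun j => ((i5 j).add (i2 j)).sub (i4 j)
      rw [Finset.sum_congr rfl fun j _ => this j, ← integral_finsetSum _ fun j _ => i6 j]
      congr 1; funext z
      simp only [tt, ← Finset.sum_sub_distrib, Finset.sum_mul]
      refine Finset.sum_congr rfl fun j _ => ?_
      ring
    rw [Finset.sum_congr rfl fun j _ => e4 j] at hvV
    rw [e5]
    simp only [Finset.sum_add_distrib, Finset.sum_sub_distrib, Finset.sum_neg_distrib] at hvV ⊢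
    linear_combination - hvV
  · have hr : Tst 0 Ω (fun z => ex (fun z => -(φ z/2)) z * tt σ v z) :=
      ht.mul_left hΩ ((ex_contDiffOn (hφ.div_const 2).neg).of_le (by norm_num))
    have := (hr.memLp).norm.integrable_sq
    refine this.congr (Eventually.of_forall fun z => ?_)
    simp only
    rw [norm_mul, ex_norm, mul_pow, ← Real.exp_nat_mul]
    congr 2; push_cast; ring

end LP
end

noncomputable section
open Set Filter Topology Metric MeasureTheory
open scoped ENNReal NNReal InnerProductSpace ComplexConjugate
namespace LP
variable {N : ℕ} {Ω : Set (EN N)}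

/-- test forms -/
def TF (Ω : Set (EN N)) : Submodule ℂ (Fin N → EN N → ℂ) where
  carrier := {v | ∀ j, Tst 2 Ω (v j)}
  add_mem' ha hb j := (ha j).add (hb j)
  zero_mem' j := Tst.zero
  smul_mem' c v hv j := by
    have : Tst 2 Ω (fun z => (fun _ => c) z * v j z) := by
      refine ⟨contDiff_const.mul (hv j).smooth, (hv j).cpt.mul_left, ?_⟩
      exact (tsupport_mul_subset_right (f := fun _ => c) (g := v j)).trans (hv j).sub
    exact this

lemma tt_add (σ : EN N → ℝ) {v w : Fin N → EN N → ℂ} (hv : ∀ j, Tst 2 Ω (v j)) (hw : ∀ j, Tst 2 Ω (w j)) (z : EN N) :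
    tt σ (v + w) z = tt σ v z + tt σ w z := by
  simp only [tt, ← Finset.sum_add_distrib]
  refine Finset.sum_congr rfl fun j _ => ?_
  have : dd j ((v + w) j) z = dd j (v j) z + dd j (w j) z := cd_add ((hv j).diff z) ((hw j).diff z)
  rw [this]; simp only [Pi.add_apply]; ring

lemma tt_smul (σ : EN N → ℝ) {v : Fin N → EN N → ℂ} (hv : ∀ j, Tst 2 Ω (v j)) (c : ℂ) (z : EN N) :
    tt σ (c • v) z = c * tt σ v z := by
  simp only [tt, Finset.mul_sum]
  refine Finset.sum_congr rfl fun j _ => ?_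
  have : dd j ((c • v) j) z = c * dd j (v j) z := by
    have := cd_mul (a := -Complex.I) (j := j) (w := fun _ => c) (u := v j) (z := z) (by fun_prop) ((hv j).diff z)
    rw [cd_const] at this
    simp only [zero_mul, mul_zero, add_zero, zero_add] at this
    exact this
  rw [this]; simp only [Pi.smul_apply, smul_eq_mul]; ring

lemma toL_add {a b : Fin N → EN N → ℂ} (ha : ∀ j, MemLp (a j) 2 ((LM N).restrict Ω))
    (hb : ∀ j, MemLp (b j) 2 ((LM N).restrict Ω)) :
    toL (fun j z => a j z + b j z) (fun j => (ha j).add (hb j)) = toL a ha + toL b hb := by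
  ext j : 1
  exact MemLp.toLp_add (ha j) (hb j)

theorem hormander (hΩ : IsOpen Ω) {φ ψ : EN N → ℝ} (hφ : ContDiffOn ℝ 2 φ Ω)
    (hψ : ContDiffOn ℝ 2 ψ Ω) (hW : WeightIneq Ω φ ψ) {η : ℕ → EN N → ℂ} (hη : Cutoffs Ω ψ η)
    {g : Fin N → EN N → ℂ} (hgm : ∀ j, AEStronglyMeasurable (g j) ((LM N).restrict Ω))
    (hgi : ∀ j, IntegrableOn (fun z => Real.exp (ψ z - φ z) * ‖g j z‖^2) Ω (LM N))
    (hgc : ∀ j k w, Tst 2 Ω w → ∫ z, g j z * dbar k w z ∂(LM N) = ∫ z, g k z * dbar j w z ∂(LM N)) :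
    ∃ u : EN N → ℂ, AEStronglyMeasurable u ((LM N).restrict Ω) ∧
      IntegrableOn (fun z => Real.exp (2 * ψ z - φ z) * ‖u z‖^2) Ω (LM N) ∧
      ∀ j w, Tst 2 Ω w → ∫ z, u z * dbar j w z ∂(LM N) = -∫ z, g j z * w z ∂(LM N) := by
  set σ : EN N → ℝ := fun z => ψ z - φ z with hσd
  have hσ : ContDiffOn ℝ 2 σ Ω := hψ.sub hφ
  set q := ex (fun z => -(σ z / 2)) with hq
  set p := ex (fun z => σ z / 2) with hp
  set p3 := ex (fun z => -(φ z / 2)) with hp3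
  have hqc : ContDiffOn ℝ 2 q Ω := ex_contDiffOn (hσ.div_const 2).neg
  have hpc : ContDiffOn ℝ 2 p Ω := ex_contDiffOn (hσ.div_const 2)
  have hp3c : ContDiffOn ℝ 2 p3 Ω := ex_contDiffOn (hφ.div_const 2).neg
  have hpq : ∀ z, q z * p z = 1 := fun z => ex_one (by ring)
  have hpm := hpc.continuousOn.aestronglyMeasurable (μ := LM N) hΩ.measurableSet
  have hp3m := hp3c.continuousOn.aestronglyMeasurable (μ := LM N) hΩ.measurableSet
  -- the element G
  have hG : ∀ j, MemLp (fun z => p z * g j z) 2 ((LM N).restrict Ω) := by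
    intro j
    refine (memLp_two_iff_integrable_sq_norm (hpm.mul (hgm j))).2 ?_
    refine (hgi j).congr (Eventually.of_forall fun z => ?_)
    simp only [Pi.mul_apply]
    rw [norm_mul, hp, ex_norm, mul_pow, ← Real.exp_nat_mul]
    congr 2; rw [hσd]; push_cast; ring
  set G : H2 Ω := toL _ hG with hGd
  have hGA : G ∈ Acl Ω σ := by
    rw [mem_Acl hΩ hσ]
    intro j k ω hω
    have aux : ∀ j k, ∫ z, (q z * G j z) * dbar k ω z ∂(LM N) = ∫ z, g j z * dbar k ω z ∂(LM N) := by
      intro j k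
      have t0 : Tst 0 Ω (dbar k ω) := (hω.cd _ k).of_le (by norm_num)
      rw [← setInt_tst t0, ← setInt_tst t0]
      refine integral_congr_ae ?_
      filter_upwards [toL_coe hG j] with z hz
      rw [hGd, hz, ← mul_assoc, hpq, one_mul]
    rw [aux, aux]; exact hgc j k ω hω
  -- maps
  have hVm : ∀ v : TF Ω, ∀ j, MemLp (fun z => p z * v.1 j z) 2 ((LM N).restrict Ω) := fun v j =>
    (((v.2 j).of_le (m := 0) (by norm_num)).mul_left hΩ (hpc.of_le (by norm_num))).memLp
  have hTm : ∀ v : TF Ω, MemLp (fun z => p3 z * tt σ v.1 z) 2 ((LM N).restrict Ω) := fun v =>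
    ((tt_tst hΩ hσ v.2).mul_left hΩ (hp3c.of_le (by norm_num))).memLp
  let T : TF Ω →ₗ[ℂ] L2s Ω :=
    { toFun := fun v => (hTm v).toLp _
      map_add' := fun v w => by
        rw [← MemLp.toLp_add, MemLp.toLp_eq_toLp_iff]
        refine Eventually.of_forall fun z => ?_
        simp only [Pi.add_apply]
        rw [← mul_add, ← tt_add σ v.2 w.2]; rfl
      map_smul' := fun c v => by
        rw [RingHom.id_apply, ← MemLp.toLp_const_smul, MemLp.toLp_eq_toLp_iff]
        refine Eventually.of_forall fun z => ?_
        simp only [Pi.smul_apply, smul_eq_mul]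
        rw [mul_left_comm, ← tt_smul σ v.2]; rfl }
  let ℓ : TF Ω →ₗ[ℂ] ℂ :=
    { toFun := fun v => ⟪G, toL _ (hVm v)⟫_ℂ
      map_add' := fun v w => by
        rw [← inner_add_right, ← toL_add]
        congr 2; funext j z; show p z * (v.1 j z + w.1 j z) = _; ring
      map_smul' := fun c v => by
        rw [RingHom.id_apply, smul_eq_mul, ← inner_smul_right]
        congr 1
        ext j : 1
        show (hVm (c • v) j).toLp _ = c • (hVm v j).toLp _
        rw [← MemLp.toLp_const_smul, MemLp.toLp_eq_toLp_iff]
        refine Eventually.of_forall fun z => ?_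
        show p z * (c * v.1 j z) = c * (p z * v.1 j z); ring }
  have hbound : ∀ v, ‖ℓ v‖ ≤ ‖G‖ * ‖T v‖ := by
    intro v
    set V : H2 Ω := toL _ (hVm v) with hV
    haveI : (Acl Ω σ).HasOrthogonalProjection := by
      haveI : CompleteSpace (Acl Ω σ) := (Submodule.isClosed_orthogonal _).completeSpace_coe
      exact Submodule.HasOrthogonalProjection.ofCompleteSpace _
    set V1 : H2 Ω := (Acl Ω σ).starProjection V with hV1
    have hV1A : V1 ∈ Acl Ω σ := Submodule.starProjection_apply_mem _ _
    have hort : ∀ B ∈ Acl Ω σ, ⟪B, V - V1⟫_ℂ = 0 := fun B hB =>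
      (Submodule.mem_orthogonal _ _).1 (Submodule.sub_starProjection_mem_orthogonal V) B hB
    have e1 : ℓ v = ⟪G, V1⟫_ℂ := by
      have := hort G hGA
      rw [inner_sub_right, sub_eq_zero] at this
      exact this
    have e2 := proj_est hΩ hφ hψ hW hη v.2 V V1 (fun j => toL_coe (hVm v) j) hV1A hort
    have e3 : ∫ z in Ω, Real.exp (-φ z) * ‖tt (fun z => ψ z - φ z) v.1 z‖^2 ∂(LM N) = ‖T v‖^2 := by
      rw [normsq_L2]
      refine integral_congr_ae ?_
      filter_upwards [(hTm v).coeFn_toLp] with z hz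
      show _ = ‖((hTm v).toLp _ : EN N → ℂ) z‖^2
      rw [hz, norm_mul, hp3, ex_norm, mul_pow, ← Real.exp_nat_mul]
      congr 2; push_cast; ring
    rw [e3] at e2
    have e4 : ‖V1‖ ≤ ‖T v‖ := by
      exact (sq_le_sq₀ (norm_nonneg _) (norm_nonneg _)).1 e2
    rw [e1]
    exact (norm_inner_le_norm _ _).trans (mul_le_mul_of_nonneg_left e4 (norm_nonneg _))
  obtain ⟨Y, hY⟩ := riesz_abs T ℓ hbound
  set W := ex (fun z => -σ z) with hWd
  have hWc : ContDiffOn ℝ 2 W Ω := ex_contDiffOn hσ.neg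
  refine ⟨fun z => -(p3 z * W z * Y z), ?_, ?_, ?_⟩
  · exact ((hp3m.mul (hWc.continuousOn.aestronglyMeasurable hΩ.measurableSet)).mul (memLp_L2s Y).1).neg
  · have := (memLp_L2s Y).norm.integrable_sq
    refine this.congr (Eventually.of_forall fun z => ?_)
    simp only
    rw [norm_neg, norm_mul, norm_mul, hp3, hWd, ex_norm, ex_norm, ← Real.exp_add, mul_pow, ← Real.exp_nat_mul,
      ← mul_assoc, ← Real.exp_add]
    have : 2 * ψ z - φ z + ((2:ℕ):ℝ) * (-(φ z / 2) + -σ z) = 0 := by rw [hσd]; push_cast; ring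
    rw [this]; simp
  · intro k w hw
    have hwc := hw.conj
    have hWw : Tst 2 Ω (fun z => W z * conj (w z)) := hwc.mul_left hΩ (by exact_mod_cast hWc)
    let v : TF Ω := ⟨Pi.single k (fun z => W z * conj (w z)), fun j => by
      by_cases h : j = k
      · subst h; simpa using hWw
      · rw [Pi.single_eq_of_ne h]; exact Tst.zero⟩
    have htt : ∀ z ∈ Ω, tt σ v.1 z = W z * conj (dbar k w z) := by
      intro z hz
      have : tt σ v.1 z = dd k (v.1 k) z + v.1 k z * dd k (cr σ) z := by
        refine Finset.sum_eq_single k (fun b _ hb => ?_) (by simp)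
        have : v.1 b = fun _ => 0 := Pi.single_eq_of_ne hb _
        rw [this]; show cd _ _ _ _ + _ = _
        rw [cd_const]; simp
      have hk : v.1 k = fun z => W z * conj (w z) := Pi.single_eq_same _ _
      rw [this, hk, hWd, dd_W hΩ hσ hwc k z hz]
      have : conj (dbar k w z) = dd k (fun z => conj (w z)) z := by
        show _ = cd _ k _ z
        rw [cd_conj (hw.diff z)]; simp [dbar]
      rw [this]; ring
    have h := hY v
    have hl : ℓ v = ∫ z, conj (g k z * w z) ∂(LM N) := by
      show ⟪G, toL _ (hVm v)⟫_ℂ = _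
      rw [hGd, inner_toL_left, Finset.sum_eq_single k]
      · rw [show ∫ z, conj (g k z * w z) ∂(LM N) = ∫ z, conj (g k z) * conj (w z) ∂(LM N) by simp only [map_mul],
          ← setInt_tst (hwc.of_le (m := 0) (by norm_num))]
        refine integral_congr_ae ?_
        filter_upwards [toL_coe (hVm v) k] with z hz
        have hk : v.1 k = fun z => W z * conj (w z) := Pi.single_eq_same _ _
        have e1 : p z * p z * W z = 1 := by
          rw [ex_mul (l := σ) (by ring)]; exact ex_one (by ring)
        rw [hz, hk]
        simp only [map_mul]
        rw [hp, ex_conj, ← hp]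
        linear_combination (conj (g k z) * conj (w z)) * e1
      · intro b _ hb
        rw [← integral_zero (EN N) ℂ (μ := (LM N).restrict Ω)]
        refine integral_congr_ae ?_
        filter_upwards [toL_coe (hVm v) b] with z hz
        have hk : v.1 b = 0 := Pi.single_eq_of_ne hb _
        rw [hz, hk]; simp
      · simp
    rw [hl, inner_L2] at h
    have e2 : ∫ z in Ω, (T v : EN N → ℂ) z * conj (Y z) ∂(LM N) = ∫ z in Ω, conj ((p3 z * W z * Y z) * dbar k w z) ∂(LM N) := by
      refine integral_congr_ae ?_
      filter_upwards [(hTm v).coeFn_toLp, ae_restrict_mem hΩ.measurableSet] with z hz hzΩ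
      show ((hTm v).toLp _ : EN N → ℂ) z * _ = _
      rw [hz, htt z hzΩ]
      simp only [map_mul]
      rw [hp3, hWd, ex_conj, ex_conj]; ring
    rw [e2, integral_conj, integral_conj] at h
    have h' := (starRingEnd ℂ).injective h
    rw [setInt_tst (u := fun z => p3 z * W z * Y z) ((hw.cd _ k).of_le (by norm_num))] at h'
    rw [← h', ← integral_neg]
    congr 1; funext z
    ring

end LP
end

noncomputable section
open Set Filter Topology Metric MeasureTheory
open scoped ENNReal NNReal InnerProductSpace ComplexConjugate
namespace LP
variable {N : ℕ} {Ω : Set (EN N)}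

lemma mo_comm {s t : ℝ} (hs : 0 < s) (ht : 0 < t) {h : EN N → ℂ} (hh : LocallyIntegrable h (LM N))
    (x : EN N) : mo t (mo s h) x = mo s (mo t h) x := by
  have key : ∀ s t : ℝ, 0 < s → 0 < t → mo t (mo s h) x =
      MeasureTheory.convolution h (MeasureTheory.convolution (kc s) (kc t)
        (ContinuousLinearMap.mul ℝ ℂ) (LM N)) (ContinuousLinearMap.mul ℝ ℂ) (LM N) x := by
    intro s t hs ht
    rw [mo_eq, mo_eq]
    have cn : ∀ {r : ℝ}, 0 < r → HasCompactSupport (fun y : EN N => ‖kc r y‖) := fun hr => (kc_cpt hr).norm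
    have kcont : ∀ r : ℝ, Continuous (fun y : EN N => ‖kc r y‖) := fun r => (kc_contDiff r).continuous.norm
    apply MeasureTheory.convolution_assoc
    · intro a b c; simp [mul_assoc]
    · exact hh.aestronglyMeasurable
    · exact (kc_contDiff s).continuous.aestronglyMeasurable
    · exact (kc_contDiff t).continuous.aestronglyMeasurable
    · exact Eventually.of_forall fun y => (kc_cpt hs).convolutionExists_right _ hh (kc_contDiff s).continuous y
    · exact Eventually.of_forall fun y => (cn ht).convolutionExists_right _
        (kcont s).locallyIntegrable (kcont t) y
    · have hn : LocallyIntegrable (fun y => ‖h y‖) (LM N) := fun y => (hh y).norm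
      have q1 := HasCompactSupport.convolution (μ := LM N) (ContinuousLinearMap.mul ℝ ℝ) (cn hs) (cn ht)
      have q2 := HasCompactSupport.continuous_convolution_right (μ := LM N) (ContinuousLinearMap.mul ℝ ℝ)
        (cn ht) (kcont s).locallyIntegrable (kcont t)
      exact HasCompactSupport.convolutionExists_right (ContinuousLinearMap.mul ℝ ℝ) q1 hn q2 x
  rw [key s t hs ht, key t s ht hs]
  congr 1
  rw [← MeasureTheory.convolution_flip]
  congr 1
  ext; simp

lemma rot_mp {c : ℂ} (hc : ‖c‖ = 1) (g : EN N → ℂ) : ∫ y, g (c • y) ∂(LM N) = ∫ y, g y ∂(LM N) := by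
  have hc0 : c ≠ 0 := by intro h; simp [h] at hc
  let L : EN N →ₗ[ℂ] EN N := c • LinearMap.id
  have hd : LinearMap.det (L.restrictScalars ℝ) = 1 := by
    rw [LinearMap.det_restrictScalars]
    simp [L, LinearMap.det_smul, Algebra.norm_complex_apply, Complex.normSq_eq_norm_sq, hc]
  have hm : Measure.map (L.restrictScalars ℝ) (LM N) = LM N := by
    rw [Measure.map_linearMap_addHaar_eq_smul_addHaar _ (by rw [hd]; norm_num), hd]; simp
  let e : EN N ≃ₜ EN N := Homeomorph.smulOfNeZero c hc0
  have he : MeasurePreserving e (LM N) (LM N) := ⟨e.continuous.measurable, by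
    conv_rhs => rw [← hm]
    rfl⟩
  exact he.integral_comp e.measurableEmbedding g

lemma mo_mean {t R : ℝ} (ht : 0 < t) (htR : t < R) {h : EN N → ℂ} (hc : Continuous h) {z : EN N}
    (hd : DifferentiableOn ℂ h (ball z R)) : mo t h z = h z := by
  have e1 : mo t h z = ∫ y, h (z - y) * kc t y ∂(LM N) := by
    unfold mo
    rw [← integral_sub_left_eq_self _ (LM N) z]
    simp
  have e2 : ∀ θ : ℝ, ∫ y, h (z - circleMap 0 1 θ • y) * kc t y ∂(LM N) = mo t h z := by
    intro θ
    have h1 : ‖circleMap 0 1 θ‖ = 1 := by simp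
    rw [e1, ← rot_mp h1 (fun y => h (z - y) * kc t y)]
    simp only [kc, cr, kk_rot h1]
  have hcont : Continuous (fun p : ℝ × EN N => h (z - circleMap 0 1 p.1 • p.2) * kc t p.2) := by
    have h1 := (kc_contDiff (N := N) t).continuous
    have h2 := continuous_circleMap (0:ℂ) 1
    exact (hc.comp (by fun_prop)).mul (h1.comp continuous_snd)
  have hIntg : Integrable (Function.uncurry fun (θ : ℝ) (y : EN N) => h (z - circleMap 0 1 θ • y) * kc t y)
      ((volume.restrict (Set.uIoc 0 (2*Real.pi))).prod (LM N)) := by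
    have h1 : IntegrableOn (fun p : ℝ × EN N => h (z - circleMap 0 1 p.1 • p.2) * kc t p.2)
      (Icc 0 (2*Real.pi) ×ˢ closedBall 0 t) ((volume).prod (LM N)) :=
      hcont.continuousOn.integrableOn_compact (isCompact_Icc.prod (isCompact_closedBall _ _))
    have h2 : IntegrableOn (fun p : ℝ × EN N => h (z - circleMap 0 1 p.1 • p.2) * kc t p.2)
      (Icc 0 (2*Real.pi) ×ˢ univ) ((volume).prod (LM N)) := by
      refine h1.of_forall_sdiff_eq_zero (measurableSet_Icc.prod MeasurableSet.univ) ?_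
      rintro ⟨θ, y⟩ ⟨⟨h3, -⟩, h4⟩
      have h5 : y ∉ closedBall (0:EN N) t := fun hy => h4 ⟨h3, hy⟩
      simp only [mem_closedBall, dist_zero_right, not_le] at h5
      simp [kc, cr, kk_zero ht h5.le]
    have h3 : IntegrableOn (fun p : ℝ × EN N => h (z - circleMap 0 1 p.1 • p.2) * kc t p.2)
      ((Set.uIoc 0 (2*Real.pi)) ×ˢ univ) ((volume).prod (LM N)) := h2.mono_set (by
        rw [Set.uIoc_of_le (by positivity)]
        exact prod_mono Ioc_subset_Icc_self le_rfl)
    rw [IntegrableOn, ← Measure.prod_restrict, Measure.restrict_univ] at h3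
    exact h3
  have sw := intervalIntegral_integral_swap hIntg
  simp only [e2] at sw
  have e3 : ∀ y : EN N, ∫ θ in (0:ℝ)..2*Real.pi, h (z - circleMap 0 1 θ • y) * kc t y
      = (2*Real.pi : ℝ) * (h z * kc t y) := by
    intro y
    by_cases hy : t ≤ ‖y‖
    · simp [kc, cr, kk_zero ht hy]
    push Not at hy
    have hA : Real.circleAverage (fun s : ℂ => h (z - s • y)) 0 1 = h (z - (0:ℂ) • y) := by
      refine circleAverage_of_differentiable_on_off_countable (s := ∅) countable_empty ?_ ?_
      · apply Continuous.continuousOn; fun_prop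
      · intro s hs
        simp only [sdiff_empty, mem_ball, dist_zero_right, abs_one] at hs
        have hm : z - s • y ∈ ball z R := by
          rw [mem_ball, dist_eq_norm]
          simp only [sub_sub_cancel_left, norm_neg, norm_smul]
          nlinarith [norm_nonneg y, norm_nonneg s]
        exact ((hd _ hm).differentiableAt (isOpen_ball.mem_nhds hm)).comp s (by fun_prop)
    rw [intervalIntegral.integral_mul_const]
    unfold Real.circleAverage at hA
    simp only [zero_smul, sub_zero] at hA
    rw [← hA]
    simp only [Complex.real_smul]
    push_cast
    have : (Real.pi : ℂ) ≠ 0 := by exact_mod_cast Real.pi_ne_zero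
    field_simp
  simp only [e3] at sw
  rw [integral_const_mul, integral_const_mul] at sw
  have e4 : ∫ y : EN N, kc t y ∂(LM N) = 1 := by
    have := integral_ofReal (𝕜 := ℂ) (μ := LM N) (f := kk (N := N) t)
    simp only [kc, cr]
    rw [kk_integral ht] at this
    simpa using this
  rw [e4] at sw
  simp only [intervalIntegral.integral_const, sub_zero, Complex.real_smul, mul_one] at sw
  exact mul_left_cancel₀ (by exact_mod_cast (by positivity : (2*Real.pi) ≠ 0)) sw

end LP
end

noncomputable section
open Set Filter Topology Metric MeasureTheory
open scoped ENNReal NNReal InnerProductSpace ComplexConjugate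
namespace LP
variable {N : ℕ} {Ω : Set (EN N)}

lemma EN_decomp (v : EN N) : v = ∑ j, v j • (eb j : EN N) := by
  ext i
  simp [eb, Pi.single_apply]

lemma rsmul_decomp (D : EN N →L[ℝ] ℂ) (h : ∀ j, D (Complex.I • (eb j)) = Complex.I * D (eb j)) (v : EN N) :
    D v = ∑ j, v j * D (eb j) := by
  conv_lhs => rw [EN_decomp v]
  rw [map_sum]
  refine Finset.sum_congr rfl fun j _ => ?_
  have : v j • (eb j : EN N) = (v j).re • (eb j : EN N) + (v j).im • (Complex.I • (eb j : EN N)) := by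
    conv_lhs => rw [← Complex.re_add_im (v j), add_smul, mul_smul]
    rfl
  rw [this, map_add, map_smul, map_smul, h]
  simp only [Complex.real_smul]
  conv_rhs => rw [← Complex.re_add_im (v j)]
  ring

lemma diff_of_dbar {h : EN N → ℂ} {x : EN N} (hd : DifferentiableAt ℝ h x) (hj : ∀ j, dbar j h x = 0) :
    DifferentiableAt ℂ h x := by
  rw [differentiableAt_iff_restrictScalars ℝ hd]
  have hI : ∀ j, fderiv ℝ h x (Complex.I • (eb j)) = Complex.I * fderiv ℝ h x (eb j) := by
    intro j
    have := hj j
    simp only [dbar, cd] at this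
    have h2 : fderiv ℝ h x (eb j) + Complex.I * fderiv ℝ h x (Complex.I • eb j) = 0 := by
      simpa using this
    linear_combination (-Complex.I) * h2 + fderiv ℝ h x (Complex.I • eb j) * Complex.I_sq
  let L : EN N →ₗ[ℂ] ℂ :=
    { toFun := fun v => ∑ j, v j * fderiv ℝ h x (eb j)
      map_add' := by intro a b; simp [add_mul, Finset.sum_add_distrib]
      map_smul' := by intro a b; simp [Finset.mul_sum, mul_assoc] }
  refine ⟨LinearMap.toContinuousLinearMap L, ?_⟩
  ext v
  exact (rsmul_decomp _ hI v).symm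

lemma diff_of_dbarOn {h : EN N → ℂ} (hΩ : IsOpen Ω) (hd : DifferentiableOn ℝ h Ω)
    (hj : ∀ j, ∀ x ∈ Ω, dbar j h x = 0) :
    DifferentiableOn ℂ h Ω := fun x hx =>
  (diff_of_dbar ((hd x hx).differentiableAt (hΩ.mem_nhds hx)) (fun j => hj j x hx)).differentiableWithinAt

lemma mo_local {f : EN N → ℂ} {z x : EN N} {R ε : ℝ} (hε : 0 < ε) (h : ε + dist x z ≤ R) :
    mo ε f x = mo ε ((closedBall z R).indicator f) x := by
  unfold mo
  refine integral_congr_ae (Eventually.of_forall fun y => ?_)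
  by_cases hy : y ∈ closedBall z R
  · simp [hy]
  · have : ε ≤ ‖x - y‖ := by
      rw [mem_closedBall] at hy
      have := dist_triangle y x z
      rw [← dist_eq_norm, dist_comm x y]; linarith
    simp [kc, cr, kk_zero hε this]

lemma kc_tst {ε : ℝ} (hε : 0 < ε) {x : EN N} (h : closedBall x ε ⊆ Ω) : Tst 2 Ω (fun t => kc ε (x - t)) := by
  have hs : tsupport (fun t => kc ε (x - t)) ⊆ closedBall x ε := by
    refine closure_minimal ?_ isClosed_closedBall
    intro t ht
    by_contra hn
    rw [mem_closedBall, dist_comm, dist_eq_norm, not_le] at hn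
    exact ht (by simp [kc, cr, kk_zero hε hn.le])
  refine ⟨?_, ?_, hs.trans h⟩
  · have hn : ∀ n : ℕ, ((n : ℕ) : WithTop ℕ∞) ≤ ((⊤ : ℕ∞) : WithTop ℕ∞) := fun n => by exact_mod_cast le_top
    exact ((kc_contDiff ε).of_le (hn 2)).comp (contDiff_const.sub contDiff_id)
  · exact (isCompact_closedBall x ε).of_isClosed_subset (isClosed_tsupport _) hs

lemma weyl_local {f : EN N → ℂ} (hf : L2loc Ω f)
    (hw : ∀ j w, Tst 2 Ω w → ∫ z, f z * dbar j w z ∂(LM N) = 0) {z : EN N} {R ε : ℝ} (hε : 0 < ε)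
    (hR : closedBall z R ⊆ Ω) :
    Continuous (mo ε ((closedBall z R).indicator f)) ∧
    DifferentiableOn ℂ (mo ε ((closedBall z R).indicator f)) (ball z (R - ε)) := by
  have hm : MemLp ((closedBall z R).indicator f) 2 (LM N) :=
    (memLp_indicator_iff_restrict (isCompact_closedBall z R).measurableSet).2
      (hf _ hR (isCompact_closedBall z R))
  have hl := memLp_locInt hm
  have hC := mo_contDiff hε hl (n := 1)
  refine ⟨hC.continuous, diff_of_dbarOn isOpen_ball (hC.differentiable (by norm_num)).differentiableOn ?_⟩
  intro j x hx
  rw [mem_ball] at hx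
  have hb : closedBall x ε ⊆ closedBall z R := closedBall_subset_closedBall' (by linarith)
  have ht := hw j _ (kc_tst hε (hb.trans hR))
  unfold dbar at ht ⊢
  rw [cd_mo hε hl]
  simp only [cd_reflect] at ht
  rw [← neg_eq_zero, ← integral_neg, ← ht]
  refine integral_congr_ae (Eventually.of_forall fun y => ?_)
  by_cases hy : y ∈ closedBall z R
  · simp [hy]
  · have h1 : y ∉ tsupport (fun t => kc ε (x - t)) := fun h => hy (by
      have hs := (kc_tst hε (Ω := closedBall x ε) le_rfl).sub h
      exact hb hs)
    have h2 : cd Complex.I j (fun t => kc ε (x - t)) y = 0 := cd_zero_of_notMem_tsupport h1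
    rw [cd_reflect] at h2
    simp [neg_eq_zero.1 h2]

theorem weyl (hΩ : IsOpen Ω) {f : EN N → ℂ} (hf : L2loc Ω f)
    (hw : ∀ j w, Tst 2 Ω w → ∫ z, f z * dbar j w z ∂(LM N) = 0) :
    ∃ F : EN N → ℂ, DifferentiableOn ℂ F Ω ∧
      ∀ z ε R, 0 < ε → ε < R → closedBall z R ⊆ Ω → F z = mo ε f z := by
  have key : ∀ z ε t R, 0 < ε → 0 < t → ε + t < R → closedBall z R ⊆ Ω → mo ε f z = mo t f z := by
    intro z ε t R hε ht h hR
    have hl : LocallyIntegrable ((closedBall z R).indicator f) (LM N) :=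
      memLp_locInt ((memLp_indicator_iff_restrict (isCompact_closedBall z R).measurableSet).2
      (hf _ hR (isCompact_closedBall z R)))
    rw [mo_local hε (z := z) (R := R) (by simp; linarith), mo_local ht (z := z) (R := R) (by simp; linarith)]
    obtain ⟨c1, d1⟩ := weyl_local hf hw hε hR
    obtain ⟨c2, d2⟩ := weyl_local hf hw ht hR
    rw [← mo_mean ht (by linarith) c1 d1, ← mo_mean hε (by linarith) c2 d2, mo_comm hε ht hl]
  have key2 : ∀ z ε t R R', 0 < ε → 0 < t → ε < R → t < R' → closedBall z R ⊆ Ω → closedBall z R' ⊆ Ω →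
      mo ε f z = mo t f z := by
    intro z ε t R R' hε ht h h' hR hR'
    let s := min (R - ε) (R' - t) / 2
    have hs : 0 < s := by
      have : 0 < min (R - ε) (R' - t) := lt_min (by linarith) (by linarith)
      positivity
    have s1 : s < R - ε := by
      have := min_le_left (R - ε) (R' - t); simp only [s] at hs ⊢; linarith
    have s2 : s < R' - t := by
      have := min_le_right (R - ε) (R' - t); simp only [s] at hs ⊢; linarith
    rw [key z ε s R hε hs (by linarith) hR, key z t s R' ht hs (by linarith) hR']
  have hex : ∀ z : EN N, ∃ r : ℝ, z ∈ Ω → 0 < r ∧ closedBall z (2*r) ⊆ Ω := by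
    intro z
    by_cases hz : z ∈ Ω
    · obtain ⟨r, hr, h⟩ := Metric.nhds_basis_closedBall.mem_iff.1 (hΩ.mem_nhds hz)
      refine ⟨r/2, fun _ => ⟨by linarith, ?_⟩⟩
      rwa [mul_div_cancel₀ _ (by norm_num)]
    · exact ⟨0, fun h => absurd h hz⟩
  choose r hr using hex
  have hF : ∀ z ε R, 0 < ε → ε < R → closedBall z R ⊆ Ω → mo (r z) f z = mo ε f z := by
    intro z ε R hε h hR
    have hz : z ∈ Ω := hR (mem_closedBall_self (by linarith))
    obtain ⟨h1, h2⟩ := hr z hz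
    exact key2 z _ _ (2 * r z) R h1 hε (by linarith) h h2 hR
  refine ⟨fun z => mo (r z) f z, ?_, hF⟩
  intro z hz
  obtain ⟨h1, h2⟩ := hr z hz
  obtain ⟨c1, d1⟩ := weyl_local hf hw (ε := r z / 2) (by linarith) h2
  have hzm : z ∈ ball z (r z / 2) := mem_ball_self (by linarith)
  have hev : (fun x => mo (r x) f x) =ᶠ[𝓝 z] mo (r z / 2) ((closedBall z (2 * r z)).indicator f) := by
    filter_upwards [ball_mem_nhds z (by linarith : 0 < r z / 2)] with x hx
    rw [mem_ball] at hx
    rw [← mo_local (by linarith) (by linarith)]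
    exact hF x _ (r z) (by linarith) (by linarith)
      ((closedBall_subset_closedBall' (by linarith)).trans h2)
  refine DifferentiableAt.differentiableWithinAt ?_
  refine DifferentiableAt.congr_of_eventuallyEq ?_ hev
  exact d1.differentiableAt (ball_mem_nhds z (by linarith))

/-- pointwise bound of the mollification by an L² norm -/
lemma mo_bound {u : EN N → ℂ} {z : EN N} {ε B : ℝ} (hε : 0 < ε)
    (hi : IntegrableOn (fun y => ‖u y‖^2) (closedBall z ε) (LM N))
    (hB : ∫ y in closedBall z ε, ‖u y‖^2 ∂(LM N) ≤ B) :
    ‖mo ε u z‖ ≤ (1 / (ε^(2*N) * kI N)) * (B + (LM N).real (closedBall z ε)) := by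
  have hfin : (LM N) (closedBall z ε) < ⊤ := measure_closedBall_lt_top
  have hc : IntegrableOn (fun _ : EN N => (1:ℝ)) (closedBall z ε) (LM N) := by
    simpa using (isCompact_closedBall z ε).measure_lt_top
  have hii : IntegrableOn (fun y => ‖u y‖^2 + 1) (closedBall z ε) (LM N) := hi.add hc
  have k0 := @kI_pos N
  have e : mo ε u z = ∫ y in closedBall z ε, u y * kc ε (z - y) ∂(LM N) := by
    unfold mo
    symm
    refine setIntegral_eq_integral_of_forall_compl_eq_zero fun y hy => ?_
    rw [mem_closedBall, dist_comm, dist_eq_norm, not_le] at hy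
    simp [kc, cr, kk_zero hε hy.le]
  rw [e]
  calc _ ≤ ∫ y in closedBall z ε, (1 / (ε^(2*N) * kI N)) * (‖u y‖^2 + 1) ∂(LM N) := by
        refine norm_integral_le_of_norm_le (hii.const_mul _) (Eventually.of_forall fun y => ?_)
        rw [norm_mul, mul_comm]
        have h1 : ‖kc ε (z - y)‖ ≤ 1 / (ε^(2*N) * kI N) := by
          simp only [kc, cr, Complex.norm_real, Real.norm_of_nonneg (kk_nonneg hε _)]
          exact kk_le hε _
        have h2 : ‖u y‖ ≤ ‖u y‖^2 + 1 := by nlinarith [sq_nonneg (‖u y‖ - 1)]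
        exact mul_le_mul h1 h2 (norm_nonneg _) (by positivity)
    _ = (1 / (ε^(2*N) * kI N)) * (∫ y in closedBall z ε, ‖u y‖^2 ∂(LM N) + (LM N).real (closedBall z ε)) := by
        rw [integral_const_mul, integral_add hi hc]
        simp [Measure.real]
    _ ≤ _ := by gcongr

end LP
end

noncomputable section
open Set Filter Topology Metric MeasureTheory
open scoped ENNReal NNReal InnerProductSpace ComplexConjugate
namespace LP
variable {N : ℕ} {Ω : Set (EN N)}

lemma clin_decomp (D : EN N →L[ℝ] ℂ) (w : EN N) :
    D w - Complex.I * D (Complex.I • w)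
      = ∑ j, w j * (D (eb j) + (-Complex.I) * D (Complex.I • eb j)) := by
  let J : EN N →L[ℝ] EN N := (Complex.I • ContinuousLinearMap.id ℂ (EN N)).restrictScalars ℝ
  let D' : EN N →L[ℝ] ℂ := D - Complex.I • (D.comp J)
  have h : ∀ v, D' v = D v - Complex.I * D (Complex.I • v) := fun v => rfl
  have := rsmul_decomp D' (fun j => by
    rw [h, h, smul_smul, Complex.I_mul_I, neg_one_smul, map_neg]
    linear_combination D (Complex.I • eb j) * Complex.I_mul_I) w
  rw [h] at this
  rw [this]
  refine Finset.sum_congr rfl fun j _ => ?_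
  rw [h]; ring

lemma calin_decomp (D : EN N →L[ℝ] ℂ) (w : EN N) :
    D w + Complex.I * D (Complex.I • w)
      = ∑ j, conj (w j) * (D (eb j) + Complex.I * D (Complex.I • eb j)) := by
  have h := clin_decomp ((Complex.conjCLE : ℂ →L[ℝ] ℂ).comp D) w
  have h2 := congrArg conj h
  simp only [ContinuousLinearMap.comp_apply, map_sub, map_mul, map_sum, map_add, map_neg] at h2
  simpa [sub_neg_eq_add] using h2

lemma fderiv_cr {φ : EN N → ℝ} {z : EN N} (h : DifferentiableAt ℝ φ z) (v : EN N) :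
    fderiv ℝ (cr φ) z v = ((fderiv ℝ φ z v : ℝ) : ℂ) := by
  have := Complex.ofRealCLM.hasFDerivAt.comp z h.hasFDerivAt
  have e : fderiv ℝ (cr φ) z = Complex.ofRealCLM.comp (fderiv ℝ φ z) := this.fderiv
  rw [e]; rfl

lemma hess_cr {φ : EN N → ℝ} {z : EN N} (h : ContDiffAt ℝ 2 φ z) (v w : EN N) :
    fderiv ℝ (fderiv ℝ (cr φ)) z v w = ((Hess φ z v w : ℝ) : ℂ) := by
  have h1 : ∀ᶠ y in 𝓝 z, fderiv ℝ (cr φ) y = Complex.ofRealCLM.comp (fderiv ℝ φ y) := by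
    filter_upwards [h.eventually (by norm_num)] with y hy
    ext v
    rw [fderiv_cr (hy.differentiableAt (by norm_num))]; rfl
  have hd : DifferentiableAt ℝ (fderiv ℝ φ) z :=
    (h.fderiv_right (m := 1) (by norm_num)).differentiableAt (by norm_num)
  have h2 : fderiv ℝ (fderiv ℝ (cr φ)) z =
    (ContinuousLinearMap.compL ℝ (EN N) ℝ ℂ Complex.ofRealCLM).comp (fderiv ℝ (fderiv ℝ φ) z) := by
    have h1' : fderiv ℝ (cr φ) =ᶠ[𝓝 z] fun y => Complex.ofRealCLM.comp (fderiv ℝ φ y) := h1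
    rw [h1'.fderiv_eq]
    have := (ContinuousLinearMap.compL ℝ (EN N) ℝ ℂ Complex.ofRealCLM).hasFDerivAt.comp z hd.hasFDerivAt
    exact this.fderiv
  rw [h2]; rfl

/-- `|∂ρ·w|²` -/
def dq (ρ : EN N → ℝ) (z w : EN N) : ℝ :=
  ((fderiv ℝ ρ z w)^2 + (fderiv ℝ ρ z (Complex.I • w))^2) / 4

lemma norm_dd {ψ : EN N → ℝ} {z : EN N} (h : DifferentiableAt ℝ ψ z) (w : EN N) :
    ‖∑ j, w j * dd j (cr ψ) z‖^2 = dq ψ z w := by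
  have h1 := clin_decomp (fderiv ℝ (cr ψ) z) w
  have h2 : ∑ j, w j * dd j (cr ψ) z =
      (1/2 : ℂ) * (fderiv ℝ (cr ψ) z w - Complex.I * fderiv ℝ (cr ψ) z (Complex.I • w)) := by
    rw [h1, Finset.mul_sum]
    refine Finset.sum_congr rfl fun j _ => ?_
    simp only [dd, cd]; ring
  rw [h2, fderiv_cr h, fderiv_cr h, ← Complex.normSq_eq_norm_sq, Complex.normSq_apply, dq]
  simp; ring

lemma re_levi {φ : EN N → ℝ} {z : EN N} (h : ContDiffAt ℝ 2 φ z) (w : EN N) :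
    (∑ j, ∑ k, dbar k (dd j (cr φ)) z * (w j * conj (w k))).re = LeviForm φ z w := by
  have hc : ContDiffAt ℝ 2 (cr φ) z := Complex.ofRealCLM.contDiff.contDiffAt.comp z h
  set H := fderiv ℝ (fderiv ℝ (cr φ)) z with hH
  let X : EN N →L[ℝ] ℂ := H.flip w - Complex.I • H.flip (Complex.I • w)
  have hX : ∀ a, X a = ∑ j, w j * (H a (eb j) + (-Complex.I) * H a (Complex.I • eb j)) := fun a =>
    clin_decomp (H a) w
  have hX' : ∀ a, X a = H a w - Complex.I * H a (Complex.I • w) := fun a => rfl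
  have e : ∑ j, ∑ k, dbar k (dd j (cr φ)) z * (w j * conj (w k))
      = (1/4 : ℂ) * (X w + Complex.I * X (Complex.I • w)) := by
    rw [calin_decomp X w, Finset.sum_comm, Finset.mul_sum]
    refine Finset.sum_congr rfl fun k _ => ?_
    rw [hX, hX, Finset.mul_sum, ← Finset.sum_add_distrib, Finset.mul_sum, Finset.mul_sum]
    refine Finset.sum_congr rfl fun j _ => ?_
    unfold dbar dd
    rw [cd_cd hc]
    ring
  rw [e, hX', hX', hH]
  simp only [hess_cr h]
  simp [LeviForm]
  ring

/-- The weight inequality in terms of the Levi form. -/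
lemma weight_of_levi (hΩ : IsOpen Ω) {φ ψ : EN N → ℝ} (hφ : ContDiffOn ℝ 2 φ Ω) (hψ : ContDiffOn ℝ 2 ψ Ω)
    (h : ∀ z ∈ Ω, ∀ w : EN N, 2 * dq ψ z w + 2 * (Real.exp (ψ z) * ‖w‖^2) ≤ LeviForm φ z w) :
    WeightIneq Ω φ ψ := by
  intro z hz v
  have := h z hz (WithLp.toLp 2 v)
  rw [← re_levi ((hφ z hz).contDiffAt (hΩ.mem_nhds hz)),
    ← norm_dd (((hψ z hz).contDiffAt (hΩ.mem_nhds hz)).differentiableAt (by norm_num)),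
    EuclideanSpace.norm_sq_eq] at this
  exact this

lemma hess_comp {D : Set (EN N)} (hD : IsOpen D) {ρ : EN N → ℝ} (hρ : ContDiffOn ℝ 2 ρ D)
    (hn : ∀ z ∈ D, ρ z < 0) {g g1 g2 : ℝ → ℝ} (hg : ∀ s < 0, HasDerivAt g (g1 s) s)
    (hg1 : ∀ s < 0, HasDerivAt g1 (g2 s) s) {z : EN N} (hz : z ∈ D) (v w : EN N) :
    fderiv ℝ (fun y => g (ρ y)) z v = g1 (ρ z) * fderiv ℝ ρ z v ∧
    Hess (fun y => g (ρ y)) z v w = g1 (ρ z) * Hess ρ z v w + g2 (ρ z) * (fderiv ℝ ρ z v * fderiv ℝ ρ z w) := by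
  have hcd : ∀ y ∈ D, ContDiffAt ℝ 2 ρ y := fun y hy => (hρ y hy).contDiffAt (hD.mem_nhds hy)
  have hf : ∀ y ∈ D, HasFDerivAt (fun y => g (ρ y)) (g1 (ρ y) • fderiv ℝ ρ y) y := fun y hy =>
    (hg _ (hn y hy)).comp_hasFDerivAt y ((hcd y hy).differentiableAt (by norm_num)).hasFDerivAt
  refine ⟨by rw [(hf z hz).fderiv]; rfl, ?_⟩
  have hev : fderiv ℝ (fun y => g (ρ y)) =ᶠ[𝓝 z] fun y => g1 (ρ y) • fderiv ℝ ρ y := by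
    filter_upwards [hD.mem_nhds hz] with y hy using (hf y hy).fderiv
  have hd : DifferentiableAt ℝ (fderiv ℝ ρ) z :=
    ((hcd z hz).fderiv_right (m := 1) (by norm_num)).differentiableAt (by norm_num)
  have h1 : HasFDerivAt (fun y => g1 (ρ y)) (g2 (ρ z) • fderiv ℝ ρ z) z :=
    (hg1 _ (hn z hz)).comp_hasFDerivAt z ((hcd z hz).differentiableAt (by norm_num)).hasFDerivAt
  have h2 := h1.smul hd.hasFDerivAt
  unfold Hess
  rw [hev.fderiv_eq, show fderiv ℝ (fun y => g1 (ρ y) • fderiv ℝ ρ y) z = _ from h2.fderiv]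
  simp
  ring

lemma hess_normsq (z v : EN N) : Hess (fun y => ‖y‖^2) z v v = 2 * ‖v‖^2 := by
  have h1 : fderiv ℝ (fun y : EN N => ‖y‖^2) = fun y => (2:ℝ) • (innerSL ℝ y) := by
    ext y; simp [fderiv_norm_sq_apply]
  unfold Hess
  rw [h1]
  have : HasFDerivAt (fun y : EN N => (2:ℝ) • (innerSL ℝ y : EN N →L[ℝ] ℝ)) ((2:ℝ) • innerSL ℝ) z :=
    ((innerSL ℝ).hasFDerivAt).const_smul (2:ℝ)
  rw [this.fderiv]
  have h3 := real_inner_self_eq_norm_sq v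
  simp only [ContinuousLinearMap.smul_apply, smul_eq_mul]
  rw [← h3]; rfl

end LP
end

noncomputable section
open Set Filter Topology Metric MeasureTheory
open scoped ENNReal NNReal InnerProductSpace ComplexConjugate
namespace LP
variable {N : ℕ} {Ω : Set (EN N)}

structure Geo (D : Set (EN N)) (ρ : EN N → ℝ) (V : Set (EN N)) : Prop where
  op : IsOpen D
  bd : Bornology.IsBounded D
  df : IsDefiningFunctionOn D ρ V
  lv : ∀ p ∈ frontier D, ∀ w : EN N, w ≠ 0 → ComplexTangent ρ p w → 0 < LeviForm ρ p w

namespace Geo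
variable {D V : Set (EN N)} {ρ : EN N → ℝ}

lemma neg (G : Geo D ρ V) {z : EN N} (hz : z ∈ D) : ρ z < 0 := by
  have := G.df.2.2.2.1; rw [this] at hz; exact hz.2

lemma cl_sub (G : Geo D ρ V) : closure D ⊆ V := G.df.2.1
lemma sub (G : Geo D ρ V) : D ⊆ V := subset_closure.trans G.cl_sub
lemma Vop (G : Geo D ρ V) : IsOpen V := G.df.1
lemma cdV (G : Geo D ρ V) : ContDiffOn ℝ 2 ρ V := G.df.2.2.1
lemma cda (G : Geo D ρ V) {z : EN N} (hz : z ∈ V) : ContDiffAt ℝ 2 ρ z := (G.cdV z hz).contDiffAt (G.Vop.mem_nhds hz)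
lemma cdD (G : Geo D ρ V) : ContDiffOn ℝ 2 ρ D := G.cdV.mono G.sub

lemma cpt (G : Geo D ρ V) : IsCompact (closure D) := G.bd.isCompact_closure

lemma le_zero (G : Geo D ρ V) {z : EN N} (hz : z ∈ closure D) : ρ z ≤ 0 := by
  have hc : ContinuousOn ρ (closure D) := G.cdV.continuousOn.mono G.cl_sub
  exact le_on_closure (fun x hx => (G.neg hx).le) hc continuousOn_const hz

lemma front (G : Geo D ρ V) {z : EN N} (hz : z ∈ frontier D) : ρ z = 0 := by
  refine le_antisymm (G.le_zero (frontier_subset_closure hz)) ?_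
  by_contra h
  push Not at h
  have : z ∈ D := by
    rw [G.df.2.2.2.1]; exact ⟨G.cl_sub (frontier_subset_closure hz), h⟩
  exact hz.2 (by rwa [G.op.interior_eq])

lemma front' (G : Geo D ρ V) {z : EN N} (hz : z ∈ closure D) (h : ρ z = 0) : z ∈ frontier D :=
  ⟨hz, fun hi => by have := G.neg (interior_subset hi); linarith⟩

lemma memD (G : Geo D ρ V) {z : EN N} (hz : z ∈ V) (h : ρ z < 0) : z ∈ D := by
  rw [G.df.2.2.2.1]; exact ⟨hz, h⟩

lemma cont1 (G : Geo D ρ V) : ContinuousOn (fderiv ℝ ρ) V :=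
  G.cdV.continuousOn_fderiv_of_isOpen G.Vop (by norm_num)

lemma cont2 (G : Geo D ρ V) : ContinuousOn (fderiv ℝ (fderiv ℝ ρ)) V :=
  (G.cdV.fderiv_of_isOpen (m := 1) G.Vop (by norm_num)).continuousOn_fderiv_of_isOpen G.Vop (by norm_num)

lemma bounds (G : Geo D ρ V) : ∃ C : ℝ, 0 < C ∧ (∀ z ∈ closure D, |ρ z| ≤ C) ∧ (∀ z ∈ closure D, ∀ v, |fderiv ℝ ρ z v| ≤ C * ‖v‖)
    ∧ (∀ z ∈ closure D, ∀ v w, |Hess ρ z v w| ≤ C * ‖v‖ * ‖w‖) ∧ (∀ z ∈ closure D, ‖z‖ ≤ C) := by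
  obtain ⟨C0, h0⟩ := G.cpt.exists_bound_of_continuousOn (G.cdV.continuousOn.mono G.cl_sub)
  obtain ⟨C1, h1⟩ := G.cpt.exists_bound_of_continuousOn (G.cont1.mono G.cl_sub)
  obtain ⟨C2, h2⟩ := G.cpt.exists_bound_of_continuousOn (f := fderiv ℝ (fderiv ℝ ρ)) (G.cont2.mono G.cl_sub)
  obtain ⟨C3, h3⟩ := G.cpt.exists_bound_of_continuousOn (f := fun z : EN N => z) continuousOn_id
  refine ⟨1 + |C0| + |C1| + |C2| + |C3|, by positivity, ?_, ?_, ?_, ?_⟩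
  · intro z hz
    have := h0 z hz
    rw [Real.norm_eq_abs] at this
    linarith [le_abs_self C0, abs_nonneg C1, abs_nonneg C2, abs_nonneg C3]
  · intro z hz v
    refine ((fderiv ℝ ρ z).le_of_opNorm_le (h1 z hz) v).trans ?_
    gcongr
    linarith [le_abs_self C1, abs_nonneg C0, abs_nonneg C2, abs_nonneg C3]
  · intro z hz v w
    refine ((fderiv ℝ (fderiv ℝ ρ) z v).le_opNorm w).trans ?_
    gcongr
    refine ((fderiv ℝ (fderiv ℝ ρ) z).le_of_opNorm_le (h2 z hz) v).trans ?_
    gcongr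
    linarith [le_abs_self C2, abs_nonneg C1, abs_nonneg C0, abs_nonneg C3]
  · intro z hz
    have := h3 z hz
    linarith [le_abs_self C3, abs_nonneg C1, abs_nonneg C2, abs_nonneg C0]

end Geo

lemma levi_smul {ρ : EN N → ℝ} (z w : EN N) (t : ℝ) : LeviForm ρ z (t • w) = t^2 * LeviForm ρ z w := by
  simp only [LeviForm, Hess, smul_comm Complex.I t w, map_smul, smul_apply, smul_eq_mul]
  ring

lemma dq_smul {ρ : EN N → ℝ} (z w : EN N) (t : ℝ) : dq ρ z (t • w) = t^2 * dq ρ z w := by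
  simp only [dq, smul_comm Complex.I t w, map_smul, smul_eq_mul]
  ring

lemma dq_nonneg {ρ : EN N → ℝ} (z w : EN N) : 0 ≤ dq ρ z w := by
  unfold dq; positivity

namespace Geo
variable {D V : Set (EN N)} {ρ : EN N → ℝ}

lemma levi_cont (G : Geo D ρ V) : ContinuousOn (fun p : EN N × EN N => LeviForm ρ p.1 p.2) (V ×ˢ univ) := by
  have h : ContinuousOn (fun p : EN N × EN N => fderiv ℝ (fderiv ℝ ρ) p.1) (V ×ˢ univ) :=
    G.cont2.comp continuousOn_fst (fun p hp => hp.1)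
  unfold LeviForm Hess
  have h2 : ContinuousOn (fun p : EN N × EN N => Complex.I • p.2) (V ×ˢ univ) := by fun_prop
  exact (((h.clm_apply continuousOn_snd).clm_apply continuousOn_snd).add
    ((h.clm_apply h2).clm_apply h2)).div_const _

lemma dq_cont (G : Geo D ρ V) : ContinuousOn (fun p : EN N × EN N => dq ρ p.1 p.2) (V ×ˢ univ) := by
  have h : ContinuousOn (fun p : EN N × EN N => fderiv ℝ ρ p.1) (V ×ˢ univ) :=
    G.cont1.comp continuousOn_fst (fun p hp => hp.1)
  unfold dq
  have h2 : ContinuousOn (fun p : EN N × EN N => Complex.I • p.2) (V ×ˢ univ) := by fun_prop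
  exact (((h.clm_apply continuousOn_snd).pow 2).add ((h.clm_apply h2).pow 2)).div_const _

lemma near (G : Geo D ρ V) : ∃ A c δ : ℝ, 0 < A ∧ 0 < c ∧ 0 < δ ∧ ∀ z ∈ closure D, - ρ z < δ → ∀ w,
    c * ‖w‖^2 ≤ LeviForm ρ z w + A * dq ρ z w := by
  by_contra hcon
  push Not at hcon
  have hn : ∀ n : ℕ, ∃ p : EN N × EN N, p.1 ∈ closure D ∧ -ρ p.1 < 1/(n+1) ∧ ‖p.2‖ = 1 ∧
      LeviForm ρ p.1 p.2 + (n+1) * dq ρ p.1 p.2 < 1/(n+1) := by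
    intro n
    obtain ⟨z, hz, h1, w, hw⟩ := hcon (n+1) (1/(n+1)) (1/(n+1)) (by positivity) (by positivity) (by positivity)
    have hw0 : w ≠ 0 := by
      rintro rfl
      simp [LeviForm, Hess, dq] at hw
    have hwn : 0 < ‖w‖ := norm_pos_iff.2 hw0
    refine ⟨(z, ‖w‖⁻¹ • w), hz, h1, by simp [norm_smul, hw0], ?_⟩
    simp only [levi_smul, dq_smul]
    have : ‖w‖⁻¹^2 * (LeviForm ρ z w + (n+1) * dq ρ z w) < ‖w‖⁻¹^2 * (1/(n+1) * ‖w‖^2) := by gcongr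
    have e : ‖w‖⁻¹^2 * (1/((n:ℝ)+1) * ‖w‖^2) = 1/(n+1) := by field_simp
    rw [e] at this; linarith
  choose p hp1 hp2 hp3 hp4 using hn
  have hK : IsCompact (closure D ×ˢ sphere (0 : EN N) 1) := G.cpt.prod (isCompact_sphere _ _)
  obtain ⟨q, hq, s, hs, hlim⟩ := hK.tendsto_subseq (x := p) (fun n => ⟨hp1 n, by simp [hp3 n]⟩)
  have hqV : q ∈ V ×ˢ (univ : Set (EN N)) := ⟨G.cl_sub hq.1, mem_univ _⟩
  have hVop : IsOpen (V ×ˢ (univ : Set (EN N))) := G.Vop.prod isOpen_univ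
  have hL : Tendsto (fun n => LeviForm ρ (p (s n)).1 (p (s n)).2) atTop (𝓝 (LeviForm ρ q.1 q.2)) :=
    ((G.levi_cont.continuousAt (hVop.mem_nhds hqV)).tendsto).comp hlim
  have hQ : Tendsto (fun n => dq ρ (p (s n)).1 (p (s n)).2) atTop (𝓝 (dq ρ q.1 q.2)) :=
    ((G.dq_cont.continuousAt (hVop.mem_nhds hqV)).tendsto).comp hlim
  have hρ : Tendsto (fun n => ρ (p (s n)).1) atTop (𝓝 (ρ q.1)) :=
    ((G.cda hqV.1).continuousAt.tendsto).comp ((continuous_fst.tendsto q).comp hlim)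
  have h0 : Tendsto (fun n => 1/(((s n : ℕ):ℝ)+1)) atTop (𝓝 0) :=
    (tendsto_one_div_add_atTop_nhds_zero_nat (𝕜 := ℝ)).comp hs.tendsto_atTop
  have r0 : ρ q.1 = 0 := by
    refine le_antisymm (G.le_zero hq.1) ?_
    have := le_of_tendsto_of_tendsto' hρ.neg h0 (fun n => (hp2 (s n)).le)
    linarith
  have hqf := G.front' hq.1 r0
  have l0 : LeviForm ρ q.1 q.2 ≤ 0 := by
    refine le_of_tendsto_of_tendsto' hL h0 (fun n => ?_)
    have h1 := hp4 (s n)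
    have h2 := dq_nonneg (ρ := ρ) (p (s n)).1 (p (s n)).2
    have h3 : (0:ℝ) ≤ ((s n : ℕ):ℝ)+1 := by positivity
    have := mul_nonneg h3 h2
    linarith
  have q0 : dq ρ q.1 q.2 = 0 := by
    refine le_antisymm ?_ (dq_nonneg _ _)
    have h5 : Tendsto (fun n => (1/(((s n : ℕ):ℝ)+1)) * (1/(((s n : ℕ):ℝ)+1) - LeviForm ρ (p (s n)).1 (p (s n)).2))
      atTop (𝓝 (0 * (0 - LeviForm ρ q.1 q.2))) := h0.mul (h0.sub hL)
    rw [zero_mul] at h5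
    refine le_of_tendsto_of_tendsto' hQ h5 (fun n => ?_)
    have h1 := hp4 (s n)
    have h3 : (0:ℝ) < ((s n : ℕ):ℝ)+1 := by positivity
    rw [one_div_mul_eq_div, le_div_iff₀ h3]
    linarith
  have hq2 : q.2 ≠ 0 := by
    intro h
    have := hq.2
    rw [h] at this; simp at this
  have hct : ComplexTangent ρ q.1 q.2 := by
    unfold dq at q0
    have a := sq_nonneg (fderiv ℝ ρ q.1 q.2)
    have b := sq_nonneg (fderiv ℝ ρ q.1 (Complex.I • q.2))
    exact ⟨pow_eq_zero_iff (two_ne_zero) |>.1 (by linarith), pow_eq_zero_iff (two_ne_zero) |>.1 (by linarith)⟩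
  exact absurd (G.lv _ hqf _ hq2 hct) (not_lt.2 l0)

end Geo
end LP
end

noncomputable section
open Set Filter Topology Metric MeasureTheory
open scoped ENNReal NNReal InnerProductSpace ComplexConjugate
namespace LP
variable {N : ℕ} {Ω : Set (EN N)}

lemma eb_norm (j : Fin N) : ‖(eb j : EN N)‖ = 1 := by simp [eb]
lemma Ieb_norm (j : Fin N) : ‖Complex.I • (eb j : EN N)‖ = 1 := by rw [norm_smul]; simp [eb_norm]

lemma cd_norm_le {a : ℂ} (ha : ‖a‖ = 1) {j : Fin N} {w : EN N → ℂ} {z : EN N} {B : ℝ}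
    (h : ∀ v, ‖fderiv ℝ w z v‖ ≤ B * ‖v‖) : ‖cd a j w z‖ ≤ B := by
  have h1 := h (eb j)
  have h2 := h (Complex.I • eb j)
  rw [eb_norm] at h1
  rw [Ieb_norm] at h2
  unfold cd
  rw [norm_mul]
  have h3 := norm_add_le (fderiv ℝ w z (eb j)) (a * fderiv ℝ w z (Complex.I • eb j))
  rw [norm_mul, ha] at h3
  have : ‖(1/2:ℂ)‖ = 1/2 := by simp
  rw [this]
  linarith

def th (s : ℝ) : ℝ := Real.smoothTransition (s - 1)

lemma th_contDiff : ContDiff ℝ (⊤ : ℕ∞) th :=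
  Real.smoothTransition.contDiff.comp (contDiff_id.sub contDiff_const)

lemma th_zero {s : ℝ} (h : s ≤ 1) : th s = 0 := Real.smoothTransition.zero_of_nonpos (by linarith)
lemma th_one {s : ℝ} (h : 2 ≤ s) : th s = 1 := Real.smoothTransition.one_of_one_le (by linarith)

lemma th_deriv : ∃ C : ℝ, 0 < C ∧ (∀ s, |deriv th s| ≤ C) ∧ ∀ s, 2 < s → deriv th s = 0 := by
  have hc : Continuous (deriv th) := (th_contDiff.continuous_deriv (by norm_num))
  obtain ⟨C, hC⟩ := (isCompact_Icc (a := (1:ℝ)) (b := 2)).exists_bound_of_continuousOn hc.continuousOn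
  have h2 : ∀ s, 2 < s → deriv th s = 0 := by
    intro s hs
    have : th =ᶠ[𝓝 s] fun _ => 1 := by
      filter_upwards [lt_mem_nhds hs] with t ht using th_one ht.le
    rw [this.deriv_eq]; simp
  have h1 : ∀ s, s < 1 → deriv th s = 0 := by
    intro s hs
    have : th =ᶠ[𝓝 s] fun _ => 0 := by
      filter_upwards [gt_mem_nhds hs] with t ht using th_zero (le_of_lt ht)
    rw [this.deriv_eq]; simp
  refine ⟨|C| + 1, by positivity, fun s => ?_, h2⟩
  rcases lt_or_ge s 1 with h | h
  · rw [h1 s h]; simp; positivity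
  rcases lt_or_ge 2 s with h' | h'
  · rw [h2 s h']; simp; positivity
  · have := hC s ⟨h, h'⟩
    rw [Real.norm_eq_abs] at this
    linarith [le_abs_self C]

/-- the scalar weight inequality -/
lemma weight_alg {τ δ A c c1 M C K L q n : ℝ} (hτ : 0 < τ) (hδ : 0 < δ) (hδA : δ * A ≤ 1)
    (hM : 0 < M) (hM1 : 8 * δ ≤ M) (hM2 : 2 * c1 ≤ M * c) (hK : 0 ≤ K) (hc1 : 0 ≤ c1)
    (hC : (8 * K + 2 * c1 + M * K) / δ^2 ≤ C) (hn : 0 ≤ n) (hq : 0 ≤ q) (hC0 : 0 ≤ C)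
    (hnear : τ < δ → c * n ≤ L + A * q) (hL : -(K * n) ≤ L) (hqK : q ≤ K * n) :
    2 * (4 * q / τ^2) + 2 * (c1 / τ^2 * n) ≤ M * (L / τ^2 + 2 * q / τ^3) + C * n := by
  have e1 : 2 * (4 * q / τ^2) + 2 * (c1 / τ^2 * n) = (8 * q + 2 * c1 * n) / τ^2 := by ring
  have e2 : M * (L / τ^2 + 2 * q / τ^3) + C * n = (M * (L + 2 * q / τ)) / τ^2 + C * n := by
    field_simp
  rw [e1, e2]
  rcases lt_or_ge τ δ with h | h
  · have h1 := hnear h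
    have h2 : 8 * q + 2 * c1 * n ≤ M * (L + 2 * q / τ) := by
      have a1 : A * q ≤ q / τ := by
        rw [le_div_iff₀ hτ]
        rcases le_or_gt A 0 with hA | hA
        · have : A * q * τ ≤ 0 := mul_nonpos_of_nonpos_of_nonneg (mul_nonpos_of_nonpos_of_nonneg hA hq) hτ.le
          linarith
        · have : A * τ ≤ 1 := by nlinarith
          nlinarith
      have a2 : 8 * q ≤ M * (q / τ) := by
        have : 8 * q * τ ≤ M * q := by nlinarith
        rw [← mul_div_assoc, le_div_iff₀ hτ]; exact this
      have a3 : 2 * c1 * n ≤ M * (c * n) := by nlinarith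
      have a4 : 2 * q / τ = q / τ + q / τ := by ring
      rw [a4]
      have : M * (c * n) ≤ M * (L + q / τ) := by
        apply mul_le_mul_of_nonneg_left _ hM.le; linarith
      linarith
    have : (8 * q + 2 * c1 * n) / τ^2 ≤ (M * (L + 2 * q / τ)) / τ^2 := by gcongr
    have := mul_nonneg hC0 hn
    linarith
  · have b1 : (8 * q + 2 * c1 * n) / τ^2 - (M * (L + 2 * q / τ)) / τ^2 ≤ ((8 * K + 2 * c1 + M * K) * n) / τ^2 := by
      rw [← sub_div]
      gcongr
      have : 0 ≤ 2 * q / τ := by positivity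
      have : M * (-(K * n)) ≤ M * (L + 2 * q / τ) := mul_le_mul_of_nonneg_left (by linarith) hM.le
      nlinarith
    have b2 : ((8 * K + 2 * c1 + M * K) * n) / τ^2 ≤ ((8 * K + 2 * c1 + M * K) * n) / δ^2 := by
      have : 0 ≤ (8 * K + 2 * c1 + M * K) * n := by positivity
      gcongr
    have b3 : ((8 * K + 2 * c1 + M * K) * n) / δ^2 ≤ C * n := by
      have := mul_le_mul_of_nonneg_right hC hn
      calc _ = (8 * K + 2 * c1 + M * K) / δ^2 * n := by ring
        _ ≤ _ := this
    linarith

namespace Geo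
variable {D V : Set (EN N)} {ρ : EN N → ℝ}

lemma cutoffs (G : Geo D ρ V) : ∃ c0 : ℝ, 0 < c0 ∧ ∀ c1 ≥ c0,
    ∃ η, Cutoffs D (fun z => Real.log c1 - 2 * Real.log (-ρ z)) η := by
  obtain ⟨C, hC0, hCρ, hC1, hC2, hC3⟩ := G.bounds
  obtain ⟨Ct, hCt0, hCt, hCt2⟩ := th_deriv
  refine ⟨(2 * Ct * C)^2 + 1, by positivity, fun c1 hc1 => ?_⟩
  have hc1' : 0 < c1 := lt_of_lt_of_le (by positivity) hc1
  classical
  let ηr : ℕ → EN N → ℝ := fun n z => if z ∈ D then th ((n+1) * (-ρ z)) else 0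
  have hK : ∀ n : ℕ, IsCompact {z ∈ closure D | 1 ≤ ((n:ℝ)+1) * (-ρ z)} := by
    intro n
    have hcl : IsClosed {z ∈ closure D | 1 ≤ ((n:ℝ)+1) * (-ρ z)} := by
      have hc : ContinuousOn (fun z => ((n:ℝ)+1) * (-ρ z)) (closure D) :=
        continuousOn_const.mul (G.cdV.continuousOn.mono G.cl_sub).neg
      exact hc.preimage_isClosed_of_isClosed isClosed_closure isClosed_Ici
    exact G.cpt.of_isClosed_subset hcl (fun z hz => hz.1)
  have hKD : ∀ n : ℕ, {z ∈ closure D | 1 ≤ ((n:ℝ)+1) * (-ρ z)} ⊆ D := by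
    rintro n z ⟨h1, h2⟩
    refine G.memD (G.cl_sub h1) ?_
    have : (0:ℝ) < (n:ℝ)+1 := by positivity
    nlinarith
  have hloc : ∀ n : ℕ, ∀ z ∈ D, ηr n =ᶠ[𝓝 z] fun y => th (((n:ℝ)+1) * (-ρ y)) := by
    intro n z hz
    filter_upwards [G.op.mem_nhds hz] with y hy
    simp [ηr, hy]
  have hsupp : ∀ n : ℕ, ∀ z, z ∉ {z ∈ closure D | 1 ≤ ((n:ℝ)+1) * (-ρ z)} → ηr n z = 0 := by
    intro n z hz
    by_cases hzD : z ∈ D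
    · simp only [ηr, hzD, if_true]
      apply th_zero
      by_contra h
      push Not at h
      exact hz ⟨subset_closure hzD, h.le⟩
    · simp [ηr, hzD]
  have hn2 : ∀ n : ℕ, ((n : ℕ) : WithTop ℕ∞) ≤ ((⊤ : ℕ∞) : WithTop ℕ∞) := fun n => by exact_mod_cast le_top
  have hsm : ∀ n, ContDiff ℝ 2 (ηr n) := by
    intro n
    rw [contDiff_iff_contDiffAt]
    intro z
    by_cases hzD : z ∈ D
    · refine ContDiffAt.congr_of_eventuallyEq ?_ (hloc n z hzD)
      exact (th_contDiff.of_le (hn2 2)).contDiffAt.comp z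
        (contDiffAt_const.mul (G.cda (G.sub hzD)).neg)
    · have : ηr n =ᶠ[𝓝 z] fun _ => 0 := by
        filter_upwards [(hK n).isClosed.isOpen_compl.mem_nhds (fun h => hzD (hKD n h))] with y hy
          using hsupp n y hy
      exact contDiffAt_const.congr_of_eventuallyEq this
  have hτs : ∀ n, tsupport (cr (ηr n)) ⊆ {z ∈ closure D | 1 ≤ ((n:ℝ)+1) * (-ρ z)} := by
    intro n
    refine closure_minimal ?_ (hK n).isClosed
    intro z hz
    by_contra h
    exact hz (by simp [cr, hsupp n z h])
  refine ⟨fun n => cr (ηr n), ⟨fun n => ⟨?_, ?_, (hτs n).trans (hKD n)⟩, ?_, ?_, ?_⟩⟩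
  · exact Complex.ofRealCLM.contDiff.comp (hsm n)
  · exact (hK n).of_isClosed_subset (isClosed_tsupport _) (hτs n)
  · intro n z
    simp only [cr, Complex.norm_real, ηr]
    split_ifs
    · rw [th, Real.norm_of_nonneg (Real.smoothTransition.nonneg _)]
      exact Real.smoothTransition.le_one _
    · simp
  · intro n z hz j
    have hτ : 0 < -ρ z := by linarith [G.neg hz]
    have hb : ∀ v, ‖fderiv ℝ (cr (ηr n)) z v‖ ≤ (2 * Ct * C / (-ρ z)) * ‖v‖ := by
      intro v
      rw [fderiv_cr ((hsm n).differentiable (by norm_num) z), Complex.norm_real]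
      have hd : HasFDerivAt (fun y => th (((n:ℝ)+1) * (-ρ y)))
          (deriv th (((n:ℝ)+1) * (-ρ z)) • (((n:ℝ)+1) • (-fderiv ℝ ρ z))) z := by
        have h1 := ((G.cda (G.sub hz)).differentiableAt (by norm_num)).hasFDerivAt.neg.const_mul ((n:ℝ)+1)
        exact ((th_contDiff.differentiable (by norm_num)) _).hasDerivAt.comp_hasFDerivAt z h1
      rw [(hloc n z hz).fderiv_eq, hd.fderiv]
      simp only [smul_apply, neg_apply, smul_eq_mul, norm_mul, Real.norm_eq_abs, abs_neg]
      have hv := hC1 z (subset_closure hz) v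
      have hn0 : (0:ℝ) < (n:ℝ)+1 := by positivity
      rw [abs_of_pos hn0]
      rcases lt_or_ge 2 (((n:ℝ)+1) * (-ρ z)) with h | h
      · rw [hCt2 _ h]; simp; positivity
      · have h2 : (n:ℝ)+1 ≤ 2 / (-ρ z) := by rw [le_div_iff₀ hτ]; exact h
        calc _ ≤ Ct * ((2 / (-ρ z)) * (C * ‖v‖)) := by
              gcongr
              exact hCt _
          _ = _ := by ring
    have hexp : Real.exp (Real.log c1 - 2 * Real.log (-ρ z)) = c1 / (-ρ z)^2 := by
      rw [Real.exp_sub, Real.exp_log hc1', two_mul, Real.exp_add, Real.exp_log hτ, sq]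
    rw [hexp]
    have key : ∀ a : ℂ, ‖a‖ = 1 → ‖cd a j (cr (ηr n)) z‖^2 ≤ c1 / (-ρ z)^2 := by
      intro a ha
      have h1 := cd_norm_le (j := j) ha hb
      calc _ ≤ (2 * Ct * C / (-ρ z))^2 := by gcongr
        _ = (2 * Ct * C)^2 / (-ρ z)^2 := by rw [div_pow]
        _ ≤ _ := by gcongr; linarith
    exact ⟨key _ (by simp), key _ (by simp)⟩
  · intro z hz
    have hτ : 0 < -ρ z := by linarith [G.neg hz]
    obtain ⟨m, hm⟩ := exists_nat_gt (4 / (-ρ z))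
    filter_upwards [eventually_ge_atTop m] with n hn
    have hev : ∀ᶠ y in 𝓝 z, (-ρ z) / 2 < -ρ y :=
      ((G.cda (G.sub hz)).continuousAt.neg).eventually (lt_mem_nhds (show -ρ z / 2 < -ρ z by linarith))
    filter_upwards [hev, hloc n z hz] with y hy hy2
    simp only [cr, hy2]
    rw [th_one]; · simp
    have h1 : 4 / (-ρ z) < (n:ℝ) + 1 := by
      have : (m:ℝ) ≤ n := by exact_mod_cast hn
      linarith
    rw [div_lt_iff₀ hτ] at h1
    nlinarith

end Geo
end LP
end

noncomputable section
open Set Filter Topology Metric MeasureTheory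
open scoped ENNReal NNReal InnerProductSpace ComplexConjugate
namespace LP
variable {N : ℕ} {Ω : Set (EN N)}

lemma xsq_exp {M τ : ℝ} (hM : 0 < M) (hτ : 0 < τ) : 1 / τ^2 * Real.exp (-(M/τ)) ≤ 2 / M^2 := by
  have h := Real.quadratic_le_exp_of_nonneg (x := M/τ) (by positivity)
  have h2 : (M/τ)^2 / 2 ≤ Real.exp (M/τ) := by
    have : 0 ≤ M/τ := by positivity
    linarith
  rw [Real.exp_neg]
  have h3 : (Real.exp (M/τ))⁻¹ ≤ ((M/τ)^2/2)⁻¹ := inv_anti₀ (by positivity) h2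
  calc _ ≤ 1/τ^2 * ((M/τ)^2/2)⁻¹ := by gcongr
    _ = _ := by field_simp

namespace Geo
variable {D V : Set (EN N)} {ρ : EN N → ℝ}

theorem hormander (G : Geo D ρ V) : ∃ M : ℝ, 0 < M ∧ ∀ g : Fin N → EN N → ℂ,
    (∀ j, AEStronglyMeasurable (g j) ((LM N).restrict D)) → (∃ B : ℝ, ∀ j, ∀ z ∈ D, ‖g j z‖ ≤ B) →
    (∀ j k w, Tst 2 D w → ∫ z, g j z * dbar k w z ∂(LM N) = ∫ z, g k z * dbar j w z ∂(LM N)) →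
    ∃ u, AEStronglyMeasurable u ((LM N).restrict D) ∧
      IntegrableOn (fun z => Real.exp (-(M / (-ρ z))) * ‖u z‖^2) D (LM N) ∧
      ∀ j w, Tst 2 D w → ∫ z, u z * dbar j w z ∂(LM N) = -∫ z, g j z * w z ∂(LM N) := by
  obtain ⟨K, hK0, hKρ, hK1, hK2, hK3⟩ := G.bounds
  obtain ⟨A, c, δ0, hA, hc, hδ0, hnear⟩ := G.near
  obtain ⟨c1, hc1, hcut⟩ := G.cutoffs
  obtain ⟨η, hη⟩ := hcut c1 le_rfl
  let δ := min δ0 (1/A)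
  have hδ : 0 < δ := lt_min hδ0 (by positivity)
  have hδA : δ * A ≤ 1 := by
    have : δ ≤ 1/A := min_le_right _ _
    rwa [le_div_iff₀ hA] at this
  let M := 8 * δ + 2 * c1 / c
  have hM : 0 < M := by positivity
  have hM2 : 2 * c1 ≤ M * c := by
    have : 2 * c1 / c * c = 2 * c1 := by field_simp
    have h2 : 0 < 8 * δ * c := by positivity
    simp only [M]; rw [add_mul]; linarith
  let K' := K + K^2
  have hK' : 0 ≤ K' := by positivity
  let C := (8 * K' + 2 * c1 + M * K') / δ^2
  have hC0 : 0 ≤ C := by positivity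
  let φ : EN N → ℝ := fun z => -M / ρ z + C * ‖z‖^2
  let ψ : EN N → ℝ := fun z => Real.log c1 - 2 * Real.log (-ρ z)
  have hρ0 : ∀ z ∈ D, ρ z ≠ 0 := fun z hz => (G.neg hz).ne
  have hφ1 : ContDiffOn ℝ 2 (fun z => -M / ρ z) D := contDiffOn_const.div G.cdD hρ0
  have hφ2 : ContDiff ℝ 2 (fun z : EN N => C * ‖z‖^2) := contDiff_const.mul (contDiff_norm_sq ℝ)
  have hφ : ContDiffOn ℝ 2 φ D := hφ1.add hφ2.contDiffOn
  have hψ : ContDiffOn ℝ 2 ψ D := contDiffOn_const.sub (contDiffOn_const.mul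
    (G.cdD.neg.log fun z hz => neg_ne_zero.2 (hρ0 z hz)))
  have hexp : ∀ z ∈ D, Real.exp (ψ z) = c1 / (-ρ z)^2 := by
    intro z hz
    have hτ : 0 < -ρ z := by linarith [G.neg hz]
    simp only [ψ]
    rw [Real.exp_sub, Real.exp_log hc1, two_mul, Real.exp_add, Real.exp_log hτ, sq]
  have hW : WeightIneq D φ ψ := by
    refine weight_of_levi G.op hφ hψ fun z hz w => ?_
    have hzc := subset_closure hz
    have hτ : 0 < -ρ z := by linarith [G.neg hz]
    rw [hexp z hz]
    have hfψ : ∀ v, fderiv ℝ ψ z v = (-2 / ρ z) * fderiv ℝ ρ z v := fun v =>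
      (hess_comp G.op G.cdD (fun z hz => G.neg hz) (g := fun s => Real.log c1 - 2 * Real.log (-s))
        (g1 := fun s => -2 / s) (g2 := fun s => 2 / s^2) (fun s hs => by
          have h1 := (((hasDerivAt_id s).neg.log (by simpa using hs.ne)).const_mul 2).const_sub (Real.log c1)
          refine HasDerivAt.congr_deriv (f := fun s => Real.log c1 - 2 * Real.log (-s)) h1 ?_
          have := hs.ne
          simp only [Pi.neg_apply, id]; field_simp) (fun s hs => by
          have h1 := (hasDerivAt_const s (-2:ℝ)).div (hasDerivAt_id s) hs.ne
          refine HasDerivAt.congr_deriv (f := fun s => -2 / s) h1 ?_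
          have := hs.ne
          simp only [id]; field_simp; ring) hz v v).1
    have hq : dq ψ z w = 4 * dq ρ z w / (-ρ z)^2 := by
      simp only [dq, hfψ]
      field_simp
      ring
    have hHφ : ∀ v, Hess φ z v v = M / (ρ z)^2 * Hess ρ z v v + (-2*M/(ρ z)^3) * (fderiv ℝ ρ z v * fderiv ℝ ρ z v)
        + C * (2 * ‖v‖^2) := by
      intro v
      have h1 := (hess_comp G.op G.cdD (fun z hz => G.neg hz) (g := fun s => -M / s)
        (g1 := fun s => M / s^2) (g2 := fun s => -2*M / s^3) (fun s hs => by
          have h1 := (hasDerivAt_const s (-M:ℝ)).div (hasDerivAt_id s) hs.ne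
          refine HasDerivAt.congr_deriv (f := fun s => -M / s) h1 ?_
          have := hs.ne
          simp only [id]; field_simp; ring) (fun s hs => by
          have h1 := (hasDerivAt_const s (M:ℝ)).div ((hasDerivAt_id s).pow 2) (pow_ne_zero 2 hs.ne)
          refine HasDerivAt.congr_deriv (f := fun s => M / s^2) h1 ?_
          have := hs.ne
          simp only [id, Pi.pow_apply]; field_simp; norm_num; ring) hz v v).2
      have hN : ∀ y, fderiv ℝ (fun z : EN N => C * ‖z‖^2) y = C • fderiv ℝ (fun z : EN N => ‖z‖^2) y := fun y => by
        have : DifferentiableAt ℝ (fun z : EN N => ‖z‖^2) y := (contDiff_norm_sq ℝ).differentiable (n := 2) (by norm_num) y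
        exact fderiv_const_mul this C
      have hds : ∀ {f : EN N → ℝ}, ContDiffAt ℝ 2 f z → DifferentiableAt ℝ (fderiv ℝ f) z := fun h =>
        (h.fderiv_right (m := 1) (by norm_num)).differentiableAt (by norm_num)
      have h2 : Hess (fun z : EN N => C * ‖z‖^2) z v v = C * (2 * ‖v‖^2) := by
        rw [← hess_normsq z v]
        unfold Hess
        rw [show fderiv ℝ (fun z : EN N => C * ‖z‖^2) = fun y => C • fderiv ℝ (fun z : EN N => ‖z‖^2) y from funext hN]
        have := (hds (contDiff_norm_sq ℝ).contDiffAt).hasFDerivAt.const_smul C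
        rw [show fderiv ℝ (fun y => C • fderiv ℝ (fun z : EN N => ‖z‖^2) y) z = _ from this.fderiv]
        rfl
      rw [← h1, ← h2]
      have hev : fderiv ℝ φ =ᶠ[𝓝 z] fun y => fderiv ℝ (fun z => -M / ρ z) y + fderiv ℝ (fun z : EN N => C * ‖z‖^2) y := by
        filter_upwards [G.op.mem_nhds hz] with y hy
        exact fderiv_add ((hφ1.differentiableOn (by norm_num) y hy).differentiableAt (G.op.mem_nhds hy))
          (hφ2.differentiable (by norm_num) y)
      unfold Hess
      rw [hev.fderiv_eq]
      have h4 := (hds ((hφ1 z hz).contDiffAt (G.op.mem_nhds hz))).hasFDerivAt.add (hds hφ2.contDiffAt).hasFDerivAt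
      rw [show fderiv ℝ (fun y => fderiv ℝ (fun z => -M / ρ z) y + fderiv ℝ (fun z : EN N => C * ‖z‖^2) y) z = _ from h4.fderiv]
      rfl
    have hIw : ‖Complex.I • w‖ = ‖w‖ := by rw [norm_smul]; simp
    have hLφ : LeviForm φ z w = M * (LeviForm ρ z w / (-ρ z)^2 + 2 * dq ρ z w / (-ρ z)^3) + C * ‖w‖^2 := by
      simp only [LeviForm, dq, hHφ, hIw]
      have := hρ0 z hz
      field_simp
      ring
    rw [hq, hLφ]
    have hHb : ∀ v, |Hess ρ z v v| ≤ K * ‖v‖^2 := fun v => by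
      have := hK2 z hzc v v; rw [sq, ← mul_assoc]; exact this
    refine weight_alg (K := K') hτ hδ hδA hM ?_ hM2 hK' hc1.le le_rfl (by positivity) (dq_nonneg _ _) hC0
      (fun h => hnear z hzc (h.trans_le (min_le_left _ _)) w) ?_ ?_
    · have : 0 ≤ 2 * c1 / c := by positivity
      simp only [M]; linarith
    · have a1 := (abs_le.1 (hHb w)).1
      have a2 := (abs_le.1 (hHb (Complex.I • w))).1
      rw [hIw] at a2
      have a3 : 0 ≤ K^2 * ‖w‖^2 := by positivity
      have a4 : 0 ≤ K * ‖w‖^2 := by positivity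
      simp only [LeviForm, K']
      linarith
    · have b1 := hK1 z hzc w
      have b2 := hK1 z hzc (Complex.I • w)
      rw [hIw] at b2
      have b1' := sq_le_sq' (by linarith [abs_le.1 b1]) (abs_le.1 b1).2
      have b2' := sq_le_sq' (by linarith [abs_le.1 b2]) (abs_le.1 b2).2
      rw [mul_pow] at b1' b2'
      have a3 : 0 ≤ K^2 * ‖w‖^2 := by positivity
      have a4 : 0 ≤ K * ‖w‖^2 := by positivity
      simp only [dq, K']
      linarith
  refine ⟨M, hM, fun g hgm ⟨B, hB⟩ hgc => ?_⟩
  have hmsD : MeasurableSet D := G.op.measurableSet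
  have hfin : (LM N) D < ⊤ := G.bd.measure_lt_top
  have hφM : ∀ z, -φ z ≤ -(M / (-ρ z)) := by
    intro z
    have : 0 ≤ C * ‖z‖^2 := by positivity
    have e : -M / ρ z = M / (-ρ z) := by rw [div_neg, neg_div]
    simp only [φ]; rw [e]; linarith
  have hgi : ∀ j, IntegrableOn (fun z => Real.exp (ψ z - φ z) * ‖g j z‖^2) D (LM N) := by
    intro j
    have : IsFiniteMeasure ((LM N).restrict D) := ⟨by simpa using hfin⟩
    refine Integrable.of_bound ?_ (c1 * (2 / M^2) * |B|^2) ?_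
    · refine AEStronglyMeasurable.mul ?_ ((hgm j).norm.pow 2)
      exact (Real.continuous_exp.comp_continuousOn (hψ.continuousOn.sub hφ.continuousOn)).aestronglyMeasurable hmsD
    · filter_upwards [ae_restrict_mem hmsD] with z hz
      have hτ : 0 < -ρ z := by linarith [G.neg hz]
      rw [Real.norm_of_nonneg (by positivity)]
      have h1 : ‖g j z‖ ≤ |B| := (hB j z hz).trans (le_abs_self B)
      have h2 : Real.exp (ψ z - φ z) ≤ c1 * (2 / M^2) := by
        rw [sub_eq_add_neg, Real.exp_add, hexp z hz]
        calc _ ≤ c1 / (-ρ z)^2 * Real.exp (-(M/(-ρ z))) := by gcongr ?_ * ?_; exact Real.exp_le_exp.2 (hφM z)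
          _ = c1 * (1 / (-ρ z)^2 * Real.exp (-(M/(-ρ z)))) := by ring
          _ ≤ _ := by gcongr; exact xsq_exp hM hτ
      gcongr
  obtain ⟨u, hu1, hu2, hu3⟩ := LP.hormander G.op hφ hψ hW hη hgm hgi hgc
  refine ⟨u, hu1, ?_, hu3⟩
  let κ := c1^2 / K^4 * Real.exp (-(C * K^2))
  have hκ : 0 < κ := by positivity
  refine Integrable.mono' (hu2.const_mul κ⁻¹) ?_ ?_
  · refine AEStronglyMeasurable.mul ?_ (hu1.norm.pow 2)
    refine ContinuousOn.aestronglyMeasurable ?_ hmsD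
    exact Real.continuous_exp.comp_continuousOn ((continuousOn_const.div G.cdD.continuousOn.neg
      fun z hz => neg_ne_zero.2 (hρ0 z hz)).neg)
  · filter_upwards [ae_restrict_mem hmsD] with z hz
    have hτ : 0 < -ρ z := by linarith [G.neg hz]
    have hzc := subset_closure hz
    rw [Real.norm_of_nonneg (by positivity), ← mul_assoc]
    gcongr
    rw [inv_mul_eq_div, le_div_iff₀ hκ]
    have e : Real.exp (2 * ψ z - φ z) = (c1 / (-ρ z)^2)^2 * (Real.exp (-(C * ‖z‖^2)) * Real.exp (-(M / (-ρ z)))) := by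
      rw [← hexp z hz, ← Real.exp_add, sq, ← Real.exp_add, ← Real.exp_add]
      congr 1
      simp only [φ]; rw [div_neg, neg_div]; ring
    rw [e]
    have hτK : -ρ z ≤ K := (neg_le_abs _).trans (hKρ z hzc)
    have hzK := hK3 z hzc
    calc _ = (c1 / K^2)^2 * (Real.exp (-(C * K^2)) * Real.exp (-(M / (-ρ z)))) := by
          simp only [κ]; rw [div_pow, ← pow_mul]; ring
      _ ≤ _ := by gcongr

end Geo
end LP
end

noncomputable section
open Set Filter Topology Metric MeasureTheory
open scoped ENNReal NNReal InnerProductSpace ComplexConjugate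
namespace LP
variable {N : ℕ} {Ω : Set (EN N)}

lemma taylor2 {f : EN N → ℝ} {x : EN N} (hf : ContDiffAt ℝ 2 f x) {ε : ℝ} (hε : 0 < ε) :
    ∃ r > 0, ∀ z ∈ closedBall x r, |f z - f x - fderiv ℝ f x (z - x) - 1/2 * Hess f x (z - x) (z - x)| ≤ ε * ‖z - x‖^2 := by
  have hsym : ∀ v w, Hess f x v w = Hess f x w v := fun v w =>
    (hf.isSymmSndFDerivAt (by simp)) v w
  have hd : HasFDerivAt (fderiv ℝ f) (fderiv ℝ (fderiv ℝ f) x) x :=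
    ((hf.fderiv_right (m := 1) (by norm_num)).differentiableAt (by norm_num)).hasFDerivAt
  have h1 := hd.isLittleO.def hε
  have h2 : ∀ᶠ y in 𝓝 x, DifferentiableAt ℝ f y := by
    filter_upwards [hf.eventually (by simp)] with y hy using hy.differentiableAt (by norm_num)
  obtain ⟨r, hr, hb⟩ := Metric.nhds_basis_closedBall.eventually_iff.1 (h1.and h2)
  refine ⟨r, hr, fun z hz => ?_⟩
  set B := fderiv ℝ (fderiv ℝ f) x with hB
  set g : EN N → ℝ := fun y => f y - fderiv ℝ f x (y - x) - 1/2 * B (y - x) (y - x) with hg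
  have hsub : closedBall x ‖z - x‖ ⊆ closedBall x r := closedBall_subset_closedBall (by rwa [mem_closedBall, dist_eq_norm] at hz)
  have hid : ∀ y, HasFDerivAt (fun y : EN N => y - x) (ContinuousLinearMap.id ℝ (EN N)) y := fun y =>
    (hasFDerivAt_id y).sub_const x
  have hgd : ∀ y ∈ closedBall x ‖z - x‖, HasFDerivWithinAt g (fderiv ℝ f y - fderiv ℝ f x - B (y - x)) (closedBall x ‖z - x‖) y := by
    intro y hy
    have e1 := (hb (hsub hy)).2.hasFDerivAt
    have e2 := (fderiv ℝ f x).hasFDerivAt.comp y (hid y)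
    have e3 := ((B.hasFDerivAt.comp y (hid y)).clm_apply (hid y)).const_mul (1/2:ℝ)
    refine HasFDerivAt.hasFDerivWithinAt ?_
    refine HasFDerivAt.congr_fderiv ((e1.sub e2).sub e3) ?_
    ext w
    have h3 := hsym w y
    have h4 := hsym w x
    simp only [Hess, ← hB] at h3 h4
    simp [h3, h4]
    ring
  have := (convex_closedBall x ‖z - x‖).norm_image_sub_le_of_norm_hasFDerivWithin_le (C := ε * ‖z - x‖) hgd (by
    intro y hy
    refine (hb (hsub hy)).1.trans ?_
    rw [mem_closedBall, dist_eq_norm] at hy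
    gcongr) (mem_closedBall_self (norm_nonneg _)) (y := z) (by rw [mem_closedBall, dist_eq_norm])
  rw [Real.norm_eq_abs] at this
  have e : g z - g x = f z - f x - fderiv ℝ f x (z - x) - 1/2 * Hess f x (z - x) (z - x) := by
    simp [hg, Hess, ← hB]; ring
  rw [e] at this
  calc _ ≤ _ := this
    _ = _ := by ring

/-- holomorphic quadratic part -/
lemma quad_diff (B : EN N →L[ℝ] EN N →L[ℝ] ℝ) (hB : ∀ v w, B v w = B w v) :
    Differentiable ℂ (fun v : EN N => ((B v v : ℝ) : ℂ) - (B (Complex.I • v) (Complex.I • v) : ℝ) - 2 * Complex.I * (B v (Complex.I • v) : ℝ)) := by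
  intro v
  let J : EN N →L[ℝ] EN N := (Complex.I • ContinuousLinearMap.id ℂ (EN N)).restrictScalars ℝ
  have hJ : ∀ v, J v = Complex.I • v := fun v => rfl
  have hid := hasFDerivAt_id (𝕜 := ℝ) v
  have hJd := J.hasFDerivAt (x := v)
  have e1 := Complex.ofRealCLM.hasFDerivAt.comp v (((B.hasFDerivAt (x := v))).clm_apply hid)
  have e2 := Complex.ofRealCLM.hasFDerivAt.comp v (((B.hasFDerivAt (x := J v)).comp v hJd).clm_apply hJd)
  have e3 := (Complex.ofRealCLM.hasFDerivAt.comp v (((B.hasFDerivAt (x := v))).clm_apply hJd)).const_mul (2 * Complex.I)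
  have h := (e1.sub e2).sub e3
  have h' : HasFDerivAt (fun v : EN N => ((B v v : ℝ) : ℂ) - (B (Complex.I • v) (Complex.I • v) : ℝ) - 2 * Complex.I * (B v (Complex.I • v) : ℝ)) _ v := h
  refine diff_of_dbar h'.differentiableAt fun j => ?_
  simp only [dbar, cd, h'.fderiv]
  have hII : ∀ w : EN N, J (Complex.I • w) = -w := fun w => by rw [hJ, smul_smul]; simp
  simp [hII, hJ]
  rw [hB (eb j) (Complex.I • v), hB (Complex.I • eb j) v, hB (Complex.I • eb j) (Complex.I • v), hB (eb j) v]
  linear_combination (2 * ((B v (eb j) : ℝ) : ℂ) - 2 * ((B (Complex.I • v) (Complex.I • eb j) : ℝ) : ℂ)) * Complex.I_sq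

lemma clin_diff (d : EN N →L[ℝ] ℝ) :
    Differentiable ℂ (fun v : EN N => ((d v : ℝ) : ℂ) - Complex.I * (d (Complex.I • v) : ℝ)) := by
  intro v
  let J : EN N →L[ℝ] EN N := (Complex.I • ContinuousLinearMap.id ℂ (EN N)).restrictScalars ℝ
  have hJ : ∀ v, J v = Complex.I • v := fun v => rfl
  have e1 := Complex.ofRealCLM.hasFDerivAt.comp v (d.hasFDerivAt (x := v))
  have e2 := (Complex.ofRealCLM.hasFDerivAt.comp v ((d.hasFDerivAt (x := J v)).comp v J.hasFDerivAt)).const_mul (Complex.I)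
  have h' : HasFDerivAt (fun v : EN N => ((d v : ℝ) : ℂ) - Complex.I * (d (Complex.I • v) : ℝ)) _ v := e1.sub e2
  refine diff_of_dbar h'.differentiableAt fun j => ?_
  simp only [dbar, cd, h'.fderiv]
  have hII : ∀ w : EN N, J (Complex.I • w) = -w := fun w => by rw [hJ, smul_smul]; simp
  simp [hII, hJ]
  linear_combination ((d (eb j) : ℝ) : ℂ) * Complex.I_sq

/-- elementary inequality behind the Levi polynomial -/
lemma levi_alg {ρ d d' L R A c K v B : ℝ} (hA : 0 < A) (hK : 0 ≤ K) (hρ : ρ ≤ 0) (hρA : -ρ * (8 * A) ≤ 1)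
    (hR : |R| ≤ c / 4 * v) (hv : 0 ≤ v) (hB : |B| ≤ K * v) (hc : 0 < c) (hvs : 4 * A * (K + c)^2 * v ≤ c / 4)
    (hT : R = ρ - d - 1/2 * B) (hL : c * v ≤ L + A * (d^2 + d'^2)) :
    -ρ / 2 + c / 2 * v ≤ -(d + (1/2 * B - L) + A * (d^2 - d'^2)) := by
  have h1 : -(d + (1/2 * B - L) + A * (d^2 - d'^2)) = -ρ + R + (L + A * (d^2 + d'^2)) - 2 * A * d^2 := by
    rw [hT]; ring
  have h2 : |d - ρ| ≤ (K + c) * v := by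
    have : d - ρ = -R - 1/2 * B := by rw [hT]; ring
    rw [this]
    rw [abs_le] at *
    constructor <;> nlinarith
  have h3 : (d - ρ)^2 ≤ ((K + c) * v)^2 := by
    rw [← sq_abs]; gcongr
  have h4 : d^2 ≤ 2 * ρ^2 + 2 * ((K+c) * v)^2 := by nlinarith [sq_nonneg (d - 2 * ρ)]
  have h5 : 2 * A * d^2 ≤ 4 * A * ρ^2 + 4 * A * (K+c)^2 * v * v := by nlinarith
  have h6 : 4 * A * ρ^2 ≤ -ρ / 2 := by nlinarith
  have h7 : 4 * A * (K+c)^2 * v * v ≤ c/4 * v := mul_le_mul_of_nonneg_right hvs hv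
  have h8 := (abs_le.1 hR).1
  rw [h1]; linarith

namespace Geo
variable {D V : Set (EN N)} {ρ : EN N → ℝ}

theorem levi_poly (G : Geo D ρ V) {x : EN N} (hx : x ∈ frontier D) :
    ∃ (P : EN N → ℂ) (r c C : ℝ), Differentiable ℂ P ∧ ContDiff ℝ 1 P ∧ 0 < r ∧ 0 < c ∧ 0 < C ∧
      (∀ z ∈ D ∩ closedBall x r, -ρ z / 2 + c * ‖z - x‖^2 ≤ (P z).re) ∧
      (∀ z ∈ closedBall x 1, ‖P z‖ ≤ C * ‖z - x‖) := by
  obtain ⟨K, hK0, hKρ, hK1, hK2, hK3⟩ := G.bounds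
  obtain ⟨A', c, δ0, hA', hc, hδ0, hnear⟩ := G.near
  have hxc := frontier_subset_closure hx
  have hxV := G.cl_sub hxc
  have hρx := G.front hx
  set B := fderiv ℝ (fderiv ℝ ρ) x with hB
  set d := fderiv ℝ ρ x with hd
  let A := A' / 4
  have hA : 0 < A := by positivity
  have hsym : ∀ v w, B v w = B w v := fun v w => ((G.cda hxV).isSymmSndFDerivAt (by simp)) v w
  let ℓ : EN N → ℂ := fun v => ((d v : ℝ) : ℂ) - Complex.I * (d (Complex.I • v) : ℝ)
  let q : EN N → ℂ := fun v => ((B v v : ℝ) : ℂ) - (B (Complex.I • v) (Complex.I • v) : ℝ) - 2 * Complex.I * (B v (Complex.I • v) : ℝ)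
  let P : EN N → ℂ := fun z => -(ℓ (z - x) + (1/4) * q (z - x) + A * (ℓ (z - x))^2)
  have hℓd : Differentiable ℂ (fun z => ℓ (z - x)) := (clin_diff d).comp (differentiable_id.sub_const x)
  have hqd : Differentiable ℂ (fun z => q (z - x)) := (quad_diff B hsym).comp (differentiable_id.sub_const x)
  have hPd : Differentiable ℂ P := ((hℓd.add (hqd.const_mul (1/4))).add ((hℓd.pow 2).const_mul (A:ℂ))).neg
  have hPc : ContDiff ℝ 1 P := by
    let J : EN N →L[ℝ] EN N := (Complex.I • ContinuousLinearMap.id ℂ (EN N)).restrictScalars ℝ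
    have o := Complex.ofRealCLM.contDiff (n := 1)
    have hl : ContDiff ℝ 1 ℓ := (o.comp d.contDiff).sub (contDiff_const.mul (o.comp (d.contDiff.comp J.contDiff)))
    have hq : ContDiff ℝ 1 q := ((o.comp (B.contDiff.clm_apply contDiff_id)).sub
      (o.comp ((B.contDiff.comp J.contDiff).clm_apply J.contDiff))).sub
      (contDiff_const.mul (o.comp (B.contDiff.clm_apply J.contDiff)))
    have hs : ContDiff ℝ 1 (fun z : EN N => z - x) := contDiff_id.sub contDiff_const
    exact (((hl.comp hs).add (contDiff_const.mul (hq.comp hs))).add (contDiff_const.mul ((hl.comp hs).pow 2))).neg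
  obtain ⟨r1, hr1, hT⟩ := taylor2 (G.cda hxV) (ε := c/4) (by positivity)
  have hev : ∀ᶠ z in 𝓝 x, -ρ z * (8 * A) < 1 := by
    have h1 : ContinuousAt (fun z => -ρ z * (8 * A)) x := ((G.cda hxV).continuousAt.neg).mul continuousAt_const
    refine h1.eventually_lt continuousAt_const ?_
    rw [hρx]; norm_num
  have hev2 : ∀ᶠ z in 𝓝 x, 4 * A * (K + c)^2 * ‖z - x‖^2 < c/4 := by
    have h1 : Continuous (fun z : EN N => 4 * A * (K + c)^2 * ‖z - x‖^2) := by fun_prop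
    refine h1.continuousAt.eventually_lt continuousAt_const ?_
    simp; positivity
  obtain ⟨r2, hr2, hb⟩ := Metric.nhds_basis_closedBall.eventually_iff.1 (hev.and hev2)
  have hIw : ∀ w : EN N, ‖Complex.I • w‖ = ‖w‖ := fun w => by rw [norm_smul]; simp
  refine ⟨P, min r1 r2, c/2, 2 * K + K + 4 * A * K^2, hPd, hPc, lt_min hr1 hr2, by positivity, by positivity, ?_, ?_⟩
  · rintro z ⟨hzD, hz⟩
    have hz1 : z ∈ closedBall x r1 := closedBall_subset_closedBall (min_le_left _ _) hz
    have hz2 := hb (closedBall_subset_closedBall (min_le_right _ _) hz)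
    set v := z - x with hv
    have hre : (P z).re = -(d v + (1/2 * B v v - LeviForm ρ x v) + A * ((d v)^2 - (d (Complex.I • v))^2)) := by
      simp only [P, ℓ, q, ← hv, LeviForm, Hess, ← hB]
      simp [sq]
      ring
    rw [hre]
    refine levi_alg (K := K) (R := ρ z - d v - 1/2 * B v v) hA hK0.le (G.neg hzD).le hz2.1.le ?_ (by positivity) ?_ hc hz2.2.le rfl ?_
    · have := hT z hz1
      rw [hρx] at this
      simpa [Hess, ← hB, ← hd, ← hv] using this
    · have := hK2 x hxc v v
      rw [sq, ← mul_assoc]; exact this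
    · have := hnear x hxc (by rw [hρx]; simpa using hδ0) v
      refine this.trans (le_of_eq ?_)
      simp only [dq, ← hd, A]; ring
  · intro z hz
    set v := z - x with hv
    have hv1 : ‖v‖ ≤ 1 := by rwa [mem_closedBall, dist_eq_norm] at hz
    have e1 : ∀ w, ‖((d w : ℝ) : ℂ)‖ ≤ K * ‖w‖ := fun w => by rw [Complex.norm_real]; exact hK1 x hxc w
    have e2 : ∀ w w', ‖((B w w' : ℝ) : ℂ)‖ ≤ K * ‖w‖ * ‖w'‖ := fun w w' => by rw [Complex.norm_real]; exact hK2 x hxc w w'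
    have hl : ‖ℓ v‖ ≤ 2 * K * ‖v‖ := by
      refine (norm_sub_le _ _).trans ?_
      have h1 := e1 v
      have h2 := e1 (Complex.I • v)
      rw [hIw] at h2
      rw [norm_mul, Complex.norm_I]; linarith
    have hq : ‖q v‖ ≤ 4 * K * ‖v‖ := by
      have h0 : K * ‖v‖ * ‖v‖ ≤ K * ‖v‖ := mul_le_of_le_one_right (by positivity) hv1
      have h1 := e2 v v
      have h2 := e2 (Complex.I • v) (Complex.I • v)
      have h3 := e2 v (Complex.I • v)
      rw [hIw] at h2 h3
      refine (norm_sub_le _ _).trans ?_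
      have := norm_sub_le (((B v v : ℝ) : ℂ)) ((B (Complex.I • v) (Complex.I • v) : ℝ) : ℂ)
      rw [norm_mul, norm_mul, Complex.norm_I, Complex.norm_two]
      linarith
    have hl2 : ‖(ℓ v)^2‖ ≤ 4 * K^2 * ‖v‖ := by
      rw [norm_pow]
      calc ‖ℓ v‖^2 ≤ (2 * K * ‖v‖)^2 := by gcongr
        _ = 4 * K^2 * (‖v‖ * ‖v‖) := by ring
        _ ≤ 4 * K^2 * (‖v‖ * 1) := by gcongr
        _ = _ := by ring
    have hPz : P z = -(ℓ v + (1/4) * q v + A * (ℓ v)^2) := rfl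
    rw [hPz, norm_neg]
    refine (norm_add₃_le).trans ?_
    rw [norm_mul, norm_mul, Complex.norm_real, Real.norm_of_nonneg hA.le]
    have : ‖(1/4:ℂ)‖ = 1/4 := by norm_num
    rw [this]
    nlinarith

end Geo
end LP
end

noncomputable section
open Set Filter Topology Metric MeasureTheory
open scoped ENNReal NNReal InnerProductSpace ComplexConjugate
namespace LP
variable {N : ℕ} {Ω : Set (EN N)}

lemma dbar_holo {f : EN N → ℂ} {z : EN N} (h : DifferentiableAt ℂ f z) (j : Fin N) : dbar j f z = 0 := by
  simp only [dbar, cd, h.fderiv_restrictScalars ℝ]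
  simp only [ContinuousLinearMap.coe_restrictScalars', map_smul, smul_eq_mul]
  linear_combination (1/2 * (fderiv ℂ f z) (eb j)) * Complex.I_sq

lemma L2loc_cont {f : EN N → ℂ} (hf : ContinuousOn f Ω) : L2loc Ω f := by
  have h1 : L2loc Ω (fun _ : EN N => (1:ℂ)) := fun K hK hKc => by
    have : IsFiniteMeasure ((LM N).restrict K) := ⟨by simpa using hKc.measure_lt_top⟩
    exact memLp_const 1
  simpa using h1.cont_mul hf

lemma mo_sub_loc {f u : EN N → ℂ} (hf : L2loc Ω f) (hu : L2loc Ω u) {z : EN N} {ε : ℝ} (hε : 0 < ε)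
    (hb : closedBall z ε ⊆ Ω) : mo ε (fun y => f y - u y) z = mo ε f z - mo ε u z := by
  have hd : ε + dist z z ≤ ε := by simp
  have hc := isCompact_closedBall z ε
  have hl : ∀ {f : EN N → ℂ}, L2loc Ω f → LocallyIntegrable ((closedBall z ε).indicator f) (LM N) := fun h =>
    memLp_locInt ((memLp_indicator_iff_restrict hc.measurableSet).2 (h _ hb hc))
  rw [mo_local hε hd, mo_local (f := f) hε hd, mo_local (f := u) hε hd]
  unfold mo
  rw [← integral_sub (mo_exists hε (hl hf) z) (mo_exists hε (hl hu) z)]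
  refine integral_congr_ae (Eventually.of_forall fun y => ?_)
  by_cases hy : y ∈ closedBall z ε <;> simp [hy, sub_mul]

lemma mo_loc_congr {f g : EN N → ℂ} {z : EN N} {ε : ℝ} (hε : 0 < ε) (h : ∀ y ∈ closedBall z ε, f y = g y) :
    mo ε f z = mo ε g z := by
  have hd : ε + dist z z ≤ ε := by simp
  rw [mo_local hε hd, mo_local (f := g) hε hd]
  congr 1
  ext y
  by_cases hy : y ∈ closedBall z ε <;> simp [hy]
  exact h y (by simpa using hy)

lemma mo_mean_loc {f : EN N → ℂ} {z : EN N} {ε R : ℝ} (hε : 0 < ε) (hR : ε < R)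
    (hf : DifferentiableOn ℂ f (ball z R)) : mo ε f z = f z := by
  let b : ContDiffBump z := ⟨(2 * ε + R)/3, (ε + 2 * R)/3, by linarith, by linarith⟩
  let h : EN N → ℂ := fun y => (b y : ℂ) * f y
  have hbc : Continuous fun y => (b y : ℂ) := Complex.continuous_ofReal.comp b.continuous
  have hc : Continuous h := by
    rw [continuous_iff_continuousAt]
    intro y
    by_cases hy : y ∈ ball z R
    · exact hbc.continuousAt.mul ((hf y hy).differentiableAt (isOpen_ball.mem_nhds hy)).continuousAt
    · have : h =ᶠ[𝓝 y] fun _ => 0 := by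
        have hy' : y ∉ tsupport b := by
          rw [b.tsupport_eq, mem_closedBall]
          rw [mem_ball] at hy
          change ¬ dist y z ≤ (ε + 2 * R)/3
          linarith
        filter_upwards [(notMem_tsupport_iff_eventuallyEq.1 hy')] with w hw
        simp [h, hw]
      exact (continuousAt_const (y := (0:ℂ))).congr this.symm
  have he : ∀ y ∈ closedBall z ((2 * ε + R)/3), h y = f y := fun y hy => by
    have := b.one_of_mem_closedBall hy
    simp [h, this]
  have hd : DifferentiableOn ℂ h (ball z ((2 * ε + R)/3)) :=
    (hf.mono (ball_subset_ball (by linarith))).congr fun y hy => he y (ball_subset_closedBall hy)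
  have h1 := mo_mean hε (by linarith) hc hd
  rw [he z (mem_closedBall_self (by linarith))] at h1
  rw [← h1]
  exact mo_loc_congr hε fun y hy => (he y (closedBall_subset_closedBall (by linarith) hy)).symm

namespace Geo
variable {D V : Set (EN N)} {ρ : EN N → ℝ}

theorem correct (G : Geo D ρ V) : ∃ M : ℝ, 0 < M ∧ ∀ H : EN N → ℂ, ContDiffOn ℝ 1 H D →
    (∃ B : ℝ, ∀ j, ∀ z ∈ D, ‖dbar j H z‖ ≤ B) → ∃ F : EN N → ℂ, DifferentiableOn ℂ F D ∧ ∃ I : ℝ, 0 ≤ I ∧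
      ∀ z ε t, 0 < ε → 0 < t → closedBall z (2 * ε) ⊆ D → (∀ y ∈ closedBall z ε, t / 2 ≤ -ρ y) →
        ‖F z - mo ε H z‖ ≤ 1 / (ε ^ (2 * N) * kI N) * (Real.exp (2 * M / t) * I + (LM N).real (closedBall z ε)) := by
  obtain ⟨M, hM, hh⟩ := G.hormander
  refine ⟨M, hM, fun H hH hB => ?_⟩
  have hcd : ∀ j, ContinuousOn (dbar j H) D := fun j =>
    (contDiffOn_cd (n := 0) G.op (by simpa using hH) Complex.I j).continuousOn
  obtain ⟨u, hu1, hu2, hu3⟩ := hh (fun j => dbar j H) (fun j => (hcd j).aestronglyMeasurable G.op.measurableSet) hB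
    (fun j k w hw => ibp2 G.op hH hw _ _ j k)
  have hHl : L2loc D H := L2loc_cont hH.continuousOn
  have hρ0 : ∀ z ∈ D, -ρ z ≠ 0 := fun z hz => by have := G.neg hz; linarith
  have hIntg : ∀ K ⊆ D, ∀ t : ℝ, 0 < t → MeasurableSet K → (∀ y ∈ K, t / 2 ≤ -ρ y) →
      IntegrableOn (fun y => ‖u y‖^2) K (LM N) ∧ ∫ y in K, ‖u y‖^2 ∂(LM N) ≤
        Real.exp (2 * M / t) * ∫ z in D, Real.exp (-(M / (-ρ z))) * ‖u z‖^2 ∂(LM N) := by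
    intro K hK t ht hKm hKt
    have hle : ∀ y ∈ K, ‖u y‖^2 ≤ Real.exp (2 * M / t) * (Real.exp (-(M / (-ρ y))) * ‖u y‖^2) := by
      intro y hy
      rw [← mul_assoc, ← Real.exp_add]
      have h1 : M / (-ρ y) ≤ 2 * M / t := by
        rw [div_le_div_iff₀ (by linarith [hKt y hy]) ht]
        nlinarith [hKt y hy]
      have h2 : 1 ≤ Real.exp (2 * M / t + -(M / -ρ y)) := Real.one_le_exp (by linarith)
      nlinarith [sq_nonneg ‖u y‖]
    have hi := (hu2.mono_set hK).const_mul (Real.exp (2 * M / t))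
    have hi1 : IntegrableOn (fun y => ‖u y‖^2) K (LM N) := by
      refine Integrable.mono' hi ((hu1.mono_measure (Measure.restrict_mono hK le_rfl)).norm.pow 2) ?_
      filter_upwards [ae_restrict_mem hKm] with y hy
      rw [Real.norm_of_nonneg (by positivity)]
      exact hle y hy
    refine ⟨hi1, ?_⟩
    calc _ ≤ ∫ y in K, Real.exp (2 * M / t) * (Real.exp (-(M / (-ρ y))) * ‖u y‖^2) ∂(LM N) :=
          setIntegral_mono_on hi1 hi hKm hle
      _ = Real.exp (2 * M / t) * ∫ y in K, (Real.exp (-(M / (-ρ y))) * ‖u y‖^2) ∂(LM N) := integral_const_mul _ _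
      _ ≤ _ := by
        gcongr ?_ * ?_
        exact setIntegral_mono_set hu2 (Eventually.of_forall fun y => by positivity) (Eventually.of_forall hK)
  have hul : L2loc D u := by
    intro K hK hKc
    rcases K.eq_empty_or_nonempty with rfl | hne
    · simp
    obtain ⟨y0, hy0, hmin⟩ := hKc.exists_isMinOn hne (G.cdD.continuousOn.neg.mono hK)
    have := (hIntg K hK (-ρ y0) (by linarith [G.neg (hK hy0)]) hKc.measurableSet (fun y hy => by
      have h1 : -ρ y0 ≤ -ρ y := hmin hy
      linarith [G.neg (hK hy0)])).1
    exact (memLp_two_iff_integrable_sq_norm (hu1.mono_measure (Measure.restrict_mono hK le_rfl))).2 this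
  obtain ⟨F, hF, hFm⟩ := weyl G.op (hHl.sub hul) (by
    intro j w hw
    have hw1 : Tst 1 D w := hw.of_le (by norm_num)
    have hcw : Tst 0 D (dbar j w) := (hw.cd _ j).of_le (by norm_num)
    have e1 := ibp G.op hH hw1 Complex.I j
    have e2 := hu3 j w hw
    have i1 := hHl.int_test hcw
    have i2 := hul.int_test hcw
    simp only [sub_mul]
    rw [integral_sub i1 i2, e2]
    have e3 : ∫ z, dbar j H z * w z ∂(LM N) = -∫ z, H z * dbar j w z ∂(LM N) := e1
    rw [e3]; ring)
  refine ⟨F, hF, _, setIntegral_nonneg (f := fun z => Real.exp (-(M / (-ρ z))) * ‖u z‖^2) (μ := LM N) G.op.measurableSet (fun y _ => by positivity), ?_⟩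
  intro z ε t hε ht hsub hτ
  have hsub1 : closedBall z ε ⊆ D := (closedBall_subset_closedBall (by linarith)).trans hsub
  rw [hFm z ε (2 * ε) hε (by linarith) hsub, mo_sub_loc hHl hul hε hsub1]
  have := hIntg _ hsub1 t ht measurableSet_closedBall hτ
  rw [sub_sub_cancel_left, norm_neg]
  exact mo_bound hε this.1 this.2

end Geo
end LP
end

noncomputable section
open Set Filter Topology Metric MeasureTheory
open scoped ENNReal NNReal InnerProductSpace ComplexConjugate
namespace LP
variable {N : ℕ} {Ω : Set (EN N)}

lemma exp_grow (C : ℝ) (n : ℕ) : Tendsto (fun y : ℝ => Real.exp y - C * y^n) atTop atTop := by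
  have h1 : Tendsto (fun y : ℝ => y^n / Real.exp y) atTop (𝓝 0) := by
    have := (Real.tendsto_exp_div_pow_atTop n).inv_tendsto_atTop
    refine this.congr fun y => ?_
    simp
  have h2 : Tendsto (fun y : ℝ => Real.exp y * (1 - C * (y^n / Real.exp y))) atTop atTop := by
    refine Real.tendsto_exp_atTop.atTop_mul_pos one_pos ?_
    simpa using (tendsto_const_nhds (x := (1:ℝ))).sub (h1.const_mul C)
  refine h2.congr fun y => ?_
  have := Real.exp_pos y
  field_simp

/-- elementary final estimate -/
lemma final_est {a b E t C2 T : ℝ} {n : ℕ} {M : ℝ} (hM : 0 < M) (ht : 0 < t) (hE : Real.exp ((2 * M + 1) / t) ≤ E)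
    (hb : b ≤ C2 * (1/t)^n * Real.exp (2 * M / t)) (hT : max T 0 ≤ Real.exp (1/t) - C2 * (1/t)^n)
    (ha : E - b ≤ a) : T ≤ a := by
  have h1 : Real.exp ((2 * M + 1) / t) = Real.exp (1/t) * Real.exp (2 * M / t) := by
    rw [← Real.exp_add]; congr 1; ring
  have h2 : 1 ≤ Real.exp (2 * M / t) := Real.one_le_exp (by positivity)
  have h3 := le_max_left T 0
  have h4 := le_max_right T 0
  have h5 : max T 0 ≤ (Real.exp (1/t) - C2 * (1/t)^n) * Real.exp (2 * M / t) := by nlinarith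
  linarith

namespace Geo
variable {D V : Set (EN N)} {ρ : EN N → ℝ}

theorem blowup (G : Geo D ρ V) {x : EN N} (hx : x ∈ frontier D) {C0 : ℝ} (hC0 : 0 < C0) :
    ∃ F : EN N → ℂ, DifferentiableOn ℂ F D ∧ ∀ T : ℝ, ∃ δ > 0, ∀ z ∈ D, ‖z - x‖ < δ → ‖z - x‖ ≤ C0 * (-ρ z) → T ≤ ‖F z‖ := by
  obtain ⟨P, r0, c, CP, hP, hPC, hr0, hc, hCP, hP1, hP2⟩ := G.levi_poly hx
  obtain ⟨M, hM, hcor⟩ := G.correct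
  have hxV := G.cl_sub (frontier_subset_closure hx)
  let r := min r0 1
  have hr : 0 < r := lt_min hr0 one_pos
  have hrr0 : r ≤ r0 := min_le_left _ _
  have hr1 : r ≤ 1 := min_le_right _ _
  have hPpos : ∀ z ∈ D ∩ closedBall x r, 0 < (P z).re := by
    rintro z ⟨hz, hz'⟩
    have := hP1 z ⟨hz, closedBall_subset_closedBall hrr0 hz'⟩
    have h2 := G.neg hz
    nlinarith [sq_nonneg ‖z - x‖]
  let A : ℝ := (2 * M + 1) * (2 * CP^2 * C0^2)
  have hA : 0 < A := by positivity
  let E : EN N → ℂ := fun z => Complex.exp (A / P z)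
  have hEd : ∀ z ∈ D ∩ closedBall x r, DifferentiableAt ℂ E z := by
    intro z hz
    have hne : P z ≠ 0 := fun h => by have := hPpos z hz; rw [h] at this; simp at this
    have h1 : DifferentiableAt ℂ (fun z => (A:ℂ) / P z) z := by
      simp only [div_eq_mul_inv]
      exact ((hP z).fun_inv hne).const_mul _
    exact h1.cexp
  have hEn : ∀ z, ‖E z‖ = Real.exp (A * ((P z).re / Complex.normSq (P z))) := by
    intro z
    rw [Complex.norm_exp]
    congr 1
    rw [Complex.div_re]; simp [mul_div_assoc]
  let b : ContDiffBump x := ⟨r/4, r/2, by positivity, by linarith⟩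
  let χ : EN N → ℂ := fun y => (b y : ℂ)
  have hχ : ContDiff ℝ 1 χ := Complex.ofRealCLM.contDiff.comp b.contDiff
  have hχts : tsupport χ ⊆ closedBall x (r/2) := by
    refine closure_minimal ?_ isClosed_closedBall
    intro y hy
    have : y ∈ Function.support b := fun h => hy (by simp [χ, h])
    rw [b.support_eq] at this
    exact ball_subset_closedBall this
  have hχ1 : ∀ y ∈ closedBall x (r/4), χ y = 1 := fun y hy => by
    have := b.one_of_mem_closedBall hy
    simp [χ, this]
  let H : EN N → ℂ := fun y => χ y * E y
  have hopD : IsOpen (D ∩ ball x r) := G.op.inter isOpen_ball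
  have hED : ContDiffOn ℝ 1 E (D ∩ ball x r) := by
    intro z hz
    have hne : P z ≠ 0 := fun h => by
      have := hPpos z ⟨hz.1, ball_subset_closedBall hz.2⟩; rw [h] at this; simp at this
    have hPc : ContDiffAt ℝ 1 P z := hPC.contDiffAt
    have h1 : ContDiffAt ℝ 1 (fun z => (A:ℂ) / P z) z := by
      simp only [div_eq_mul_inv]
      exact contDiffAt_const.mul (hPc.inv hne)
    exact h1.cexp.contDiffWithinAt
  have hHz : ∀ z, z ∉ closedBall x (r/2) → H =ᶠ[𝓝 z] fun _ => 0 := by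
    intro z hz
    filter_upwards [(notMem_tsupport_iff_eventuallyEq.1 (fun h => hz (hχts h)))] with w hw
    simp only [H, hw]; simp
  have hH : ContDiffOn ℝ 1 H D := by
    intro z hz
    by_cases hzb : z ∈ ball x r
    · exact ((hχ.contDiffAt.mul ((hED z ⟨hz, hzb⟩).contDiffAt (hopD.mem_nhds ⟨hz, hzb⟩)))).contDiffWithinAt
    · have h1 : z ∉ closedBall x (r/2) := fun h => hzb (by rw [mem_closedBall] at h; rw [mem_ball]; linarith)
      exact (contDiffAt_const.congr_of_eventuallyEq (hHz z h1)).contDiffWithinAt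
  have hHB : ∃ B : ℝ, ∀ j, ∀ z ∈ D, ‖dbar j H z‖ ≤ B := by
    have hcj : ∀ j : Fin N, ∃ B : ℝ, ∀ z, ‖dbar j χ z‖ ≤ B := by
      intro j
      have hcont : ContinuousOn (dbar j χ) univ := (contDiffOn_cd (n := 0) isOpen_univ (by simpa using hχ.contDiffOn) Complex.I j).continuousOn
      obtain ⟨B, hB⟩ := (isCompact_closedBall x (r/2)).exists_bound_of_continuousOn (hcont.mono (subset_univ _))
      refine ⟨max B 0, fun z => ?_⟩
      by_cases hz : z ∈ closedBall x (r/2)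
      · exact (hB z hz).trans (le_max_left _ _)
      · have : dbar j χ z = 0 := cd_zero_of_notMem_tsupport (fun h => hz (hχts h))
        rw [this]; simp
    choose B hB using hcj
    refine ⟨∑ j, |B j| * Real.exp (A * (1 / (c * (r/4)^2))), fun j z hz => ?_⟩
    have hterm : ‖dbar j H z‖ ≤ |B j| * Real.exp (A * (1 / (c * (r/4)^2))) := by
      by_cases hzb : z ∈ closedBall x (r/2)
      · have hzr : z ∈ D ∩ closedBall x r := ⟨hz, closedBall_subset_closedBall (by linarith) hzb⟩
        have e1 : dbar j H z = dbar j χ z * E z := by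
          have := cd_mul (a := Complex.I) (j := j) (w := χ) (u := E) (z := z) (hχ.differentiable (by norm_num) z) ((hEd z hzr).restrictScalars ℝ)
          have h2 := dbar_holo (hEd z hzr) j
          simp only [dbar] at h2 ⊢
          rw [show cd Complex.I j H z = _ from this, h2]; ring
        by_cases hzs : z ∈ ball x (r/4)
        · have : dbar j χ z = 0 := by
            have h3 : χ =ᶠ[𝓝 z] fun _ => 1 := by
              filter_upwards [isOpen_ball.mem_nhds hzs] with y hy using hχ1 y (ball_subset_closedBall hy)
            simp only [dbar]
            rw [cd_congr h3, cd_const]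
          rw [e1, this]; simp; positivity
        · rw [e1, norm_mul, hEn]
          have hge : r/4 ≤ ‖z - x‖ := by rw [mem_ball, dist_eq_norm] at hzs; linarith
          have hre : c * (r/4)^2 ≤ (P z).re := by
            have := hP1 z ⟨hz, closedBall_subset_closedBall hrr0 hzr.2⟩
            have h2 := G.neg hz
            have : c * (r/4)^2 ≤ c * ‖z - x‖^2 := by gcongr
            linarith
          have hcr : 0 < c * (r/4)^2 := by positivity
          have hrp : 0 < (P z).re := by linarith
          have hns : (P z).re^2 ≤ Complex.normSq (P z) := by
            rw [Complex.normSq_apply]; nlinarith [mul_self_nonneg (P z).im]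
          have : (P z).re / Complex.normSq (P z) ≤ 1 / (c * (r/4)^2) := by
            rw [div_le_div_iff₀ (by nlinarith) hcr]
            nlinarith
          have h5 := (hB j z).trans (le_abs_self _)
          gcongr
      · have : dbar j H z = 0 := by
          simp only [dbar]
          rw [cd_congr (hHz z hzb), cd_const]
        rw [this]; simp; positivity
    refine hterm.trans ?_
    exact Finset.single_le_sum (f := fun j => |B j| * Real.exp (A * (1 / (c * (r/4)^2)))) (fun i _ => by positivity) (Finset.mem_univ j)
  obtain ⟨F, hF, I, hI, hFb⟩ := hcor H hH hHB
  refine ⟨F, hF, fun T => ?_⟩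
  obtain ⟨L0, W, hW, hLip⟩ := ((G.cda hxV).of_le (by norm_num : (1:WithTop ℕ∞) ≤ 2)).exists_lipschitzOnWith
  obtain ⟨s, hs, hsW⟩ := Metric.nhds_basis_closedBall.mem_iff.1 (Filter.inter_mem hW (G.Vop.mem_nhds hxV))
  let L : ℝ := L0 + 1
  have hL : 1 ≤ L := by simp [L]
  have hLp : 0 < L := by linarith
  have hLip' : ∀ y ∈ closedBall x s, ∀ z ∈ closedBall x s, |ρ y - ρ z| ≤ L * ‖y - z‖ := by
    intro y hy z hz
    have := hLip.dist_le_mul y (hsW hy).1 z (hsW hz).1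
    rw [Real.dist_eq, dist_eq_norm] at this
    have h2 := norm_nonneg (y - z)
    simp only [L]; linarith
  let v1 : ℝ := (LM N).real (closedBall (0:EN N) 1)
  let C2 : ℝ := (4 * L)^(2 * N) / kI N * (I + v1)
  have hgrow := ((exp_grow C2 (2*N)).eventually_ge_atTop (max T 0))
  obtain ⟨Y, hY⟩ := eventually_atTop.1 hgrow
  have hkI : 0 < kI N := kI_pos
  have hv1 : 0 ≤ v1 := measureReal_nonneg
  have hYp : 0 < max Y 1 := by positivity
  let δ := min (min (s/2) (r/8)) (1 / (L * max Y 1))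
  have hδ : 0 < δ := by refine lt_min (lt_min (by positivity) (by positivity)) (by positivity)
  refine ⟨δ, hδ, fun z hz hzx hzC => ?_⟩
  have hδ1 : δ ≤ s/2 := (min_le_left _ _).trans (min_le_left _ _)
  have hδ2 : δ ≤ r/8 := (min_le_left _ _).trans (min_le_right _ _)
  have hδ3 : δ ≤ 1 / (L * max Y 1) := min_le_right _ _
  have hρx := G.front hx
  set t := -ρ z with ht
  have htp : 0 < t := by have := G.neg hz; linarith
  have hzs : z ∈ closedBall x s := by rw [mem_closedBall, dist_eq_norm]; linarith
  have htL : t ≤ L * ‖z - x‖ := by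
    have := hLip' z hzs x (mem_closedBall_self hs.le)
    rw [hρx, sub_zero] at this
    exact (neg_le_abs _).trans this
  have htδ : t ≤ L * δ := htL.trans (by gcongr)
  let ε := t / (4 * L)
  have hε : 0 < ε := by positivity
  have hεδ : ε ≤ δ / 4 := by
    simp only [ε]; rw [div_le_iff₀ (by positivity)]; linarith
  have h2ε : ∀ y ∈ closedBall z (2 * ε), y ∈ D ∧ t / 2 ≤ -ρ y ∧ y ∈ ball x (r/4) := by
    intro y hy
    rw [mem_closedBall, dist_eq_norm] at hy
    have hyx : ‖y - x‖ ≤ δ / 2 + ‖z - x‖ := by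
      have := norm_sub_le_norm_sub_add_norm_sub y z x
      linarith
    have hys : y ∈ closedBall x s := by rw [mem_closedBall, dist_eq_norm]; linarith
    have h1 := hLip' y hys z hzs
    have h2 : L * ‖y - z‖ ≤ t / 2 := by
      calc _ ≤ L * (2 * ε) := by gcongr
        _ = t / 2 := by simp only [ε]; field_simp; norm_num
    have h3 : t / 2 ≤ -ρ y := by have := (le_abs_self _).trans (h1.trans h2); linarith
    refine ⟨G.memD (hsW hys).2 (by linarith), h3, ?_⟩
    rw [mem_ball, dist_eq_norm]; linarith
  have hest := hFb z ε t hε htp (fun y hy => (h2ε y hy).1)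
    (fun y hy => (h2ε y (closedBall_subset_closedBall (by linarith) hy)).2.1)
  have hmo : mo ε H z = E z := by
    rw [mo_loc_congr (g := E) hε, mo_mean_loc hε (R := 2 * ε) (by linarith)]
    · intro y hy
      have := h2ε y (ball_subset_closedBall hy)
      exact (hEd y ⟨this.1, closedBall_subset_closedBall (by linarith) (ball_subset_closedBall this.2.2)⟩).differentiableWithinAt
    · intro y hy
      have := h2ε y (closedBall_subset_closedBall (by linarith) hy)
      simp only [H, hχ1 y (ball_subset_closedBall this.2.2), one_mul]
  rw [hmo] at hest
  have hEz : Real.exp ((2 * M + 1) / t) ≤ ‖E z‖ := by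
    rw [hEn]
    refine Real.exp_le_exp.2 ?_
    have hzr : z ∈ D ∩ closedBall x r := ⟨hz, by rw [mem_closedBall, dist_eq_norm]; linarith⟩
    have hp := hPpos z hzr
    have h1 := hP1 z ⟨hz, closedBall_subset_closedBall hrr0 hzr.2⟩
    have h2 : t / 2 ≤ (P z).re := by
      have : 0 ≤ c * ‖z - x‖^2 := by positivity
      linarith
    have h3 := hP2 z (closedBall_subset_closedBall hr1 hzr.2)
    have h4 : Complex.normSq (P z) ≤ (CP * (C0 * t))^2 := by
      rw [Complex.normSq_eq_norm_sq]
      have : ‖P z‖ ≤ CP * (C0 * t) := h3.trans (by gcongr)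
      gcongr
    have h5 : 0 < Complex.normSq (P z) := by
      rw [Complex.normSq_pos]; intro h; rw [h] at hp; simp at hp
    have h6 : 1 / (2 * CP^2 * C0^2 * t) ≤ (P z).re / Complex.normSq (P z) := by
      rw [div_le_div_iff₀ (by positivity) h5]
      calc 1 * Complex.normSq (P z) ≤ (CP * (C0 * t))^2 := by linarith
        _ = t / 2 * (2 * CP^2 * C0^2 * t) := by ring
        _ ≤ _ := by gcongr
    calc (2 * M + 1) / t = A * (1 / (2 * CP^2 * C0^2 * t)) := by simp only [A]; field_simp
      _ ≤ _ := by gcongr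
  have hb : 1 / (ε ^ (2 * N) * kI N) * (Real.exp (2 * M / t) * I + (LM N).real (closedBall z ε)) ≤
      C2 * (1/t)^(2*N) * Real.exp (2 * M / t) := by
    have h1 : (LM N).real (closedBall z ε) ≤ v1 := by
      have e : (LM N).real (closedBall z 1) = v1 := by
        simp only [v1, Measure.real]
        rw [Measure.addHaar_closedBall_center]
      rw [← e]
      refine measureReal_mono (closedBall_subset_closedBall ?_) (isCompact_closedBall z 1).measure_lt_top.ne
      linarith
    have h2 : 1 ≤ Real.exp (2 * M / t) := Real.one_le_exp (by positivity)
    calc _ ≤ 1 / (ε ^ (2 * N) * kI N) * (Real.exp (2 * M / t) * I + Real.exp (2 * M / t) * v1) := by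
          gcongr; nlinarith
      _ = _ := by
        simp only [C2, ε]; rw [div_pow, div_pow, one_pow]; field_simp
  refine final_est (n := 2 * N) (M := M) hM htp hEz hb (hY _ ?_) ?_
  · have h1 : t ≤ 1 / max Y 1 := by
      refine htδ.trans ((mul_le_mul_of_nonneg_left hδ3 hLp.le).trans (le_of_eq ?_))
      field_simp
    have h2 : max Y 1 ≤ 1 / t := by rw [le_div_iff₀ htp]; rw [le_div_iff₀ hYp] at h1; linarith
    exact (le_max_left _ _).trans h2
  · have := norm_sub_norm_le (E z) (F z)
    rw [norm_sub_rev] at this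
    linarith

/-- blow-up along a transversal curve -/
theorem blowup_path (G : Geo D ρ V) {x : EN N} (hx : x ∈ frontier D) {p : ℝ → EN N} {v : EN N}
    (hp : HasDerivWithinAt p v (Icc 0 1) 1) (hp1 : p 1 = x) (hpD : ∀ r ∈ Ico (0:ℝ) 1, p r ∈ D)
    (hv : fderiv ℝ ρ x v ≠ 0) :
    ∃ F : EN N → ℂ, DifferentiableOn ℂ F D ∧ Tendsto (fun r => ‖F (p r)‖) (𝓝[<] 1) atTop := by
  have hxV := G.cl_sub (frontier_subset_closure hx)
  have hρx := G.front hx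
  set a := fderiv ℝ ρ x v with ha
  have hap : 0 < |a| := abs_pos.2 hv
  obtain ⟨F, hF, hFT⟩ := G.blowup hx (C0 := (‖v‖ + 1) * (2 / |a|)) (by positivity)
  refine ⟨F, hF, ?_⟩
  have hp' : HasDerivWithinAt p v (Ico 0 1) 1 := hp.mono Ico_subset_Icc_self
  have hd : HasFDerivAt ρ (fderiv ℝ ρ x) (p 1) := by
    rw [hp1]; exact ((G.cda hxV).differentiableAt (by norm_num)).hasFDerivAt
  have hρp : HasDerivWithinAt (ρ ∘ p) a (Ico 0 1) 1 := hd.comp_hasDerivWithinAt 1 hp'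
  have h1 := hp'.hasFDerivWithinAt.isLittleO.def (c := 1) one_pos
  have h2 := hρp.hasFDerivWithinAt.isLittleO.def (c := |a|/2) (by positivity)
  have hmem : 𝓝[<] (1:ℝ) ≤ 𝓝[Ico 0 1] 1 := by
    rw [nhdsWithin_Ico_eq_nhdsLT (by norm_num)]
  have hcont : Tendsto (fun r => ‖p r - x‖) (𝓝[Ico 0 1] 1) (𝓝 0) := by
    have := hp'.continuousWithinAt.tendsto.sub_const x |>.norm
    simpa [hp1] using this
  rw [Filter.tendsto_atTop]
  intro T
  obtain ⟨δ, hδ, hT⟩ := hFT T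
  have key : ∀ᶠ r in 𝓝[Ico 0 1] (1:ℝ), T ≤ ‖F (p r)‖ := by
    filter_upwards [h1, h2, hcont.eventually_lt_const hδ, self_mem_nhdsWithin] with r e1 e2 e3 hr
    refine hT _ (hpD r hr) e3 ?_
    have hr1 : |r - 1| = 1 - r := by rw [abs_sub_comm, abs_of_nonneg]; linarith [hr.2]
    simp only [hp1, ContinuousLinearMap.toSpanSingleton_apply, Function.comp, hρx, Real.norm_eq_abs, hr1, smul_eq_mul] at e1 e2
    have f1 : ‖p r - x‖ ≤ (1 - r) * (‖v‖ + 1) := by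
      have h3 := norm_sub_norm_le (p r - x) ((r - 1) • v)
      rw [norm_smul, Real.norm_eq_abs, hr1] at h3
      linarith
    have f2 : (1 - r) * (|a| / 2) ≤ -ρ (p r) := by
      have h3 := abs_sub_abs_le_abs_sub ((r - 1) * a) (ρ (p r) - 0)
      rw [abs_sub_comm ((r - 1) * a), abs_mul, hr1] at h3
      have h4 : |ρ (p r) - 0| = -ρ (p r) := by rw [sub_zero, abs_of_neg (G.neg (hpD r hr))]
      rw [h4] at h3
      linarith
    have f3 : 1 - r ≤ (2 / |a|) * (-ρ (p r)) := by
      rw [div_mul_eq_mul_div, le_div_iff₀ hap]; linarith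
    calc _ ≤ _ := f1
      _ ≤ (2 / |a|) * (-ρ (p r)) * (‖v‖ + 1) := by gcongr
      _ = _ := by ring
  exact hmem key

end Geo
end LP
end

noncomputable section
open Set Filter Topology Metric MeasureTheory
open scoped ENNReal NNReal InnerProductSpace ComplexConjugate
namespace LP
open Polynomial

lemma runge {L : Set ℂ} (hc : IsCompact L)
    (hL : ∀ z ∉ L, ¬ Bornology.IsBounded (connectedComponentIn Lᶜ z))
    (a q : ℂ[X]) (hq : ∀ z ∈ L, q.eval z ≠ 0) {ε : ℝ} (he : 0 < ε) :
    ∃ p : ℂ[X], ∀ z ∈ L, ‖p.eval z - a.eval z / q.eval z‖ < ε := by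
  rcases L.eq_empty_or_nonempty with h0 | hne
  · exact ⟨0, by simp [h0]⟩
  haveI : CompactSpace L := isCompact_iff_compactSpace.1 hc
  haveI : Nonempty L := hne.to_subtype
  let X0 : C(L, ℂ) := ⟨fun z => z, continuous_subtype_val⟩
  let S : Subalgebra ℂ C(L, ℂ) := (Algebra.adjoin ℂ {X0}).topologicalClosure
  have hS : IsClosed (S : Set C(L, ℂ)) := Subalgebra.isClosed_topologicalClosure _
  haveI : CompleteSpace S := hS.completeSpace_coe
  have hX : X0 ∈ S := Subalgebra.le_topologicalClosure _ (Algebra.self_mem_adjoin_singleton ℂ X0)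
  let x : S := ⟨X0, hX⟩
  have hsp : spectrum ℂ x ⊆ L := by
    intro z hz
    by_contra hzL
    haveI : IsClosed (S : Set C(L, ℂ)) := hS
    have h1 := Subalgebra.spectrum_isBounded_connectedComponentIn S x hz
    have h2 : spectrum ℂ (x : C(L, ℂ)) = L := by
      rw [ContinuousMap.spectrum_eq_range]
      show range (fun z : L => (z : ℂ)) = L
      exact Subtype.range_coe
    rw [h2] at h1
    exact hL z hzL h1
  have hev : ∀ (r : ℂ[X]) (z : L), ((aeval x r : S) : C(L, ℂ)) z = r.eval (z : ℂ) := by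
    intro r z
    let ev : S →ₐ[ℂ] ℂ := (ContinuousMap.evalAlgHom ℂ ℂ z).comp S.val
    have h1 : ev (aeval x r) = aeval (ev x) r := (Polynomial.aeval_algHom_apply ev x r).symm
    have h2 : ev x = (z : ℂ) := rfl
    rw [h2] at h1
    have h3 : ((aeval x r : S) : C(L, ℂ)) z = ev (aeval x r) := rfl
    rw [h3, h1, Polynomial.coe_aeval_eq_eval]
  have hu : IsUnit (aeval x q) := by
    have h1 : (0:ℂ) ∉ spectrum ℂ (aeval x q) := by
      rw [spectrum.map_polynomial_aeval]
      rintro ⟨z, hz, h0⟩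
      exact hq z (hsp hz) h0
    exact (spectrum.zero_notMem_iff ℂ).1 h1
  obtain ⟨u, hu⟩ := hu
  let g : S := aeval x a * ((u⁻¹ : Sˣ) : S)
  have hg : ∀ z : L, (g : C(L, ℂ)) z = a.eval (z:ℂ) / q.eval (z:ℂ) := by
    intro z
    have h1 : g * aeval x q = aeval x a := by
      rw [← hu]; simp [g, mul_assoc]
    have h2 : (g : C(L, ℂ)) z * ((aeval x q : S) : C(L, ℂ)) z = ((aeval x a : S) : C(L, ℂ)) z := by
      rw [← h1]; rfl
    rw [hev, hev] at h2
    rw [eq_div_iff (hq z z.2), h2]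
  have hgm : (g : C(L, ℂ)) ∈ closure ((Algebra.adjoin ℂ {X0} : Subalgebra ℂ C(L, ℂ)) : Set C(L, ℂ)) := by
    have := g.2
    exact this
  obtain ⟨p', hp', hd⟩ := Metric.mem_closure_iff.1 hgm ε he
  rw [SetLike.mem_coe, Algebra.adjoin_singleton_eq_range_aeval] at hp'
  obtain ⟨p, rfl⟩ := hp'
  refine ⟨p, fun z hz => ?_⟩
  have h1 : dist ((g : C(L, ℂ)) ⟨z, hz⟩) ((aeval X0 p : C(L, ℂ)) ⟨z, hz⟩) < ε :=
    lt_of_le_of_lt (ContinuousMap.dist_apply_le_dist _) hd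
  have h2 : (aeval X0 p : C(L, ℂ)) ⟨z, hz⟩ = p.eval z := by
    let ev : C(L, ℂ) →ₐ[ℂ] ℂ := ContinuousMap.evalAlgHom ℂ ℂ ⟨z, hz⟩
    have h1 : ev (aeval X0 p) = aeval (ev X0) p := (Polynomial.aeval_algHom_apply ev X0 p).symm
    have h2 : ev X0 = z := rfl
    rw [h2] at h1
    have h3 : (aeval X0 p : C(L, ℂ)) ⟨z, hz⟩ = ev (aeval X0 p) := rfl
    rw [h3, h1, Polynomial.coe_aeval_eq_eval]
  rw [hg, h2, dist_comm, dist_eq_norm] at h1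
  exact h1



lemma ray_unbdd {L : Set ℂ} {z v : ℂ} (hv : v ≠ 0) (h : ∀ t : ℝ, 0 ≤ t → z + t * v ∉ L) :
    ¬ Bornology.IsBounded (connectedComponentIn Lᶜ z) := by
  intro hb
  have hpre : IsPreconnected ((fun t : ℝ => z + t * v) '' Ici 0) :=
    isPreconnected_Ici.image _ (by fun_prop)
  have hsub : (fun t : ℝ => z + t * v) '' Ici 0 ⊆ connectedComponentIn Lᶜ z := by
    apply hpre.subset_connectedComponentIn
    · exact ⟨0, by simp, by simp⟩
    · rintro _ ⟨t, ht, rfl⟩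
      exact h t ht
  obtain ⟨C, hC⟩ := (hb.subset hsub).exists_norm_le
  have hv' : 0 < ‖v‖ := norm_pos_iff.2 hv
  have hC0 : 0 ≤ C := (norm_nonneg _).trans (hC _ ⟨0, by simp, rfl⟩)
  have h1 := hC _ ⟨(C + ‖z‖ + 1) / ‖v‖, by simp only [mem_Ici]; positivity, rfl⟩
  have h2 : ‖(((C + ‖z‖ + 1) / ‖v‖ : ℝ) : ℂ) * v‖ = C + ‖z‖ + 1 := by
    rw [norm_mul, Complex.norm_real, Real.norm_of_nonneg (by positivity)]
    field_simp
  have h3 := norm_sub_norm_le ((((C + ‖z‖ + 1) / ‖v‖ : ℝ) : ℂ) * v) (-z)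
  rw [h2, norm_neg, sub_neg_eq_add, add_comm _ z] at h3
  simp only at h1
  linarith

lemma frac_small {A B : ℂ} {t : ℝ} (hA : A ≠ 0) (h : ‖B‖ ≤ t * ‖A‖) (ht : t ≤ 1/2) :
    A + B ≠ 0 ∧ ‖B / (A + B)‖ ≤ 2 * t := by
  have hA' : 0 < ‖A‖ := norm_pos_iff.2 hA
  have h1 : ‖A‖ / 2 ≤ ‖A + B‖ := by
    have := norm_sub_norm_le A (-B)
    rw [norm_neg, sub_neg_eq_add] at this
    nlinarith
  have h2 : A + B ≠ 0 := norm_pos_iff.1 (by linarith)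
  refine ⟨h2, ?_⟩
  rw [norm_div, div_le_iff₀ (norm_pos_iff.2 h2)]
  have : 0 ≤ t := by
    by_contra hh
    push Not at hh
    have := norm_nonneg B
    nlinarith
  nlinarith

lemma moeb_ratio {s : ℂ} {c M : ℝ} (hc : 0 < c) (hs : c ≤ s.re) (hM : ‖s‖ ≤ M) :
    ‖1 - s‖ ≤ Real.sqrt (1 - 4 * c / (1 + M)^2) * ‖1 + s‖ := by
  have hM0 : 0 ≤ M := (norm_nonneg _).trans hM
  have h1 : ‖1 - s‖^2 = ‖1 + s‖^2 - 4 * s.re := by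
    rw [Complex.sq_norm, Complex.sq_norm, Complex.normSq_apply, Complex.normSq_apply]
    simp; ring
  have h2 : ‖1 + s‖ ≤ 1 + M := (norm_add_le _ _).trans (by simpa using hM)
  have h3 : ‖1 - s‖^2 ≤ (1 - 4 * c / (1 + M)^2) * ‖1 + s‖^2 := by
    rw [h1]
    have : 4 * c / (1 + M)^2 * ‖1 + s‖^2 ≤ 4 * c := by
      rw [div_mul_eq_mul_div, div_le_iff₀ (by positivity)]
      gcongr
    linarith
  rw [← Real.sqrt_sq (norm_nonneg (1 - s))]
  have h4 := Real.sqrt_le_sqrt h3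
  rwa [Real.sqrt_mul' _ (sq_nonneg _), Real.sqrt_sq (norm_nonneg (1 + s))] at h4

lemma halfplane_poly {δ R ε : ℝ} (hd : 0 < δ) (hR : 0 < R) (he : 0 < ε) :
    ∃ p : ℂ[X], (∀ s : ℂ, ‖s‖ ≤ R → 0 ≤ s.re → ‖p.eval s - 1‖ < ε) ∧
      (∀ s : ℂ, ‖s‖ ≤ R → s.re ≤ -δ → ‖p.eval s‖ < ε) := by
  let c : ℝ := δ / 2
  have hc : 0 < c := by positivity
  let M : ℝ := R + c
  let θ : ℝ := Real.sqrt (1 - 4 * c / (1 + M)^2)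
  have hθ0 : 0 ≤ θ := Real.sqrt_nonneg _
  have hθ1 : θ < 1 := by
    rw [Real.sqrt_lt' one_pos]
    have : 0 < 4 * c / (1 + M)^2 := by positivity
    linarith
  obtain ⟨k, hk⟩ := exists_pow_lt_of_lt_one (show (0:ℝ) < min (1/2) (ε/4) by positivity) hθ1
  have hk1 : θ^k ≤ 1/2 := hk.le.trans (min_le_left _ _)
  have hk2 : θ^k < ε/4 := hk.trans_le (min_le_right _ _)
  let a : ℂ[X] := (1 + (X + C (c:ℂ)))^k
  let b : ℂ[X] := (1 - (X + C (c:ℂ)))^k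
  have ha : ∀ s : ℂ, a.eval s = (1 + (s + c))^k := by intro s; simp [a]
  have hb : ∀ s : ℂ, b.eval s = (1 - (s + c))^k := by intro s; simp [b]
  have hM' : ∀ s : ℂ, ‖s‖ ≤ R → ‖s + c‖ ≤ M := by
    intro s hs
    refine (norm_add_le _ _).trans ?_
    rw [Complex.norm_real, Real.norm_of_nonneg hc.le]
    simp only [M]; linarith
  have hpos : ∀ s : ℂ, ‖s‖ ≤ R → 0 ≤ s.re → a.eval s ≠ 0 ∧ ‖b.eval s‖ ≤ θ^k * ‖a.eval s‖ := by
    intro s hs hre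
    have h1 : c ≤ (s + c).re := by simp; linarith
    constructor
    · rw [ha]
      apply pow_ne_zero
      intro h
      have := congrArg Complex.re h
      simp at this
      linarith
    · rw [ha, hb, norm_pow, norm_pow, ← mul_pow]
      exact pow_le_pow_left₀ (norm_nonneg _) (moeb_ratio hc h1 (hM' s hs)) k
  have hneg : ∀ s : ℂ, ‖s‖ ≤ R → s.re ≤ -δ → b.eval s ≠ 0 ∧ ‖a.eval s‖ ≤ θ^k * ‖b.eval s‖ := by
    intro s hs hre
    have h1 : c ≤ (-(s + c)).re := by simp [c]; linarith
    constructor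
    · rw [hb]
      apply pow_ne_zero
      intro h
      have := congrArg Complex.re h
      simp [c] at this
      linarith
    · rw [ha, hb, norm_pow, norm_pow, ← mul_pow]
      have := moeb_ratio hc h1 (M := M) (by rw [norm_neg]; exact hM' s hs)
      rw [sub_neg_eq_add, ← sub_eq_add_neg] at this
      exact pow_le_pow_left₀ (norm_nonneg _) this k
  let L : Set ℂ := closedBall 0 R ∩ ({s | 0 ≤ s.re} ∪ {s | s.re ≤ -δ})
  have hLc : IsCompact L := (isCompact_closedBall 0 R).inter_right
    ((isClosed_le continuous_const Complex.continuous_re).union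
      (isClosed_le Complex.continuous_re continuous_const))
  have hL : ∀ z ∉ L, ¬ Bornology.IsBounded (connectedComponentIn Lᶜ z) := by
    intro z hz
    by_cases h : ‖z‖ ≤ R
    · have h2 : -δ < z.re ∧ z.re < 0 := by
        by_contra hh
        apply hz
        refine ⟨by simpa using h, ?_⟩
        rw [not_and_or] at hh
        rcases hh with hh | hh
        · right; exact not_lt.1 hh
        · left; exact not_lt.1 hh
      apply ray_unbdd (v := Complex.I) Complex.I_ne_zero
      rintro t ht ⟨-, h3 | h3⟩
      · simp at h3; linarith
      · simp at h3; linarith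
    · push Not at h
      have hz0 : z ≠ 0 := norm_pos_iff.1 (hR.trans h)
      apply ray_unbdd (v := z) hz0
      rintro t ht ⟨h3, -⟩
      rw [mem_closedBall_zero_iff, show z + t * z = ((1 + t : ℝ) : ℂ) * z by push_cast; ring, norm_mul,
        Complex.norm_real, Real.norm_of_nonneg (by linarith)] at h3
      nlinarith [norm_nonneg z]
  have hq : ∀ z ∈ L, (a + b).eval z ≠ 0 := by
    rintro z ⟨h1, h2 | h2⟩
    · rw [eval_add]
      obtain ⟨h3, h4⟩ := hpos z (by simpa using h1) h2
      exact (frac_small h3 h4 hk1).1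
    · rw [eval_add, add_comm]
      obtain ⟨h3, h4⟩ := hneg z (by simpa using h1) h2
      exact (frac_small h3 h4 hk1).1
  obtain ⟨p, hp⟩ := runge hLc hL a (a + b) hq (show 0 < ε / 2 by positivity)
  refine ⟨p, fun s hs hre => ?_, fun s hs hre => ?_⟩
  · have h1 := hp s ⟨by simpa using hs, Or.inl hre⟩
    obtain ⟨h3, h4⟩ := hpos s hs hre
    obtain ⟨h5, h6⟩ := frac_small h3 h4 hk1
    rw [eval_add] at h1
    have h7 : p.eval s - 1 = (p.eval s - a.eval s / (a.eval s + b.eval s)) - b.eval s / (a.eval s + b.eval s) := by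
      field_simp; ring
    rw [h7]
    have := norm_sub_le (p.eval s - a.eval s / (a.eval s + b.eval s)) (b.eval s / (a.eval s + b.eval s))
    linarith
  · have h1 := hp s ⟨by simpa using hs, Or.inr hre⟩
    obtain ⟨h3, h4⟩ := hneg s hs hre
    obtain ⟨h5, h6⟩ := frac_small h3 h4 hk1
    rw [eval_add, add_comm (a.eval s)] at h1
    have := norm_sub_norm_le (p.eval s) (a.eval s / (b.eval s + a.eval s))
    linarith

end LP
end

noncomputable section
open Set Filter Topology Metric MeasureTheory
open scoped ENNReal NNReal InnerProductSpace ComplexConjugate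
namespace LP
variable {N : ℕ} {D K : Set (EN N)} {m : Measure (EN N)}

/-- approximability of `f` by holomorphic functions small on `K`. -/
def App (D K : Set (EN N)) (m : Measure (EN N)) (f : EN N → ℂ) : Prop :=
  ∃ F : ℕ → EN N → ℂ, (∀ n, DifferentiableOn ℂ (F n) D) ∧
    (∀ ε : ℝ, 0 < ε → ∀ᶠ n in atTop, ∀ z ∈ K, ‖F n z‖ < ε) ∧
    ∀ᵐ z ∂m, Tendsto (fun n => F n z) atTop (𝓝 (f z))

lemma App.congr {f g : EN N → ℂ} (h : App D K m f) (hfg : ∀ᵐ z ∂m, f z = g z) : App D K m g := by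
  obtain ⟨F, h1, h2, h3⟩ := h
  refine ⟨F, h1, h2, ?_⟩
  filter_upwards [h3, hfg] with z hz hz'
  rwa [← hz']

lemma App.zero : App D K m (fun _ => 0) :=
  ⟨fun _ _ => 0, fun _ => differentiableOn_const 0, fun ε he => by simp [he], by simp⟩

lemma App.add {f g : EN N → ℂ} (hf : App D K m f) (hg : App D K m g) :
    App D K m (fun z => f z + g z) := by
  obtain ⟨F, h1, h2, h3⟩ := hf
  obtain ⟨G, k1, k2, k3⟩ := hg
  refine ⟨fun n z => F n z + G n z, fun n => (h1 n).fun_add (k1 n), fun ε he => ?_, ?_⟩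
  · filter_upwards [h2 (ε/2) (by positivity), k2 (ε/2) (by positivity)] with n ha hb z hz
    have := norm_add_le (F n z) (G n z)
    linarith [ha z hz, hb z hz]
  · filter_upwards [h3, k3] with z hz hz'
    exact hz.add hz'

lemma App.mul {f g : EN N → ℂ} (hf : App D K m f) (hg : App D K m g) :
    App D K m (fun z => f z * g z) := by
  obtain ⟨F, h1, h2, h3⟩ := hf
  obtain ⟨G, k1, k2, k3⟩ := hg
  refine ⟨fun n z => F n z * G n z, fun n => (h1 n).fun_mul (k1 n), fun ε he => ?_, ?_⟩
  · filter_upwards [h2 ε he, k2 1 one_pos] with n ha hb z hz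
    rw [norm_mul]
    nlinarith [ha z hz, hb z hz, norm_nonneg (F n z), norm_nonneg (G n z)]
  · filter_upwards [h3, k3] with z hz hz'
    exact hz.mul hz'

lemma App.smul {f : EN N → ℂ} (c : ℂ) (hf : App D K m f) :
    App D K m (fun z => c * f z) := by
  obtain ⟨F, h1, h2, h3⟩ := hf
  refine ⟨fun n z => c * F n z, fun n => (h1 n).const_mul c, fun ε he => ?_, ?_⟩
  · filter_upwards [h2 (ε/(‖c‖+1)) (by positivity)] with n ha z hz
    have := ha z hz
    rw [lt_div_iff₀ (by positivity)] at this
    rw [norm_mul]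
    nlinarith [norm_nonneg (F n z), norm_nonneg c]
  · filter_upwards [h3] with z hz
    exact hz.const_mul c

lemma aesm_of_hol (hD : IsOpen D) (hm : ∀ᵐ z ∂m, z ∈ D) {F : EN N → ℂ} (hF : DifferentiableOn ℂ F D) :
    AEStronglyMeasurable F m := by
  rw [← Measure.restrict_eq_self_of_ae_mem hm]
  exact hF.continuousOn.aestronglyMeasurable hD.measurableSet

lemma App.aesm (hD : IsOpen D) (hm : ∀ᵐ z ∂m, z ∈ D) {f : EN N → ℂ} (hf : App D K m f) :
    AEStronglyMeasurable f m := by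
  obtain ⟨F, h1, h2, h3⟩ := hf
  exact aestronglyMeasurable_of_tendsto_ae atTop (fun n => aesm_of_hol hD hm (h1 n)) h3

lemma App.inMeasure [IsFiniteMeasure m] (hD : IsOpen D) (hm : ∀ᵐ z ∂m, z ∈ D) {f : EN N → ℂ}
    (hf : App D K m f) {ε : ℝ} (he : 0 < ε) : ∃ F : EN N → ℂ, DifferentiableOn ℂ F D ∧
      (∀ z ∈ K, ‖F z‖ < ε) ∧ m {z | ε ≤ ‖F z - f z‖} < ENNReal.ofReal ε := by
  obtain ⟨F, h1, h2, h3⟩ := hf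
  have h4 := tendstoInMeasure_of_tendsto_ae (fun n => aesm_of_hol hD hm (h1 n)) h3
  rw [tendstoInMeasure_iff_norm] at h4
  have h5 := (h4 ε he).eventually_lt_const (ENNReal.ofReal_pos.2 he)
  obtain ⟨n, hn1, hn2⟩ := ((h2 ε he).and h5).exists
  exact ⟨F n, h1 n, hn1, hn2⟩

lemma App.limit [IsFiniteMeasure m] (hD : IsOpen D) (hm : ∀ᵐ z ∂m, z ∈ D) {f : ℕ → EN N → ℂ}
    {g : EN N → ℂ} (hf : ∀ n, App D K m (f n))
    (hg : ∀ᵐ z ∂m, Tendsto (fun n => f n z) atTop (𝓝 (g z))) : App D K m g := by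
  choose F h1 h2 h3 using fun n : ℕ =>
    (hf n).inMeasure hD hm (show (0:ℝ) < 1 / ((n:ℝ) + 1) by positivity)
  have hlim : Tendsto (fun n : ℕ => 1 / ((n:ℝ) + 1)) atTop (𝓝 0) := tendsto_one_div_add_atTop_nhds_zero_nat
  have h4 : TendstoInMeasure m (fun n z => F n z - f n z) atTop (fun _ => (0:ℂ)) := by
    rw [tendstoInMeasure_iff_norm]
    intro ε he
    have hl2 : Tendsto (fun n : ℕ => ENNReal.ofReal (1 / ((n:ℝ) + 1))) atTop (𝓝 0) := by
      have := ENNReal.tendsto_ofReal hlim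
      rwa [ENNReal.ofReal_zero] at this
    refine tendsto_of_tendsto_of_tendsto_of_le_of_le' tendsto_const_nhds hl2 (by simp) ?_
    filter_upwards [hlim.eventually_lt_const he] with n hn
    refine (measure_mono ?_).trans (h3 n).le
    intro z hz
    simp only [mem_ofPred_eq, sub_zero] at hz ⊢
    linarith
  obtain ⟨φ, hφ, h5⟩ := h4.exists_seq_tendsto_ae
  refine ⟨fun n => F (φ n), fun n => h1 _, fun ε he => ?_, ?_⟩
  · filter_upwards [(hlim.comp hφ.tendsto_atTop).eventually_lt_const he] with n hn z hz
    exact (h2 (φ n) z hz).trans hn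
  · filter_upwards [h5, hg] with z hz hz'
    have := hz.add (hz'.comp hφ.tendsto_atTop)
    simpa using this

/-- sets whose indicator is approximable -/
def AppS (D K : Set (EN N)) (m : Measure (EN N)) (B : Set (EN N)) : Prop :=
  App D K m (B.indicator (fun _ => (1:ℂ)))

lemma AppS.empty : AppS D K m ∅ := by
  unfold AppS; simpa using App.zero

lemma AppS.inter {A B : Set (EN N)} (hA : AppS D K m A) (hB : AppS D K m B) : AppS D K m (A ∩ B) := by
  refine (App.mul hA hB).congr (ae_of_all _ fun z => ?_)
  by_cases h1 : z ∈ A <;> by_cases h2 : z ∈ B <;> simp [h1, h2]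

lemma AppS.diff {A B : Set (EN N)} (hA : AppS D K m A) (hB : AppS D K m B) : AppS D K m (A \ B) := by
  refine (App.add hA (App.smul (-1) (App.mul hA hB))).congr (ae_of_all _ fun z => ?_)
  by_cases h1 : z ∈ A <;> by_cases h2 : z ∈ B <;> simp [h1, h2]

lemma AppS.union {A B : Set (EN N)} (hA : AppS D K m A) (hB : AppS D K m B) : AppS D K m (A ∪ B) := by
  refine (App.add (App.add hA hB) (App.smul (-1) (App.mul hA hB))).congr (ae_of_all _ fun z => ?_)
  by_cases h1 : z ∈ A <;> by_cases h2 : z ∈ B <;> simp [h1, h2]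

lemma AppS.iUnion_nat [IsFiniteMeasure m] (hD : IsOpen D) (hm : ∀ᵐ z ∂m, z ∈ D) {A : ℕ → Set (EN N)}
    (hA : ∀ n, AppS D K m (A n)) : AppS D K m (⋃ n, A n) := by
  have h1 : ∀ n, AppS D K m (Set.accumulate A n) := by
    intro n
    induction n with
    | zero => simpa [Set.accumulate] using hA 0
    | succ n ih => rw [Set.accumulate_succ]; exact ih.union (hA _)
  refine App.limit hD hm h1 (ae_of_all _ fun z => ?_)
  by_cases hz : z ∈ ⋃ n, A n
  · obtain ⟨n, hn⟩ := mem_iUnion.1 hz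
    rw [indicator_of_mem hz]
    refine tendsto_const_nhds.congr' ?_
    filter_upwards [eventually_ge_atTop n] with k hk
    rw [indicator_of_mem]
    exact mem_iUnion₂.2 ⟨n, hk, hn⟩
  · rw [indicator_of_notMem hz]
    refine tendsto_const_nhds.congr fun k => ?_
    rw [indicator_of_notMem]
    intro h
    obtain ⟨i, -, hi⟩ := mem_iUnion₂.1 h
    exact hz (mem_iUnion.2 ⟨i, hi⟩)

lemma AppS.iUnion [IsFiniteMeasure m] (hD : IsOpen D) (hm : ∀ᵐ z ∂m, z ∈ D) {ι : Type*} [Countable ι]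
    {A : ι → Set (EN N)} (hA : ∀ n, AppS D K m (A n)) : AppS D K m (⋃ n, A n) := by
  rcases isEmpty_or_nonempty ι with h | h
  · simpa using AppS.empty
  · obtain ⟨e, he⟩ := exists_surjective_nat ι
    rw [← he.iUnion_comp]
    exact AppS.iUnion_nat hD hm fun n => hA _

lemma AppS.re_ge {Φ : EN N → ℂ} (hΦ : DifferentiableOn ℂ Φ D) {δ R : ℝ} (hd : 0 < δ)
    (h1 : ∀ z ∈ K, (Φ z).re ≤ -δ) (h2 : ∀ z ∈ K, ‖Φ z‖ ≤ R) : AppS D K m {z | 0 ≤ (Φ z).re} := by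
  have hpn : ∀ n : ℕ, (0:ℝ) < 1 / ((n:ℝ) + 1) := fun n => by positivity
  choose p hp1 hp2 using fun n : ℕ => halfplane_poly (hpn n) (show (0:ℝ) < (n:ℝ) + 1 by positivity) (hpn n)
  have hlim : Tendsto (fun n : ℕ => 1 / ((n:ℝ) + 1)) atTop (𝓝 0) := tendsto_one_div_add_atTop_nhds_zero_nat
  have hR : ∀ R : ℝ, ∀ᶠ n : ℕ in atTop, R ≤ (n:ℝ) + 1 := fun R =>
    (tendsto_atTop_add_const_right _ 1 tendsto_natCast_atTop_atTop).eventually_ge_atTop R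
  refine ⟨fun n z => (p n).eval (Φ z), fun n => ?_, fun ε he => ?_, ae_of_all _ fun z => ?_⟩
  · exact (p n).differentiable.comp_differentiableOn hΦ
  · filter_upwards [hR R, hlim.eventually_lt_const hd, hlim.eventually_lt_const he] with n a b c z hz
    exact (hp2 n _ ((h2 z hz).trans a) (by linarith [h1 z hz])).trans c
  · by_cases hz : 0 ≤ (Φ z).re
    · rw [indicator_of_mem (show z ∈ {z | 0 ≤ (Φ z).re} from hz), tendsto_iff_norm_sub_tendsto_zero]
      refine squeeze_zero' (Eventually.of_forall fun n => norm_nonneg _) ?_ hlim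
      filter_upwards [hR ‖Φ z‖] with n a
      exact (hp1 n _ a hz).le
    · rw [indicator_of_notMem (show z ∉ {z | 0 ≤ (Φ z).re} from hz), tendsto_zero_iff_norm_tendsto_zero]
      refine squeeze_zero' (Eventually.of_forall fun n => norm_nonneg _) ?_ hlim
      push Not at hz
      filter_upwards [hR ‖Φ z‖, hlim.eventually_lt_const (show 0 < -(Φ z).re by linarith)] with n a b
      exact (hp2 n _ a (by linarith)).le

lemma exists_rat_rot {w : ℂ} (hw : 1 < ‖w‖) :
    ∃ (θ : ℚ) (n : ℕ), 1 + 1 / ((n:ℝ) + 1) ≤ (Complex.exp (((θ:ℝ):ℂ) * Complex.I) * w).re := by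
  have h0 : (Complex.exp (((-Complex.arg w : ℝ):ℂ) * Complex.I) * w).re = ‖w‖ := by
    conv_lhs => rw [← Complex.norm_mul_exp_arg_mul_I w]
    rw [mul_left_comm, ← Complex.exp_add]
    push_cast
    simp
  have hcont : Continuous fun θ : ℝ => (Complex.exp ((θ:ℂ) * Complex.I) * w).re := by fun_prop
  have hopen : IsOpen {θ : ℝ | 1 < (Complex.exp ((θ:ℂ) * Complex.I) * w).re} :=
    isOpen_lt continuous_const hcont
  obtain ⟨θ, hθ⟩ := (Rat.denseRange_cast (𝕜 := ℝ)).exists_mem_open hopen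
    ⟨-Complex.arg w, by rw [mem_ofPred_eq, h0]; exact hw⟩
  have hθ' : 1 < (Complex.exp (((θ:ℝ):ℂ) * Complex.I) * w).re := hθ
  obtain ⟨n, hn⟩ := exists_nat_one_div_lt (sub_pos.2 hθ')
  exact ⟨θ, n, by linarith⟩

lemma AppS.norm_gt [IsFiniteMeasure m] (hD : IsOpen D) (hm : ∀ᵐ z ∂m, z ∈ D) {G : EN N → ℂ}
    (hG : DifferentiableOn ℂ G D) {c : ℝ} (hc : c < 1) (h1 : ∀ z ∈ K, ‖G z‖ ≤ c) :
    AppS D K m {z | 1 < ‖G z‖} := by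
  have key : {z | 1 < ‖G z‖} = ⋃ q : ℚ × ℕ,
      {z | 0 ≤ (Complex.exp (((q.1:ℝ):ℂ) * Complex.I) * G z - ((1 + 1 / ((q.2:ℝ) + 1) : ℝ) : ℂ)).re} := by
    ext z
    simp only [mem_iUnion]
    constructor
    · intro hz
      obtain ⟨θ, n, h⟩ := exists_rat_rot hz
      refine ⟨(θ, n), ?_⟩
      rw [mem_ofPred_eq, Complex.sub_re, Complex.ofReal_re]
      linarith
    · rintro ⟨⟨θ, n⟩, h⟩
      have h : 0 ≤ (Complex.exp (((θ:ℝ):ℂ) * Complex.I) * G z - ((1 + 1 / ((n:ℝ) + 1) : ℝ) : ℂ)).re := h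
      rw [Complex.sub_re, Complex.ofReal_re] at h
      have h2 := Complex.re_le_norm (Complex.exp (((θ:ℝ):ℂ) * Complex.I) * G z)
      rw [norm_mul, Complex.norm_exp_ofReal_mul_I, one_mul] at h2
      have : (0:ℝ) < 1 / ((n:ℝ) + 1) := by positivity
      rw [mem_ofPred_eq]
      linarith
  rw [key]
  refine AppS.iUnion hD hm fun ⟨θ, n⟩ => ?_
  have hn : (0:ℝ) < 1 / ((n:ℝ) + 1) := by positivity
  refine AppS.re_ge (δ := 1 - c) (R := c + (1 + 1 / ((n:ℝ) + 1))) ((hG.const_mul _).sub_const _) (by linarith) (fun z hz => ?_) fun z hz => ?_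
  · rw [Complex.sub_re, Complex.ofReal_re]
    have h2 := Complex.re_le_norm (Complex.exp (((θ:ℝ):ℂ) * Complex.I) * G z)
    rw [norm_mul, Complex.norm_exp_ofReal_mul_I, one_mul] at h2
    simp only
    linarith [h1 z hz]
  · refine (norm_sub_le _ _).trans ?_
    rw [norm_mul, Complex.norm_exp_ofReal_mul_I, one_mul, Complex.norm_real, Real.norm_of_nonneg (by positivity)]
    simp only
    linarith [h1 z hz]

lemma AppS.re_gt [IsFiniteMeasure m] (hD : IsOpen D) (hm : ∀ᵐ z ∂m, z ∈ D) {G H : EN N → ℂ}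
    (hG : DifferentiableOn ℂ G D) {c : ℝ} (hc : c < 1) (h1 : ∀ z ∈ K, ‖G z‖ ≤ c)
    (hH : DifferentiableOn ℂ H D) {R : ℝ} (h2 : ∀ z ∈ K, ‖H z‖ ≤ R) (α : ℝ) :
    AppS D K m ({z | 1 < ‖G z‖} ∩ {z | α < (H z).re}) := by
  wlog hc0 : 0 ≤ c generalizing c
  · exact this (c := 0) one_pos (fun z hz => by linarith [h1 z hz]) le_rfl
  obtain ⟨κ, hκ⟩ : ∃ κ : ℕ, c ^ (κ+1) * Real.exp (R - α) < 1 := by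
    obtain ⟨k, hk⟩ := exists_pow_lt_of_lt_one (Real.exp_pos (-(R - α))) hc
    refine ⟨k, ?_⟩
    have : c^(k+1) < Real.exp (-(R-α)) := lt_of_le_of_lt (by rw [pow_succ]; nlinarith [pow_nonneg hc0 k]) hk
    calc _ < Real.exp (-(R-α)) * Real.exp (R - α) := by gcongr
      _ = 1 := by rw [← Real.exp_add]; simp
  have key : {z | 1 < ‖G z‖} ∩ {z | α < (H z).re} = ⋃ q : {q : ℚ // α ≤ q},
      (({z | 1 < ‖G z‖} ∩ {z | 1 < ‖(G z)^(κ+1) * Complex.exp (H z - ((q.1 : ℝ) : ℂ))‖}) \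
        {z | 1 < ‖(G z)^(κ+1) * Complex.exp (-((((q.1 : ℝ) - α : ℝ)) : ℂ))‖}) := by
    ext z
    have e1 : ∀ q : ℝ, 1 < ‖G z‖ → (1 < ‖(G z)^(κ+1) * Complex.exp (H z - (q : ℂ))‖ ↔
        q < (H z).re + (κ+1) * Real.log ‖G z‖) := by
      intro q hz
      have hz0 : 0 < ‖G z‖ := by linarith
      rw [norm_mul, Complex.norm_exp, norm_pow, Complex.sub_re, Complex.ofReal_re]
      have : ‖G z‖^(κ+1) = Real.exp ((κ+1) * Real.log ‖G z‖) := by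
        rw [← Real.exp_log (pow_pos hz0 (κ+1)), Real.log_pow]; push_cast; rfl
      rw [this, ← Real.exp_add, Real.one_lt_exp_iff]
      constructor <;> intro h <;> linarith
    have e2 : ∀ q : ℝ, 1 < ‖G z‖ → (1 < ‖(G z)^(κ+1) * Complex.exp (-(((q - α : ℝ)) : ℂ))‖ ↔
        q - α < (κ+1) * Real.log ‖G z‖) := by
      intro q hz
      have hz0 : 0 < ‖G z‖ := by linarith
      rw [norm_mul, Complex.norm_exp, norm_pow, Complex.neg_re, Complex.ofReal_re]
      have : ‖G z‖^(κ+1) = Real.exp ((κ+1) * Real.log ‖G z‖) := by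
        rw [← Real.exp_log (pow_pos hz0 (κ+1)), Real.log_pow]; push_cast; rfl
      rw [this, ← Real.exp_add, Real.one_lt_exp_iff]
      constructor <;> intro h <;> linarith
    simp only [mem_iUnion]
    constructor
    · rintro ⟨hz, hz2⟩
      have hz : 1 < ‖G z‖ := hz
      have hz2 : α < (H z).re := hz2
      have hl : 0 < Real.log ‖G z‖ := Real.log_pos hz
      obtain ⟨q, hq1, hq2⟩ := exists_rat_btwn (show α + (κ+1) * Real.log ‖G z‖ < (H z).re + (κ+1) * Real.log ‖G z‖ by linarith)
      have hl2 : 0 < (κ+1) * Real.log ‖G z‖ := by positivity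
      refine ⟨⟨q, by linarith⟩, ⟨hz, (e1 q hz).2 hq2⟩, fun h => ?_⟩
      have := (e2 q hz).1 h
      linarith
    · rintro ⟨⟨q, hq⟩, ⟨hz, hz2⟩, hz3⟩
      have hz : 1 < ‖G z‖ := hz
      have h3 := (e1 q hz).1 hz2
      have h4 := mt (e2 q hz).2 hz3
      refine ⟨hz, ?_⟩
      show α < (H z).re
      linarith
  rw [key]
  refine AppS.iUnion hD hm fun ⟨q, hq⟩ => AppS.diff (AppS.inter (AppS.norm_gt hD hm hG hc h1) ?_) ?_
  · refine AppS.norm_gt hD hm ((hG.fun_pow _).fun_mul (hH.sub_const _).cexp) hκ fun z hz => ?_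
    rw [norm_mul, Complex.norm_exp, norm_pow, Complex.sub_re, Complex.ofReal_re]
    have := (Complex.re_le_norm (H z)).trans (h2 z hz)
    gcongr
    · exact h1 z hz
  · refine AppS.norm_gt (c := c) hD hm ((hG.fun_pow _).mul_const _) hc fun z hz => ?_
    rw [norm_mul, Complex.norm_exp, norm_pow, Complex.neg_re, Complex.ofReal_re]
    have e1 : Real.exp (-((q:ℝ) - α)) ≤ 1 := Real.exp_le_one_iff.2 (by linarith)
    have e2 : ‖G z‖^(κ+1) ≤ c^(κ+1) := pow_le_pow_left₀ (norm_nonneg _) (h1 z hz) _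
    have e3 : c^(κ+1) ≤ c := by
      rw [pow_succ]
      have := pow_le_one₀ (n := κ) hc0 hc.le
      nlinarith
    calc _ ≤ c^(κ+1) * 1 := by gcongr
      _ ≤ c := by linarith

end LP
end

noncomputable section
open Set Filter Topology Metric MeasureTheory
open scoped ENNReal NNReal InnerProductSpace ComplexConjugate
namespace LP
variable {N : ℕ} {D K : Set (EN N)} {m : Measure (EN N)}

lemma toLp_meas : Measurable (α := Fin N → ℂ) (β := EN N) (fun v => WithLp.toLp 2 v) := by
  have hto : Continuous (X := Fin N → ℂ) (Y := EN N) (fun v => WithLp.toLp 2 v) :=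
    PiLp.continuous_toLp 2 (fun _ : Fin N => ℂ)
  exact Continuous.measurable (γ := EN N) hto

lemma AppS.borel [IsFiniteMeasure m] (hD : IsOpen D) (hm : ∀ᵐ z ∂m, z ∈ D) (hKD : K ⊆ D)
    (hK : IsCompact K) {G : EN N → ℂ}
    (hG : DifferentiableOn ℂ G D) {c : ℝ} (hc : c < 1) (h1 : ∀ z ∈ K, ‖G z‖ ≤ c)
    {B : Set (EN N)} (hB : MeasurableSet B) : AppS D K m ({z | 1 < ‖G z‖} ∩ B) := by
  set U : Set (EN N) := {z | 1 < ‖G z‖} with hU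
  let M : MeasurableSpace (EN N) :=
    { MeasurableSet' := fun B => AppS D K m (U ∩ B)
      measurableSet_empty := by simpa using AppS.empty
      measurableSet_compl := fun B hB => by
        have := (AppS.norm_gt hD hm hG hc h1).diff hB
        rwa [← hU, sdiff_self_inter, sdiff_eq] at this
      measurableSet_iUnion := fun f hf => by
        rw [inter_iUnion]
        exact AppS.iUnion hD hm hf }
  have hre : ∀ H : EN N → ℂ, Differentiable ℂ H → Measurable[M] (fun z => (H z).re) := by
    intro H hH
    refine measurable_of_Ioi (mδ := M) fun α => ?_
    obtain ⟨R, hR⟩ := (hK.image hH.continuous).isBounded.exists_norm_le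
    exact AppS.re_gt hD hm hG hc h1 hH.differentiableOn (fun z hz => hR _ (mem_image_of_mem _ hz)) α
  have hid : @Measurable _ _ M _ (fun z : EN N => (WithLp.ofLp z : Fin N → ℂ)) := by
    refine @measurable_pi_lambda _ _ _ M _ _ fun j => ?_
    refine @measurable_of_re_im _ ℂ _ M _ ?_ ?_
    · exact hre (fun z => z j) (by fun_prop)
    · have := hre (fun z => -Complex.I * z j) (by fun_prop)
      simpa using this
  exact hid (toLp_meas hB)

/-- points peaked away from K -/
def ZSet (D K : Set (EN N)) : Set (EN N) :=
  {z | z ∈ D ∧ ∃ G : EN N → ℂ, DifferentiableOn ℂ G D ∧ ∃ c : ℝ, c < 1 ∧ (∀ w ∈ K, ‖G w‖ ≤ c) ∧ 1 < ‖G z‖}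

lemma App.measurable [IsFiniteMeasure m] (hD : IsOpen D) (hm : ∀ᵐ z ∂m, z ∈ ZSet D K) (hKD : K ⊆ D)
    (hK : IsCompact K) {h : EN N → ℂ} (hh : Measurable h) : App D K m h := by
  have hmD : ∀ᵐ z ∂m, z ∈ D := hm.mono fun z hz => hz.1
  have hB : ∀ B : Set (EN N), MeasurableSet B → AppS D K m B := by
    intro B hB
    let ι := {G : EN N → ℂ // DifferentiableOn ℂ G D ∧ ∃ c : ℝ, c < 1 ∧ (∀ w ∈ K, ‖G w‖ ≤ c)}
    obtain ⟨T, hT, hTe⟩ := TopologicalSpace.isOpen_iUnion_countable (fun G : ι => D ∩ {z | 1 < ‖G.1 z‖})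
      (fun G => G.2.1.continuousOn.norm.isOpen_inter_preimage hD isOpen_Ioi)
    haveI := hT.to_subtype
    have h1 : AppS D K m (⋃ G : T, {z | 1 < ‖G.1.1 z‖} ∩ B) := AppS.iUnion hD hmD fun G => by
      obtain ⟨hG, c, hc, hGK⟩ := G.1.2
      exact AppS.borel hD hmD hKD hK hG hc hGK hB
    refine h1.congr ?_
    filter_upwards [hm] with z hz
    have : z ∈ (⋃ G : T, {z | 1 < ‖G.1.1 z‖} ∩ B) ↔ z ∈ B := by
      rw [← iUnion_inter]
      refine ⟨fun h => h.2, fun h => ⟨?_, h⟩⟩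
      obtain ⟨hzD, G, hG, c, hc, hGK, hz1⟩ := hz
      have hmem : z ∈ ⋃ G : ι, D ∩ {z | 1 < ‖G.1 z‖} :=
        mem_iUnion.2 ⟨⟨G, hG, c, hc, hGK⟩, hzD, hz1⟩
      rw [← hTe] at hmem
      obtain ⟨G', hG', h3⟩ := mem_iUnion₂.1 hmem
      exact mem_iUnion.2 ⟨⟨G', hG'⟩, h3.2⟩
    by_cases h2 : z ∈ B
    · rw [indicator_of_mem h2, indicator_of_mem (this.2 h2)]
    · rw [indicator_of_notMem h2, indicator_of_notMem (mt this.1 h2)]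
  have hs : ∀ s : SimpleFunc (EN N) ℂ, App D K m s := by
    intro s
    induction s using SimpleFunc.induction with
    | const c hs =>
      refine (App.smul c (hB _ hs)).congr (ae_of_all _ fun z => ?_)
      simp [SimpleFunc.coe_piecewise, Set.piecewise, indicator]
    | add hd hf hg => exact hf.add hg
  have hsm := hh.stronglyMeasurable
  exact App.limit hD hmD (fun n => hs (hsm.approx n)) (ae_of_all _ fun z => hsm.tendsto_approx z)

end LP
end

noncomputable section
open Set Filter Topology Metric MeasureTheory
open scoped ENNReal NNReal InnerProductSpace ComplexConjugate
namespace LP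
variable {N : ℕ} {D K V : Set (EN N)} {ρ : EN N → ℝ} {μ : Measure (EN N)}

lemma ZSet_open (hD : IsOpen D) : IsOpen (ZSet D K) := by
  rw [isOpen_iff_mem_nhds]
  rintro z ⟨hz, G, hG, c, hc, hK, hz1⟩
  have h1 : IsOpen (D ∩ {z | 1 < ‖G z‖}) := hG.continuousOn.norm.isOpen_inter_preimage hD isOpen_Ioi
  filter_upwards [h1.mem_nhds ⟨hz, hz1⟩] with w hw
  exact ⟨hw.1, G, hG, c, hc, hK, hw.2⟩

lemma eventually_ZSet (G : Geo D ρ V) (hK : IsCompact K) (hKD : K ⊆ D) {x : EN N} (hx : x ∈ frontier D)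
    {p : ℝ → EN N} {v : EN N} (hp : HasDerivWithinAt p v (Icc 0 1) 1) (hp1 : p 1 = x)
    (hpD : ∀ r ∈ Ico (0:ℝ) 1, p r ∈ D) (hv : fderiv ℝ ρ x v ≠ 0) {r : ℕ → ℝ}
    (hr : ∀ j, r j ∈ Ioo (0:ℝ) 1) (hr1 : Tendsto r atTop (𝓝 1)) :
    ∀ᶠ j in atTop, p (r j) ∈ ZSet D K := by
  obtain ⟨F, hF, hlim⟩ := G.blowup_path hx hp hp1 hpD hv
  obtain ⟨R0, hR0⟩ := (hK.image_of_continuousOn (hF.continuousOn.mono hKD)).isBounded.exists_norm_le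
  let R := max R0 0
  have hR : 0 ≤ R := le_max_right _ _
  have hRK : ∀ z ∈ K, ‖F z‖ ≤ R := fun z hz => (hR0 _ (mem_image_of_mem _ hz)).trans (le_max_left _ _)
  have hr2 : Tendsto r atTop (𝓝[<] 1) :=
    tendsto_nhdsWithin_iff.2 ⟨hr1, Eventually.of_forall fun j => (hr j).2⟩
  filter_upwards [(hlim.comp hr2).eventually_gt_atTop (R+1)] with j hj
  have hj : R + 1 < ‖F (p (r j))‖ := hj
  refine ⟨hpD _ ⟨(hr j).1.le, (hr j).2⟩, fun z => ((R + 1 : ℝ) : ℂ)⁻¹ * F z, hF.const_mul _, (R+1)⁻¹ * R, ?_, fun w hw => ?_, ?_⟩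
  · rw [inv_mul_eq_div, div_lt_one (by linarith)]; linarith
  · rw [norm_mul, norm_inv, Complex.norm_real, Real.norm_of_nonneg (by linarith)]
    have := hRK w hw
    gcongr
  · rw [norm_mul, norm_inv, Complex.norm_real, Real.norm_of_nonneg (by linarith), inv_mul_eq_div,
      one_lt_div (by linarith)]
    exact hj

lemma density_step [IsFiniteMeasure μ] (hD : IsOpen D) (hK : IsCompact K) (hKD : K ⊆ D)
    (hμ : ∀ᵐ x ∂μ, x ∈ frontier D) {Γ : ℕ → EN N → EN N} (hΓm : ∀ j, AEMeasurable (Γ j) μ)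
    (hΓD : ∀ x ∈ frontier D, ∀ j, Γ j x ∈ D)
    (hΓ1 : ∀ x ∈ frontier D, Tendsto (fun j => Γ j x) atTop (𝓝 x))
    (hΓZ : ∀ x ∈ frontier D, ∀ᶠ j in atTop, Γ j x ∈ ZSet D K)
    {g : EN N → ℂ} (hg : DifferentiableOn ℂ g D) {h : EN N → ℂ} (hh : Continuous h)
    {η : ℝ} (hη : 0 < η) (n : ℕ) :
    ∃ j ≥ n, ∃ F : EN N → ℂ, DifferentiableOn ℂ F D ∧ (∀ z ∈ K, ‖F z - g z‖ < η) ∧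
      μ {x | η ≤ ‖F (Γ j x) - h x‖} < ENNReal.ofReal η := by
  have hη3 : 0 < η / 3 := by positivity
  have hofr : 0 < ENNReal.ofReal (η/3) := ENNReal.ofReal_pos.2 hη3
  have hZm : MeasurableSet (ZSet D K) := (ZSet_open hD).measurableSet
  have t1 : TendstoInMeasure μ (fun j x => ((ZSet D K)ᶜ.indicator (fun _ => (1:ℝ))) (Γ j x)) atTop (fun _ => (0:ℝ)) := by
    refine tendstoInMeasure_of_tendsto_ae (fun j => ?_) ?_
    · exact ((measurable_const.indicator hZm.compl).comp_aemeasurable (hΓm j)).aestronglyMeasurable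
    · filter_upwards [hμ] with x hx
      refine tendsto_const_nhds.congr' ?_
      filter_upwards [hΓZ x hx] with j hj
      rw [indicator_of_notMem (by simpa using hj)]
  have t2 : TendstoInMeasure μ (fun j x => h (Γ j x)) atTop h := by
    refine tendstoInMeasure_of_tendsto_ae (fun j => ?_) ?_
    · exact (hh.measurable.comp_aemeasurable (hΓm j)).aestronglyMeasurable
    · filter_upwards [hμ] with x hx
      exact (hh.tendsto x).comp (hΓ1 x hx)
  rw [tendstoInMeasure_iff_norm] at t1 t2
  obtain ⟨j, hj1, hj2, hj3⟩ := (((t1 1 one_pos).eventually_lt_const hofr).and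
    (((t2 (η/3) hη3).eventually_lt_const hofr).and (eventually_ge_atTop n))).exists
  refine ⟨j, hj3, ?_⟩
  let m : Measure (EN N) := (μ.map (Γ j)).restrict (ZSet D K)
  have hmf : IsFiniteMeasure m := inferInstance
  have hmZ : ∀ᵐ z ∂m, z ∈ ZSet D K := ae_restrict_mem hZm
  let f : EN N → ℂ := D.indicator (fun z => h z - g z)
  have hf : Measurable f := by
    classical
    have : f = D.piecewise (fun z => h z - g z) 0 := by
      ext z; by_cases hz : z ∈ D <;> simp [f, hz]
    rw [this]
    exact (hh.continuousOn.sub hg.continuousOn).measurable_piecewise continuousOn_const hD.measurableSet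
  obtain ⟨F0, h1, h2, h3⟩ := (App.measurable hD hmZ hKD hK hf).inMeasure hD (hmZ.mono fun z hz => hz.1) hη3
  refine ⟨fun z => g z + F0 z, hg.fun_add h1, fun z hz => ?_, ?_⟩
  · simp only [add_sub_cancel_left]; linarith [h2 z hz]
  · have hsub : {x | η ≤ ‖(g (Γ j x) + F0 (Γ j x)) - h x‖} ⊆
        {x | (1:ℝ) ≤ ‖((ZSet D K)ᶜ.indicator (fun _ => (1:ℝ))) (Γ j x) - 0‖} ∪
        ({x | η / 3 ≤ ‖h (Γ j x) - h x‖} ∪ Γ j ⁻¹' ({z | η/3 ≤ ‖F0 z - f z‖} ∩ ZSet D K)) := by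
      intro x hx
      rw [mem_ofPred_eq] at hx
      by_cases hz : Γ j x ∈ ZSet D K
      · right
        by_contra hcon
        rw [mem_union, not_or] at hcon
        obtain ⟨c1, c2⟩ := hcon
        rw [mem_ofPred_eq, not_le] at c1
        have c2 : ‖F0 (Γ j x) - f (Γ j x)‖ < η/3 := by
          by_contra hc
          exact c2 ⟨not_lt.1 hc, hz⟩
        have hfe : f (Γ j x) = h (Γ j x) - g (Γ j x) := indicator_of_mem hz.1 _
        rw [hfe] at c2
        have e : (g (Γ j x) + F0 (Γ j x)) - h x = (F0 (Γ j x) - (h (Γ j x) - g (Γ j x))) + (h (Γ j x) - h x) := by ring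
        rw [e] at hx
        have := norm_add_le (F0 (Γ j x) - (h (Γ j x) - g (Γ j x))) (h (Γ j x) - h x)
        linarith
      · left
        rw [mem_ofPred_eq, indicator_of_mem (by simpa using hz)]
        simp
    have h4 : μ (Γ j ⁻¹' ({z | η/3 ≤ ‖F0 z - f z‖} ∩ ZSet D K)) < ENNReal.ofReal (η/3) :=
      lt_of_le_of_lt ((Measure.le_map_apply (hΓm j) _).trans (Measure.le_restrict_apply _ _)) h3
    calc _ ≤ _ := measure_mono hsub
      _ ≤ _ := (measure_union_le _ _).trans (add_le_add le_rfl (measure_union_le _ _))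
      _ < ENNReal.ofReal (η/3) + (ENNReal.ofReal (η/3) + ENNReal.ofReal (η/3)) :=
        ENNReal.add_lt_add hj1 (ENNReal.add_lt_add hj2 h4)
      _ = ENNReal.ofReal η := by
        rw [← ENNReal.ofReal_add hη3.le hη3.le, ← ENNReal.ofReal_add hη3.le (by linarith)]
        congr 1; ring

end LP
end

noncomputable section
open Set Filter Topology Metric MeasureTheory
open scoped ENNReal NNReal InnerProductSpace ComplexConjugate
namespace LP
variable {N : ℕ} {D K V : Set (EN N)} {ρ : EN N → ℝ} {μ : Measure (EN N)}

lemma Geo.surf_local (G : Geo D ρ V) {p : EN N} (hp : p ∈ frontier D) :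
    ∃ δ > 0, (Measure.hausdorffMeasure (2 * (N:ℝ) - 1) : Measure (EN N)) (frontier D ∩ ball p δ) < ∞ := by
  have hL : fderiv ℝ ρ p ≠ 0 := G.df.2.2.2.2 p hp
  set L : EN N →L[ℝ] ℝ := fderiv ℝ ρ p with hLdef
  have hpV : p ∈ V := G.df.2.1 (frontier_subset_closure hp)
  have hst : HasStrictFDerivAt ρ L p :=
    (G.df.2.2.1.contDiffAt (G.df.1.mem_nhds hpV)).hasStrictFDerivAt (by norm_num)
  obtain ⟨w0, hw0⟩ : ∃ w0, L w0 ≠ 0 := by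
    by_contra h
    push Not at h
    exact hL (ContinuousLinearMap.ext h)
  let w : EN N := (L w0)⁻¹ • w0
  have hw : L w = 1 := by simp [w, hw0]
  let F : Submodule ℝ (EN N) := LinearMap.ker (L : EN N →ₗ[ℝ] ℝ)
  have hfin : (Module.finrank ℝ F : ℝ) = 2 * (N:ℝ) - 1 := by
    have h1 := Module.Dual.finrank_ker_add_one_of_ne_zero (f := (L : EN N →ₗ[ℝ] ℝ)) (by
      intro h
      apply hw0
      have := LinearMap.congr_fun h w0
      exact this)
    rw [finrank_EN] at h1
    have h2 : (Module.finrank ℝ F : ℝ) + 1 = 2 * N := by exact_mod_cast h1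
    linarith
  let P : EN N → F := fun z => ⟨z - L z • w, by simp [F, hw]⟩
  have hPc : Continuous P := by
    apply Continuous.subtype_mk
    fun_prop
  -- strict differentiability
  have hε : 0 < 1 / (2 * (‖w‖ + 1)) := by positivity
  have hlo := hst.isLittleO.def hε
  rw [nhds_prod_eq, Metric.nhds_basis_ball.prod_self.eventually_iff] at hlo
  obtain ⟨δ, hδ, hball⟩ := hlo
  refine ⟨δ, hδ, ?_⟩
  set S := frontier D ∩ ball p δ with hS
  have hanti : ∀ z ∈ S, ∀ z' ∈ S, ‖z - z'‖ ≤ 2 * ‖P z - P z'‖ := by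
    intro z hz z' hz'
    have h1 := @hball (z, z') ⟨hz.2, hz'.2⟩
    simp only [G.front hz.1, G.front hz'.1, sub_self, zero_sub, norm_neg] at h1
    have h2 : ‖P z - P z'‖ = ‖(z - z') - L (z - z') • w‖ := by
      have e : ((P z - P z' : F) : EN N) = (z - z') - L (z - z') • w := by
        simp only [P, Submodule.coe_sub, map_sub]
        module
      rw [← e]; rfl
    have h3 := norm_sub_norm_le (z - z') (L (z - z') • w)
    rw [← h2, norm_smul] at h3
    have h4 : ‖L (z - z')‖ * ‖w‖ ≤ ‖z - z'‖ / 2 := by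
      calc _ ≤ 1 / (2 * (‖w‖ + 1)) * ‖z - z'‖ * (‖w‖ + 1) := by gcongr; linarith
        _ = _ := by field_simp
    linarith
  let g : F → EN N := Function.invFunOn P S
  have hgP : ∀ z ∈ S, g (P z) = z := by
    intro z hz
    have hm : P z ∈ P '' S := mem_image_of_mem _ hz
    have h1 : g (P z) ∈ S := Function.invFunOn_mem hm
    have h2 : P (g (P z)) = P z := Function.invFunOn_eq hm
    have h3 := hanti _ h1 _ hz
    rw [h2, sub_self, norm_zero, mul_zero] at h3
    exact sub_eq_zero.1 (norm_le_zero_iff.1 h3)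
  have hglip : LipschitzOnWith 2 g (P '' S) := by
    refine LipschitzOnWith.of_dist_le_mul ?_
    rintro _ ⟨z, hz, rfl⟩ _ ⟨z', hz', rfl⟩
    rw [hgP z hz, hgP z' hz', dist_eq_norm, dist_eq_norm]
    simpa using hanti z hz z' hz'
  have himg : g '' (P '' S) = S := by
    ext z
    constructor
    · rintro ⟨_, ⟨z', hz', rfl⟩, rfl⟩
      rw [hgP z' hz']; exact hz'
    · intro hz
      exact ⟨P z, mem_image_of_mem _ hz, hgP z hz⟩
  have hd : 0 ≤ 2 * (N:ℝ) - 1 := by rw [← hfin]; positivity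
  have h1 := hglip.hausdorffMeasure_image_le hd
  rw [himg] at h1
  refine h1.trans_lt (ENNReal.mul_lt_top ?_ ?_)
  · exact ENNReal.rpow_lt_top_of_nonneg hd (by simp)
  · rw [← hfin]
    haveI : (Measure.hausdorffMeasure (Module.finrank ℝ F : ℝ) : Measure F).IsAddHaarMeasure :=
      isAddHaarMeasure_hausdorffMeasure
    have hcpt : IsCompact (P '' closedBall p δ) := (isCompact_closedBall p δ).image hPc
    exact (measure_mono (image_mono (inter_subset_right.trans ball_subset_closedBall))).trans_lt hcpt.measure_lt_top

lemma Geo.surf_finite (G : Geo D ρ V) : IsFiniteMeasure (surfMeasure D) := by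
  refine ⟨?_⟩
  rw [surfMeasure, Measure.restrict_apply_univ]
  have hc : IsCompact (frontier D) := G.cpt.of_isClosed_subset isClosed_frontier frontier_subset_closure
  refine hc.measure_lt_top_of_nhdsWithin fun x hx => ?_
  obtain ⟨δ, hδ, h⟩ := G.surf_local hx
  exact ⟨_, inter_mem_nhdsWithin _ (ball_mem_nhds x hδ), h⟩

end LP
end

noncomputable section
open Set Filter Topology Metric MeasureTheory
open scoped ENNReal NNReal InnerProductSpace ComplexConjugate Uniformity UniformConvergence
namespace LP
variable {N : ℕ} {D K V : Set (EN N)} {ρ : EN N → ℝ} {μ : Measure (EN N)}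

lemma cauchy_fderiv (hD : IsOpen D) {f : EN N → ℂ} (hf : DifferentiableOn ℂ f D) {z : EN N} {R M : ℝ} (hR : 0 < R)
    (hz : closedBall z R ⊆ D) (hM : ∀ w ∈ closedBall z R, ‖f w‖ ≤ M) : ‖fderiv ℂ f z‖ ≤ M / R := by
  have hzD : z ∈ D := hz (mem_closedBall_self hR.le)
  have hM0 : 0 ≤ M := (norm_nonneg _).trans (hM z (mem_closedBall_self hR.le))
  refine ContinuousLinearMap.opNorm_le_bound _ (by positivity) fun v => ?_
  rcases eq_or_ne v 0 with rfl | hv0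
  · simp
  have hv : 0 < ‖v‖ := norm_pos_iff.2 hv0
  have hRv : 0 < R / ‖v‖ := by positivity
  have hfz : DifferentiableAt ℂ f z := hf.differentiableAt (hD.mem_nhds hzD)
  have hline : ∀ t ∈ closedBall (0:ℂ) (R/‖v‖), z + t • v ∈ closedBall z R := by
    intro t ht
    rw [mem_closedBall_iff_norm, add_sub_cancel_left, norm_smul, ← le_div_iff₀ hv]
    simpa using ht
  have hd : DifferentiableOn ℂ (fun t : ℂ => f (z + t • v)) (closedBall 0 (R/‖v‖)) := by
    refine hf.comp (f := fun t : ℂ => z + t • v) (by fun_prop) fun t ht => hz (hline t ht)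
  have hder : HasDerivAt (fun t : ℂ => f (z + t • v)) (fderiv ℂ f z v) 0 := by
    have h1 : HasDerivAt (fun t : ℂ => z + t • v) v 0 := by
      simpa using ((hasDerivAt_id (0:ℂ)).smul_const v).const_add z
    have h2 : HasFDerivAt f (fderiv ℂ f z) (z + (0:ℂ) • v) := by simpa using hfz.hasFDerivAt
    exact h2.comp_hasDerivAt (0:ℂ) h1
  rw [← hder.deriv]
  have e : M / R * ‖v‖ = M / (R / ‖v‖) := by field_simp
  rw [e]
  refine Complex.norm_deriv_le_of_forall_mem_sphere_norm_le hRv ?_ fun t ht => hM _ (hline t (sphere_subset_closedBall ht))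
  refine DifferentiableOn.diffContOnCl ?_
  rwa [closure_ball _ hRv.ne']

lemma hol_limit (hD : IsOpen D) {F : ℕ → EN N → ℂ} {f : EN N → ℂ} (hF : ∀ n, DifferentiableOn ℂ (F n) D)
    (hlim : ∀ K, K ⊆ D → IsCompact K → TendstoUniformlyOn F f atTop K) : DifferentiableOn ℂ f D := by
  intro x hx
  obtain ⟨R, hR, hRD⟩ := Metric.nhds_basis_closedBall.mem_iff.1 (hD.mem_nhds hx)
  have hR2 : 0 < R / 2 := by positivity
  have hK := hlim _ hRD (isCompact_closedBall x R)
  have hcau := hK.uniformCauchySeqOn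
  rw [Metric.uniformCauchySeqOn_iff] at hcau
  have hd : UniformCauchySeqOn (fun n => fderiv ℂ (F n)) atTop (ball x (R/2)) := by
    rw [Metric.uniformCauchySeqOn_iff]
    intro ε he
    obtain ⟨n0, hn0⟩ := hcau (ε * (R/2) / 2) (by positivity)
    refine ⟨n0, fun p hp q hq z hz => ?_⟩
    have hsub : closedBall z (R/2) ⊆ closedBall x R := by
      apply closedBall_subset_closedBall'
      have := mem_ball.1 hz
      linarith
    have hzD : z ∈ D := hRD (hsub (mem_closedBall_self hR2.le))
    have h1 := cauchy_fderiv hD ((hF p).fun_sub (hF q)) hR2 (hsub.trans hRD) (M := ε * (R/2) / 2) (fun w hw => by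
      rw [← dist_eq_norm]; exact (hn0 p hp q hq w (hsub hw)).le)
    rw [fderiv_fun_sub ((hF p).differentiableAt (hD.mem_nhds hzD)) ((hF q).differentiableAt (hD.mem_nhds hzD))] at h1
    rw [dist_eq_norm]
    refine h1.trans_lt ?_
    rw [div_lt_iff₀ hR2]
    nlinarith
  have hpt : ∀ z ∈ ball x (R/2), ∃ l, Tendsto (fun n => fderiv ℂ (F n) z) atTop (𝓝 l) := fun z hz =>
    cauchySeq_tendsto_of_complete (hd.cauchySeq hz)
  choose! g' hg' using hpt
  have hunif : TendstoUniformlyOn (fun n => fderiv ℂ (F n)) g' atTop (ball x (R/2)) :=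
    hd.tendstoUniformlyOn_of_tendsto hg'
  have hbD : ball x (R/2) ⊆ D := (ball_subset_closedBall.trans (closedBall_subset_closedBall (by linarith))).trans hRD
  refine (hasFDerivAt_of_tendstoUniformlyOn (f := F) isOpen_ball hunif (fun n z hz => ?_) (fun z hz => ?_) (mem_ball_self hR2)).differentiableAt.differentiableWithinAt
  · exact ((hF n).differentiableAt (hD.mem_nhds (hbD hz))).hasFDerivAt
  · exact hK.tendsto_at (ball_subset_closedBall.trans (closedBall_subset_closedBall (by linarith)) hz)

/-- the compact sets of D -/
abbrev KK (D : Set (EN N)) : Set (Set (EN N)) := {K : Set (EN N) | K ⊆ D ∧ IsCompact K}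

lemma exhaustion (hD : IsOpen D) : ∃ t : ℕ → Set (EN N), (∀ n, t n ∈ KK D) ∧ Monotone t ∧
    ∀ s ∈ KK D, ∃ n, s ⊆ t n := by
  have : LocallyCompactSpace D := hD.locallyCompactSpace
  let e := CompactExhaustion.choice D
  refine ⟨fun n => (↑) '' (e n), fun n => ⟨by simp, (e.isCompact n).image continuous_subtype_val⟩,
    fun a b hab => image_mono (e.subset hab), fun s hs => ?_⟩
  have hc : IsCompact ((↑) ⁻¹' s : Set D) := by
    rw [Subtype.isCompact_iff, Subtype.image_preimage_coe, inter_eq_self_of_subset_right hs.1]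
    exact hs.2
  obtain ⟨n, hn⟩ := e.exists_superset_of_isCompact hc
  refine ⟨n, fun x hx => ⟨⟨x, hs.1 hx⟩, hn hx, rfl⟩⟩

lemma hol_baire (hD : IsOpen D) : BaireSpace (Hol D) := by
  obtain ⟨t, ht1, ht2, ht3⟩ := exhaustion hD
  have hcg : (𝓤 (EN N →ᵤ[KK D] ℂ)).IsCountablyGenerated :=
    UniformOnFun.isCountablyGenerated_uniformity _ ht1 ht2 ht3
  let J : Hol D → (EN N →ᵤ[KK D] ℂ) := fun f => UniformOnFun.ofFun (KK D) f.1
  letI U : UniformSpace (Hol D) := UniformSpace.comap J inferInstance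
  have hJ : IsUniformInducing J := ⟨rfl⟩
  have hclosed : IsClosed (range J) := by
    apply IsSeqClosed.isClosed
    intro u f hu hlim
    rw [UniformOnFun.tendsto_iff_tendstoUniformlyOn] at hlim
    refine ⟨⟨UniformOnFun.toFun (KK D) f, ?_⟩, rfl⟩
    refine hol_limit hD (F := fun n => UniformOnFun.toFun (KK D) (u n)) (fun n => ?_) fun K hK hK2 => hlim K ⟨hK, hK2⟩
    obtain ⟨g, hg⟩ := hu n
    rw [← hg]
    exact g.2
  have hcomp : CompleteSpace (Hol D) := hJ.completeSpace hclosed.isComplete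
  have hcg2 : (𝓤 (Hol D)).IsCountablyGenerated := by
    show (Filter.comap _ (𝓤 (EN N →ᵤ[KK D] ℂ))).IsCountablyGenerated
    infer_instance
  have : @BaireSpace (Hol D) U.toTopologicalSpace := inferInstance
  exact this

end LP
end

noncomputable section
open Set Filter Topology Metric MeasureTheory
open scoped ENNReal NNReal InnerProductSpace ComplexConjugate Uniformity UniformConvergence
namespace LP
variable {N : ℕ} {D K V : Set (EN N)} {ρ : EN N → ℝ} {μ : Measure (EN N)}

lemma meas_tri {a b c : EN N → ℂ} {s t ε : ℝ} (hst : s + t ≤ ε) {p q e : ℝ≥0∞}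
    (h1 : μ {x | s ≤ ‖a x - b x‖} < p) (h2 : μ {x | t ≤ ‖b x - c x‖} < q) (hpq : p + q ≤ e) :
    μ {x | ε ≤ ‖a x - c x‖} < e := by
  refine lt_of_lt_of_le (lt_of_le_of_lt ((measure_mono (fun x hx => ?_)).trans (measure_union_le _ _))
    (ENNReal.add_lt_add h1 h2)) hpq
  by_contra hcon
  simp only [mem_union, mem_ofPred_eq, not_or, not_le] at hcon
  have hx' : ε ≤ ‖a x - c x‖ := hx
  have := norm_sub_le_norm_sub_add_norm_sub (a x) (b x) (c x)
  linarith [hcon.1, hcon.2]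

lemma dense_family (μ : Measure (EN N)) [IsFiniteMeasure μ] : ∃ u : ℕ → EN N → ℂ, (∀ l, Continuous (u l)) ∧
    ∀ h : EN N → ℂ, Measurable h → ∀ ε > (0:ℝ), ∃ l, μ {x | ε ≤ ‖u l x - h x‖} < ENNReal.ofReal ε := by
  have hdr : DenseRange (BoundedContinuousFunction.toLp (E := ℂ) 1 μ ℂ) :=
    BoundedContinuousFunction.toLp_denseRange ℂ μ ℂ ENNReal.one_ne_top
  haveI : Fact ((1:ℝ≥0∞) ≠ ⊤) := ⟨ENNReal.one_ne_top⟩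
  haveI : SecondCountableTopology (Lp ℂ 1 μ) := inferInstance
  obtain ⟨t, ht1, htc, htd⟩ := Dense.exists_countable_dense_subset hdr
  obtain ⟨w, hw⟩ := htc.exists_eq_range htd.nonempty
  have hb : ∀ n, ∃ b : BoundedContinuousFunction (EN N) ℂ, BoundedContinuousFunction.toLp (E := ℂ) 1 μ ℂ b = w n :=
    fun n => ht1 (hw ▸ mem_range_self n)
  choose b hb using hb
  refine ⟨fun n => b n, fun n => (b n).continuous, fun h hh ε hε => ?_⟩
  have hofr : 0 < ENNReal.ofReal (ε/2) := ENNReal.ofReal_pos.2 (by positivity)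
  let hR : ℕ → EN N → ℂ := fun n => {x | ‖h x‖ ≤ n}.indicator h
  have hRm : ∀ n, Measurable (hR n) := fun n => hh.indicator (measurableSet_le hh.norm measurable_const)
  have t1 : TendstoInMeasure μ hR atTop h := by
    refine tendstoInMeasure_of_tendsto_ae (fun n => (hRm n).aestronglyMeasurable) (Eventually.of_forall fun x => ?_)
    refine tendsto_const_nhds.congr' ?_
    obtain ⟨n0, hn0⟩ := exists_nat_ge ‖h x‖
    filter_upwards [eventually_ge_atTop n0] with n hn
    have : x ∈ {x | ‖h x‖ ≤ n} := by
      rw [mem_ofPred_eq]; exact hn0.trans (by exact_mod_cast hn)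
    exact (indicator_of_mem this h).symm
  rw [tendstoInMeasure_iff_norm] at t1
  obtain ⟨n, hn⟩ := ((t1 (ε/2) (by positivity)).eventually (gt_mem_nhds hofr)).exists
  have hmem : MemLp (hR n) 1 μ := by
    refine MemLp.of_bound (hRm n).aestronglyMeasurable n (Eventually.of_forall fun x => ?_)
    by_cases hx : x ∈ {x | ‖h x‖ ≤ n}
    · simp only [hR, indicator_of_mem hx]; exact hx
    · simp only [hR, indicator_of_notMem hx]; simp
  obtain ⟨v, hvt, hv⟩ := mem_closure_iff_seq_limit.1 (htd (hmem.toLp (hR n)))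
  have t2 := tendstoInMeasure_of_tendsto_Lp hv
  rw [tendstoInMeasure_iff_norm] at t2
  obtain ⟨m, hm⟩ := ((t2 (ε/2) (by positivity)).eventually (gt_mem_nhds hofr)).exists
  obtain ⟨l, hl⟩ : v m ∈ range w := hw ▸ hvt m
  refine ⟨l, meas_tri (b := hR n) (s := ε/2) (t := ε/2) (by linarith) (p := ENNReal.ofReal (ε/2)) ?_ hn ?_⟩
  · refine lt_of_le_of_lt (measure_mono_ae ?_) hm
    have e1 := BoundedContinuousFunction.coeFn_toLp (p := 1) (𝕜 := ℂ) μ (b l)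
    rw [hb l, hl] at e1
    filter_upwards [e1, hmem.coeFn_toLp] with x h1 h2 hx
    have hx' : ε/2 ≤ ‖b l x - hR n x‖ := hx
    rw [← h1, ← h2] at hx'
    exact hx'
  · rw [← ENNReal.ofReal_add (by positivity) (by positivity)]; simp

lemma KK_dir : (KK D).Nonempty ∧ DirectedOn (· ⊆ ·) (KK D) :=
  ⟨⟨∅, empty_subset _, isCompact_empty⟩, fun A hA B hB => ⟨A ∪ B, ⟨union_subset hA.1 hB.1, hA.2.union hB.2⟩,
    subset_union_left, subset_union_right⟩⟩

lemma hol_basis (f : Hol D) : (𝓝 f).HasBasis (fun Si : Set (EN N) × ℝ => Si.1 ∈ KK D ∧ 0 < Si.2)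
    fun Si => {g : Hol D | ∀ x ∈ Si.1, ‖g.1 x - f.1 x‖ < Si.2} := by
  have h := (UniformOnFun.hasBasis_nhds_of_basis (EN N) ℂ (KK D) (UniformOnFun.ofFun (KK D) f.1) KK_dir.1 KK_dir.2
    Metric.uniformity_basis_dist).comap (fun f : Hol D => UniformOnFun.ofFun (KK D) f.1)
  rw [← nhds_induced] at h
  refine h.to_hasBasis (fun i hi => ⟨i, hi, ?_⟩) (fun i hi => ⟨i, hi, ?_⟩)
  · intro g hg x hx
    have := hg x hx
    rw [← dist_eq_norm] at this
    exact this
  · intro g hg x hx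
    have : dist (g.1 x) (f.1 x) < i.2 := hg x hx
    rwa [dist_eq_norm] at this

/-- The open dense sets of the Baire argument. -/
def VS (D : Set (EN N)) (μ : Measure (EN N)) (Γ : ℕ → EN N → EN N) (u : EN N → ℂ) (n : ℕ) : Set (Hol D) :=
  {f | ∃ j ≥ n, ∃ η < 1/((n:ℝ)+1), μ {x | η ≤ ‖f.1 (Γ j x) - u x‖} < ENNReal.ofReal (1/((n:ℝ)+1))}

lemma VS_open (hF : IsCompact (frontier D)) (hμ : ∀ᵐ x ∂μ, x ∈ frontier D) {Γ : ℕ → EN N → EN N}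
    (hΓc : ∀ j, ContinuousOn (Γ j) (frontier D))
    (hΓD : ∀ x ∈ frontier D, ∀ j, Γ j x ∈ D) (u : EN N → ℂ) (n : ℕ) : IsOpen (VS D μ Γ u n) := by
  rw [isOpen_iff_mem_nhds]
  rintro f ⟨j, hj, η, hη, hlt⟩
  have hKK : Γ j '' frontier D ∈ KK D := by
    refine ⟨?_, hF.image_of_continuousOn (hΓc j)⟩
    rintro _ ⟨x, hx, rfl⟩
    exact hΓD x hx j
  refine (hol_basis f).mem_iff.2 ⟨(Γ j '' frontier D, (1/((n:ℝ)+1) - η)/2), ⟨hKK, by simp only; linarith⟩, ?_⟩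
  intro g hg
  have hg' : ∀ x ∈ Γ j '' frontier D, ‖g.1 x - f.1 x‖ < (1/((n:ℝ)+1) - η)/2 := hg
  refine ⟨j, hj, (1/((n:ℝ)+1) + η)/2, by linarith, lt_of_le_of_lt (measure_mono_ae ?_) hlt⟩
  filter_upwards [hμ] with x hx hx2
  have h1 : (1/((n:ℝ)+1) + η)/2 ≤ ‖g.1 (Γ j x) - u x‖ := hx2
  have h2 := hg' _ (mem_image_of_mem _ hx)
  have h3 := norm_sub_le_norm_sub_add_norm_sub (g.1 (Γ j x)) (f.1 (Γ j x)) (u x)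
  have h4 : η ≤ ‖f.1 (Γ j x) - u x‖ := by linarith
  exact h4

lemma baire_main (hD : IsOpen D) (hF : IsCompact (frontier D)) [IsFiniteMeasure μ] (hμ : ∀ᵐ x ∂μ, x ∈ frontier D)
    {Γ : ℕ → EN N → EN N} (hΓm : ∀ j, AEMeasurable (Γ j) μ)
    (hΓc : ∀ j, ContinuousOn (Γ j) (frontier D))
    (hΓD : ∀ x ∈ frontier D, ∀ j, Γ j x ∈ D)
    (hΓ1 : ∀ x ∈ frontier D, Tendsto (fun j => Γ j x) atTop (𝓝 x))
    (hΓZ : ∀ K, IsCompact K → K ⊆ D → ∀ x ∈ frontier D, ∀ᶠ j in atTop, Γ j x ∈ ZSet D K) :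
    ResidualIn {f : Hol D | ∀ h : EN N → ℂ, Measurable h → ∃ φ : ℕ → ℕ, StrictMono φ ∧
      ∀ᵐ x ∂ μ, Tendsto (fun k => f.1 (Γ (φ k) x)) atTop (𝓝 (h x))} := by
  obtain ⟨u, huc, hu⟩ := dense_family μ
  haveI := hol_baire hD
  have hop : ∀ p : ℕ × ℕ, IsOpen (VS D μ Γ (u p.1) p.2) := fun p => VS_open hF hμ hΓc hΓD _ _
  refine ⟨⋂ p : ℕ × ℕ, VS D μ Γ (u p.1) p.2, ?_, IsGδ.iInter_of_isOpen hop, dense_iInter_of_isOpen hop fun p => ?_⟩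
  · intro f hf h hh
    rw [mem_iInter] at hf
    have key : ∀ n : ℕ, ∃ᶠ j in atTop, μ {x | 1/((n:ℝ)+1) ≤ ‖f.1 (Γ j x) - h x‖} < ENNReal.ofReal (1/((n:ℝ)+1)) := by
      intro n
      rw [frequently_atTop]
      intro M
      have hpos : 0 < 1/((n:ℝ)+1) := by positivity
      obtain ⟨l, hl⟩ := hu h hh (1/((n:ℝ)+1)/2) (by positivity)
      obtain ⟨j, hj, η, hη, hlt⟩ := hf (l, max M (2*n+1))
      have hle : 1/(((max M (2*n+1) : ℕ):ℝ)+1) ≤ 1/((n:ℝ)+1)/2 := by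
        rw [div_div]
        apply one_div_le_one_div_of_le (by positivity)
        have : ((2*n+1 : ℕ):ℝ) ≤ ((max M (2*n+1) : ℕ):ℝ) := by exact_mod_cast le_max_right _ _
        push_cast at this ⊢
        linarith
      refine ⟨j, (le_max_left _ _).trans hj, meas_tri (b := u l) (s := η) (t := 1/((n:ℝ)+1)/2) ?_ hlt hl ?_⟩
      · simp only at hη; linarith
      · rw [← ENNReal.ofReal_add (by positivity) (by positivity)]
        apply ENNReal.ofReal_le_ofReal
        simp only; linarith
    obtain ⟨φ, hφ, hP⟩ := extraction_forall_of_frequently key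
    have ht : TendstoInMeasure μ (fun k x => f.1 (Γ (φ k) x)) atTop h := by
      rw [tendstoInMeasure_iff_norm]
      intro ε hε
      have h0 : Tendsto (fun n : ℕ => ENNReal.ofReal (1/((n:ℝ)+1))) atTop (𝓝 0) := by
        have := (ENNReal.continuous_ofReal.tendsto 0).comp tendsto_one_div_add_atTop_nhds_zero_nat
        rw [ENNReal.ofReal_zero] at this
        exact this
      refine tendsto_of_tendsto_of_tendsto_of_le_of_le' tendsto_const_nhds h0 (Eventually.of_forall fun _ => bot_le) ?_
      filter_upwards [tendsto_one_div_add_atTop_nhds_zero_nat.eventually (gt_mem_nhds hε)] with n hn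
      refine le_trans (measure_mono fun x hx => ?_) (hP n).le
      have hx' : ε ≤ ‖f.1 (Γ (φ n) x) - h x‖ := hx
      exact hn.le.trans hx'
    obtain ⟨ns, hns, hae⟩ := ht.exists_seq_tendsto_ae
    exact ⟨φ ∘ ns, hφ.comp hns, hae⟩
  · obtain ⟨l, n⟩ := p
    intro f
    rw [mem_closure_iff_nhds_basis (hol_basis f)]
    rintro ⟨K, δ⟩ ⟨hK, hδ⟩
    have hδ : 0 < δ := hδ
    have hpos : 0 < 1/((n:ℝ)+1) := by positivity
    have hη : 0 < min δ (1/((n:ℝ)+1)/2) := lt_min hδ (by positivity)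
    have hη2 : min δ (1/((n:ℝ)+1)/2) < 1/((n:ℝ)+1) := lt_of_le_of_lt (min_le_right _ _) (by linarith)
    obtain ⟨j, hj, F, hF1, hF2, hF3⟩ := density_step hD hK.2 hK.1 hμ hΓm hΓD hΓ1 (hΓZ K hK.2 hK.1) (g := f.1) f.2
      (huc l) hη n
    exact ⟨⟨F, hF1⟩, ⟨j, hj, _, hη2, hF3.trans_le (ENNReal.ofReal_le_ofReal hη2.le)⟩,
      fun x hx => (hF2 x hx).trans_le (min_le_left _ _)⟩

lemma final {D : Set (EN N)} {ρ : EN N → ℝ} (hD : StrictPSCWith D ρ)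
    {γ : EN N × ℝ → EN N} (hγ : GammaMap D ρ γ 1)
    {r : ℕ → ℝ} (hmem : ∀ j, r j ∈ Ioo (0:ℝ) 1)
    (hlim : Tendsto r atTop (𝓝 1)) :
    ResidualIn (WSet D γ r) := by
  obtain ⟨V, hV⟩ := hD.2.2.1
  have G : Geo D ρ V := ⟨hD.1.1, hD.2.1, hV, hD.2.2.2⟩
  haveI := G.surf_finite
  have hF : IsCompact (frontier D) :=
    Metric.isCompact_of_isClosed_isBounded isClosed_frontier (hD.2.1.closure.subset frontier_subset_closure)
  have hrI : ∀ j, r j ∈ Icc (0:ℝ) 1 := fun j => ⟨(hmem j).1.le, (hmem j).2.le⟩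
  have hc : ∀ j, ContinuousOn (fun x => γ (x, r j)) (frontier D) := fun j =>
    hγ.1.continuousOn.comp (by fun_prop) fun x hx => ⟨hx, hrI j⟩
  have hder : ∀ x ∈ frontier D, DifferentiableWithinAt ℝ (fun s => γ (x, s)) (Icc 0 1) 1 := by
    intro x hx
    have h1 := hγ.1.differentiableOn one_ne_zero (x, 1) ⟨hx, right_mem_Icc.2 zero_le_one⟩
    exact h1.comp (f := fun s : ℝ => (x, s)) 1 (by fun_prop) fun s hs => ⟨hx, hs⟩
  refine baire_main (μ := surfMeasure D) (Γ := fun j x => γ (x, r j)) hD.1.1 hF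
    (ae_restrict_mem isClosed_frontier.measurableSet)
    (fun j => (hc j).aemeasurable isClosed_frontier.measurableSet) hc
    (fun x hx j => hγ.2.1 x hx _ ⟨(hmem j).1.le, (hmem j).2⟩) ?_ ?_
  · intro x hx
    have h1 : Tendsto (fun s => γ (x, s)) (𝓝[Icc 0 1] 1) (𝓝 (γ (x, 1))) := (hder x hx).continuousWithinAt
    rw [hγ.2.2.1 x hx] at h1
    exact h1.comp (tendsto_nhdsWithin_iff.2 ⟨hlim, Eventually.of_forall hrI⟩)
  · intro K hK hKD x hx
    exact eventually_ZSet G hK hKD hx (hder x hx).hasDerivWithinAt (hγ.2.2.1 x hx) (fun s hs => hγ.2.1 x hx s hs)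
      (hγ.2.2.2 x hx) hmem hlim

end LP
end

/-- **Theorem B (residuality).** Let `D` be strictly pseudoconvex and let `γ` be a `C¹` map
`bD × [0,1] → cl D` as above satisfying (†). Let `(r_j)` be an increasing sequence in `(0,1)`
tending to `1`. Then the set `𝒲((r_j))` of all `f ∈ 𝒪(D)` such that every measurable
`h : bD → ℂ` is, for almost every `x ∈ bD` (surface measure), the limit of
`f(γ(x, r_{j_k}))` along some subsequence, is residual in `𝒪(D)`. -/
theorem theoremB_residual {N : ℕ} (D : Set (EN N)) (ρ : EN N → ℝ) (hD : StrictPSCWith D ρ)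
    (γ : EN N × ℝ → EN N) (hγ : GammaMap D ρ γ 1) (hdag : Dagger D ρ γ)
    (r : ℕ → ℝ) (hmono : StrictMono r) (hmem : ∀ j, r j ∈ Ioo (0:ℝ) 1)
    (hlim : Tendsto r atTop (𝓝 1)) :
    ResidualIn (WSet D γ r) := by
  exact LP.final hD hγ hmem hlim
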